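/- arXiv:1810.06310 — 4 statements merged into one kernel-verified Lean document; each statement's English description precedes it below -/
import Mathlib

section
/- Let P(x) = x^d − a ∈ ℤ[x] with d ≥ 2, gcd(d, a) = 1, and a squarefree with a ≠ ±1. Then there exists a constant c > 0, depending only on d and a, such that there are infinitely many primes p with the property that P has no root modulo p and p − G_P(p) ≥ c · (log log log p)/(log log log log p). -/
open Polynomial Finset

/-- `Fprod P n = ∏_{i=1}^n P(i)`. -/
noncomputable def Fprod (P : Polynomial ℤ) (n : ℕ) : ℤ := ∏ i ∈ Finset.Icc 1 n, P.eval (i : ℤ)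

/-- `Gval P p = #{F_P(n) mod p : 1 ≤ n ≤ p}`. -/
noncomputable def Gval (P : Polynomial ℤ) (p : ℕ) : ℕ :=
  ((Finset.Icc 1 p).image (fun n => ((Fprod P n : ZMod p)))).card

namespace MissingValues

open NumberField

section Counting

variable {K : Type*} [Field K] [NumberField K]

lemma finite_house_le (T : ℝ) : {x : 𝓞 K | house (x : K) ≤ T}.Finite := by
  have h := NumberField.Embeddings.finite_of_norm_le K ℂ T
  refine Set.Finite.of_finite_image (f := fun x : 𝓞 K => (x : K)) (h.subset ?_) ?_
  · rintro _ ⟨x, hx, rfl⟩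
    exact ⟨x.isIntegral_coe, fun φ => (norm_embedding_le_house _ φ).trans hx⟩
  · exact fun x _ y _ h => RingOfIntegers.ext h

variable (K) in
/-- The algebraic integers all of whose conjugates have absolute value at most `T`. -/
noncomputable def houseBall (T : ℝ) : Finset (𝓞 K) := (finite_house_le T).toFinset

@[simp] lemma mem_houseBall {T : ℝ} {x : 𝓞 K} : x ∈ houseBall K T ↔ house (x : K) ≤ T := by
  simp [houseBall]

lemma houseBall_mono {S T : ℝ} (h : S ≤ T) : houseBall K S ⊆ houseBall K T := by
  intro x hx
  rw [mem_houseBall] at hx ⊢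
  exact hx.trans h

lemma house_natCast (a : ℕ) : house ((a : 𝓞 K) : K) = a := by
  have := house_intCast (K := K) (a : ℤ)
  simpa using this

lemma house_neg (x : K) : house (-x) = house x := by
  simp [house]

lemma house_sub_le (x y : K) : house (x - y) ≤ house x + house y := by
  rw [sub_eq_add_neg, ← house_neg y]
  exact house_add_le _ _

open Classical in
lemma card_houseBall_le {I : Ideal (𝓞 K)} (hI : I ≠ ⊥) {D : ℝ}
    (hD : ∀ z : 𝓞 K, ∃ u ∈ I, house ((z - u : 𝓞 K) : K) ≤ D) (T : ℝ) :
    (houseBall K T).card ≤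
      Ideal.absNorm I * ((houseBall K (T + D)).filter (· ∈ I)).card := by
  have : Finite (𝓞 K ⧸ I) := Ideal.finiteQuotientOfFreeOfNeBot I hI
  have := Fintype.ofFinite (𝓞 K ⧸ I)
  rw [Finset.card_eq_sum_card_fiberwise (f := Ideal.Quotient.mk I) (t := Finset.univ)
    (by simp), Ideal.absNorm_apply, Submodule.cardQuot_apply, Nat.card_eq_fintype_card,
    ← Finset.card_univ, ← smul_eq_mul]
  refine Finset.sum_le_card_nsmul _ _ _ fun c _ => ?_
  obtain ⟨z, rfl⟩ := Ideal.Quotient.mk_surjective c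
  obtain ⟨u, hu, hz⟩ := hD z
  refine Finset.card_le_card_of_injOn (fun x => x - (z - u)) ?_ ?_
  · intro x hx
    simp only [coe_filter, mem_houseBall, Set.mem_ofPred_eq] at hx ⊢
    refine ⟨?_, ?_⟩
    · push_cast at hz ⊢
      exact (house_sub_le _ _).trans (add_le_add hx.1 hz)
    · rw [← sub_add]
      exact I.add_mem (Ideal.Quotient.eq.1 hx.2) hu
  · intro x _ y _ h
    simpa using h

open Classical in
lemma absNorm_mul_card_le {I : Ideal (𝓞 K)} (hI : I ≠ ⊥) {D : ℝ}
    (hD : ∀ z : 𝓞 K, ∃ u ∈ I, house ((z - u : 𝓞 K) : K) ≤ D) (T : ℝ) :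
    Ideal.absNorm I * ((houseBall K T).filter (· ∈ I)).card ≤ (houseBall K (T + D)).card := by
  have : Finite (𝓞 K ⧸ I) := Ideal.finiteQuotientOfFreeOfNeBot I hI
  have := Fintype.ofFinite (𝓞 K ⧸ I)
  rw [Finset.card_eq_sum_card_fiberwise (f := Ideal.Quotient.mk I) (t := Finset.univ)
    (s := houseBall K (T + D))
    (by simp), Ideal.absNorm_apply, Submodule.cardQuot_apply, Nat.card_eq_fintype_card,
    ← Finset.card_univ, ← smul_eq_mul]
  refine Finset.card_nsmul_le_sum _ _ _ fun c _ => ?_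
  obtain ⟨z, rfl⟩ := Ideal.Quotient.mk_surjective c
  obtain ⟨u, hu, hz⟩ := hD z
  refine Finset.card_le_card_of_injOn (fun x => x + (z - u)) ?_ ?_
  · intro x hx
    simp only [coe_filter, mem_houseBall, Set.mem_ofPred_eq] at hx ⊢
    refine ⟨?_, ?_⟩
    · push_cast at hz ⊢
      exact (house_add_le _ _).trans (add_le_add hx.1 hz)
    · rw [Ideal.Quotient.eq]
      have : x + (z - u) - z = x - u := by ring
      rw [this]
      exact I.sub_mem hx.2 hu
  · intro x _ y _ h
    simpa using h

/-- `w` is a `ℚ`-basis of `K` consisting of integers of house at most `B`. -/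
structure IsShortBasis {ι : Type*} [Fintype ι] (w : ι → 𝓞 K) (B : ℝ) : Prop where
  linearIndependent : LinearIndependent ℚ (fun i => (w i : K))
  span_eq_top : Submodule.span ℚ (Set.range fun i => (w i : K)) = ⊤
  house_le : ∀ i, house (w i : K) ≤ B

variable {ι : Type*} [Fintype ι] {w : ι → 𝓞 K} {B : ℝ}

lemma IsShortBasis.card_eq (h : IsShortBasis w B) : Fintype.card ι = Module.finrank ℚ K := by
  rw [← Module.finrank_eq_card_basis (Module.Basis.mk h.linearIndependent h.span_eq_top.ge)]

lemma IsShortBasis.house_sum_le (h : IsShortBasis w B) {c : ι → ℚ} {t : ℝ} (ht : 0 ≤ t)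
    (hc : ∀ i, |(c i : ℝ)| ≤ t) :
    house (∑ i, (c i : K) * (w i : K)) ≤ Module.finrank ℚ K * B * t := by
  have hq : ∀ q : ℚ, house (q : K) ≤ |(q : ℝ)| := by
    intro q
    rw [house, pi_norm_le_iff_of_nonneg (abs_nonneg _)]
    intro σ
    simp [canonicalEmbedding.apply_at]
  calc house (∑ i, (c i : K) * (w i : K)) ≤ ∑ i, house ((c i : K) * (w i : K)) :=
        house_sum_le_sum_house _ _
    _ ≤ ∑ i : ι, t * B := by
        refine Finset.sum_le_sum fun i _ => (house_mul_le _ _).trans ?_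
        exact mul_le_mul ((hq _).trans (hc i)) (h.house_le i) (house_nonneg _) ht
    _ = _ := by
        rw [Finset.sum_const, Finset.card_univ, h.card_eq, nsmul_eq_mul]; ring

lemma IsShortBasis.exists_sub_house_le (h : IsShortBasis w B) (I : Ideal (𝓞 K)) {v : 𝓞 K}
    (hv : v ∈ I) (hv0 : v ≠ 0) (z : 𝓞 K) :
    ∃ u ∈ I, house ((z - u : 𝓞 K) : K) ≤ Module.finrank ℚ K * B * house (v : K) := by
  let b := Module.Basis.mk h.linearIndependent h.span_eq_top.ge
  let x : ι → ℚ := fun i => b.repr ((z : K) / v) i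
  refine ⟨v * ∑ i, (⌊x i⌋ : 𝓞 K) * w i, I.mul_mem_right _ hv, ?_⟩
  have hv0' : (v : K) ≠ 0 := by simpa using hv0
  have hz : (z : K) = v * ∑ i, (x i : K) * (w i : K) := by
    have := b.sum_repr ((z : K) / v)
    rw [show ∑ i, (x i : K) * (w i : K) = (z : K) / v by
      rw [← this]
      refine Finset.sum_congr rfl fun i _ => ?_
      rw [Module.Basis.mk_apply, Rat.smul_def]]
    field_simp
  have : ((z - v * ∑ i, (⌊x i⌋ : 𝓞 K) * w i : 𝓞 K) : K)
      = v * ∑ i, ((Int.fract (x i) : ℚ) : K) * (w i : K) := by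
    simp only [map_sub, map_mul, map_sum, map_intCast]
    rw [show algebraMap (𝓞 K) K z = _ from hz, ← mul_sub, ← Finset.sum_sub_distrib]
    congr 1
    refine Finset.sum_congr rfl fun i _ => ?_
    rw [← sub_mul]
    congr 1
    rw [Int.fract]
    push_cast
    ring
  rw [this]
  refine (house_mul_le _ _).trans ?_
  rw [mul_comm]
  refine mul_le_mul_of_nonneg_right ?_ (house_nonneg _)
  have := h.house_sum_le (c := fun i => Int.fract (x i)) (t := 1) zero_le_one (fun i => by
    have h1 := Int.fract_nonneg (x i)
    have h2 := (Int.fract_lt_one (x i)).le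
    rw [abs_of_nonneg (by exact_mod_cast h1)]
    exact_mod_cast h2)
  simpa using this

variable (K) in
/-- Quantitative information on the lattice `𝓞 K` provided by a short basis. -/
structure LatticeBound (c : ℕ) : Prop where
  one_le : 1 ≤ c
  cover : ∀ (I : Ideal (𝓞 K)) (v : 𝓞 K), v ∈ I → v ≠ 0 → ∀ z : 𝓞 K,
    ∃ u ∈ I, house ((z - u : 𝓞 K) : K) ≤ c * house (v : K)
  card_ge : ∀ m : ℕ, (m + 1) ^ Module.finrank ℚ K ≤ (houseBall K (c * m)).card

lemma IsShortBasis.latticeBound (h : IsShortBasis w B) {c : ℕ} (hc1 : 1 ≤ c)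
    (hc : Module.finrank ℚ K * B ≤ c) : LatticeBound K c where
  one_le := hc1
  cover I v hv hv0 z := by
    obtain ⟨u, hu, hz⟩ := h.exists_sub_house_le I hv hv0 z
    exact ⟨u, hu, hz.trans (mul_le_mul_of_nonneg_right hc (house_nonneg _))⟩
  card_ge m := by
    classical
    have hcard : (Fintype.piFinset fun _ : ι => Finset.range (m + 1)).card
        = (m + 1) ^ Module.finrank ℚ K := by
      simp [h.card_eq]
    rw [← hcard]
    refine Finset.card_le_card_of_injOn (fun f => ∑ i, (f i : 𝓞 K) * w i) ?_ ?_
    · intro f hf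
      simp only [Finset.mem_coe, Fintype.mem_piFinset, Finset.mem_range]
        at hf
      simp only [Finset.mem_coe, mem_houseBall, map_sum, map_mul, map_natCast]
      have := h.house_sum_le (c := fun i => (f i : ℚ)) (t := m) (Nat.cast_nonneg m) (fun i => by
        have := hf i
        simp only [Rat.cast_natCast, Nat.abs_cast, Nat.cast_le]
        omega)
      simp only [Rat.cast_natCast] at this
      exact this.trans (mul_le_mul_of_nonneg_right hc (Nat.cast_nonneg m))
    · intro f _ g _ hfg
      have h1 := congrArg (algebraMap (𝓞 K) K) hfg
      simp only [map_sum, map_mul, map_natCast] at h1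
      have h2 := Fintype.linearIndependent_iff.1 h.linearIndependent
        (fun i => (f i : ℚ) - (g i : ℚ)) (by
          simp only [sub_smul, Finset.sum_sub_distrib, Rat.smul_def, Rat.cast_natCast]
          exact sub_eq_zero.2 h1)
      funext i
      have := h2 i
      rw [sub_eq_zero] at this
      exact_mod_cast this

namespace LatticeBound

variable {c : ℕ} (hK : LatticeBound K c)
include hK

lemma growth (s : ℝ) {a b : ℕ} (ha : 0 < a) (hb : 0 < b) :
    a ^ Module.finrank ℚ K * (houseBall K s).card ≤
      b ^ Module.finrank ℚ K * (houseBall K (a * (s + c) / b + c)).card := by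
  classical
  have key : ∀ m : ℕ, 0 < m → (Ideal.span {(m : 𝓞 K)} ≠ ⊥ ∧
      Ideal.absNorm (Ideal.span {(m : 𝓞 K)}) = m ^ Module.finrank ℚ K ∧
      (∀ z : 𝓞 K, ∃ u ∈ Ideal.span {(m : 𝓞 K)}, house ((z - u : 𝓞 K) : K) ≤ c * m) ∧
      ∀ T : ℝ, ((houseBall K (m * T)).filter (· ∈ Ideal.span {(m : 𝓞 K)})).card =
        (houseBall K T).card) := by
    intro m hm
    have hm0 : (m : 𝓞 K) ≠ 0 := by exact_mod_cast hm.ne'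
    refine ⟨by simpa using hm0, ?_, ?_, ?_⟩
    · rw [Ideal.absNorm_span_natCast, RingOfIntegers.rank]
    · intro z
      have := hK.cover (Ideal.span {(m : 𝓞 K)}) m (Ideal.mem_span_singleton_self _) hm0 z
      rwa [house_natCast] at this
    · intro T
      symm
      refine Finset.card_bij (fun x _ => (m : 𝓞 K) * x) ?_ ?_ ?_
      · intro x hx
        rw [mem_houseBall] at hx
        simp only [mem_filter, mem_houseBall, map_mul, map_natCast]
        refine ⟨?_, Ideal.mul_mem_right _ _ (Ideal.mem_span_singleton_self _)⟩
        rw [house_nat_mul]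
        exact mul_le_mul_of_nonneg_left hx (Nat.cast_nonneg m)
      · intro x _ y _ h
        exact mul_left_cancel₀ hm0 h
      · intro y hy
        simp only [mem_filter, mem_houseBall, Ideal.mem_span_singleton] at hy
        obtain ⟨hy, x, rfl⟩ := hy
        refine ⟨x, ?_, rfl⟩
        simp only [map_mul, map_natCast] at hy
        rw [house_nat_mul] at hy
        rw [mem_houseBall]
        exact le_of_mul_le_mul_left hy (by exact_mod_cast hm)
  obtain ⟨a1, a2, a3, a4⟩ := key a ha
  obtain ⟨b1, b2, b3, b4⟩ := key b hb
  have h1 := absNorm_mul_card_le a1 a3 (a * s)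
  have h2 := card_houseBall_le b1 b3 (a * s + c * a)
  rw [a2, a4] at h1
  rw [b2] at h2
  have hb' : (b : ℝ) ≠ 0 := by exact_mod_cast hb.ne'
  rw [show (a * s + c * a + c * b : ℝ) = b * (a * (s + c) / b + c) by field_simp, b4] at h2
  exact h1.trans h2

lemma growth_fine {T : ℝ} (hT : c * (60 * Module.finrank ℚ K + 1) ≤ T) :
    ((houseBall K (T + T / (60 * Module.finrank ℚ K + 1))).card : ℝ) ≤
      11 / 10 * (houseBall K T).card := by
  set n := Module.finrank ℚ K with hn
  have hn0 : 0 < n := Module.finrank_pos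
  have hn1 : (1 : ℝ) ≤ n := by exact_mod_cast hn0
  have h := hK.growth (T + T / (60 * n + 1)) (a := 60 * n) (b := 60 * n + 3) (by omega) (by omega)
  have hsub : (houseBall K (((60 * n : ℕ) : ℝ) * (T + T / (60 * n + 1) + c) /
      ((60 * n + 3 : ℕ) : ℝ) + c)).card ≤ (houseBall K T).card := by
    refine Finset.card_le_card (houseBall_mono ?_)
    push_cast
    have hc : (c : ℝ) ≤ T / (60 * n + 1) := by
      rw [le_div_iff₀ (by positivity)]; exact hT
    have e : T = (60 * n + 1) * (T / (60 * n + 1)) := by field_simp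
    set r := T / (60 * n + 1) with hr
    rw [← le_sub_iff_add_le, div_le_iff₀ (by positivity)]
    rw [e]
    nlinarith
  replace h := h.trans (Nat.mul_le_mul_left _ hsub)
  rw [← hn] at h
  have h' : (60 * n : ℝ) ^ n * (houseBall K (T + T / (60 * n + 1))).card ≤
      (60 * n + 3 : ℝ) ^ n * (houseBall K T).card := by exact_mod_cast h
  have hpow : (60 * n + 3 : ℝ) ^ n ≤ 11 / 10 * (60 * n : ℝ) ^ n := by
    have e : (60 * n + 3 : ℝ) = (60 * n) * (1 / (20 * n) + 1) := by field_simp; ring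
    rw [e, mul_pow, mul_comm]
    refine mul_le_mul_of_nonneg_right ?_ (by positivity)
    calc (1 / (20 * n) + 1 : ℝ) ^ n ≤ (Real.exp (1 / (20 * n))) ^ n :=
          pow_le_pow_left₀ (by positivity) (Real.add_one_le_exp _) _
      _ = Real.exp (1 / 20) := by
          rw [← Real.exp_nat_mul]; congr 1; field_simp
      _ ≤ 11 / 10 := by
          have h1 := Real.add_one_le_exp (-(1 / 20) : ℝ)
          rw [Real.exp_neg] at h1
          have h2 := Real.exp_pos (1 / 20 : ℝ)
          rw [le_inv_comm₀ (by norm_num) h2] at h1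
          refine h1.trans (by norm_num)
  have hp : (0 : ℝ) < (60 * n : ℝ) ^ n := by positivity
  have := h'.trans (mul_le_mul_of_nonneg_right hpow (Nat.cast_nonneg _))
  refine le_of_mul_le_mul_left ?_ hp
  linarith

lemma growth_coarse {T : ℝ} (hT : 4 * c ≤ T) {l : ℕ} (hl : 1 ≤ l) :
    (houseBall K (l * T)).card ≤ (2 * l) ^ Module.finrank ℚ K * (houseBall K T).card := by
  have h := hK.growth (l * T) (a := 1) (b := 2 * l) one_pos (by omega)
  rw [one_pow, one_mul] at h
  refine h.trans (Nat.mul_le_mul_left _ (Finset.card_le_card (houseBall_mono ?_)))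
  have hl' : (1 : ℝ) ≤ l := by exact_mod_cast hl
  have hc : (0 : ℝ) ≤ c := Nat.cast_nonneg c
  push_cast
  rw [← le_sub_iff_add_le, div_le_iff₀ (by positivity)]
  nlinarith

lemma cover_of_absNorm_le {I : Ideal (𝓞 K)} (hI : I ≠ ⊥) {u : ℕ}
    (hu : Ideal.absNorm I ≤ u ^ Module.finrank ℚ K) (z : 𝓞 K) :
    ∃ v ∈ I, house ((z - v : 𝓞 K) : K) ≤ 2 * c ^ 2 * u := by
  classical
  have : Finite (𝓞 K ⧸ I) := Ideal.finiteQuotientOfFreeOfNeBot I hI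
  have := Fintype.ofFinite (𝓞 K ⧸ I)
  have hlt : (Finset.univ : Finset (𝓞 K ⧸ I)).card < (houseBall K (c * u)).card := by
    rw [Finset.card_univ, ← Nat.card_eq_fintype_card, ← Submodule.cardQuot_apply,
      ← Ideal.absNorm_apply]
    refine (hu.trans_lt ?_).trans_le (hK.card_ge u)
    exact Nat.pow_lt_pow_left (Nat.lt_succ_self u) Module.finrank_pos.ne'
  obtain ⟨x, hx, y, hy, hxy, he⟩ := Finset.exists_ne_map_eq_of_card_lt_of_maps_to hlt
    (f := Ideal.Quotient.mk I) (by simp)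
  rw [mem_houseBall] at hx hy
  obtain ⟨v, hv, hz⟩ := hK.cover I (x - y) (Ideal.Quotient.eq.1 he) (sub_ne_zero.2 hxy) z
  refine ⟨v, hv, hz.trans ?_⟩
  have : house ((x - y : 𝓞 K) : K) ≤ 2 * (c * u) := by
    simp only [map_sub]
    exact (house_sub_le _ _).trans (by linarith)
  calc (c : ℝ) * house ((x - y : 𝓞 K) : K) ≤ c * (2 * (c * u)) :=
        mul_le_mul_of_nonneg_left this (Nat.cast_nonneg c)
    _ = _ := by ring

end LatticeBound

end Counting

section Mertens

variable {K : Type*} [Field K] [NumberField K]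

lemma absNorm_span_eq_prod (α : 𝓞 K) :
    (Ideal.absNorm (Ideal.span {α}) : ℝ) = ∏ σ : K →+* ℂ, ‖σ (α : K)‖ := by
  rw [Ideal.absNorm_span_singleton]
  have h1 := Algebra.norm_eq_prod_embeddings ℚ ℂ (α : K)
  have h2 : Algebra.norm ℚ (α : K) = ((Algebra.norm ℤ α : ℤ) : ℚ) := by
    exact (Algebra.coe_norm_int α).symm
  have h3 : ∏ σ : K →+* ℂ, σ (α : K) = ((Algebra.norm ℤ α : ℤ) : ℂ) := by
    rw [h2] at h1
    simp only [map_intCast] at h1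
    rw [h1]
    exact (Fintype.prod_equiv (RingHom.equivRatAlgHom K ℂ) (fun f : K →+* ℂ => f (α : K))
      (fun φ => φ (α : K)) fun _ => rfl)
  rw [← norm_prod, h3, Complex.norm_intCast, Nat.cast_natAbs, Int.cast_abs]

lemma card_embeddings : (Finset.univ : Finset (K →+* ℂ)).card = Module.finrank ℚ K := by
  rw [Finset.card_univ, NumberField.Embeddings.card]

lemma absNorm_span_le {α : 𝓞 K} {T : ℝ} (h : house (α : K) ≤ T) :
    (Ideal.absNorm (Ideal.span {α}) : ℝ) ≤ T ^ Module.finrank ℚ K := by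
  rw [absNorm_span_eq_prod, ← card_embeddings, ← Finset.prod_const]
  exact Finset.prod_le_prod (fun _ _ => norm_nonneg _)
    fun σ _ => (norm_embedding_le_house _ σ).trans h

lemma le_absNorm_span {α : 𝓞 K} {t : ℝ} (ht : 0 ≤ t) (h : ∀ σ : K →+* ℂ, t ≤ ‖σ (α : K)‖) :
    t ^ Module.finrank ℚ K ≤ (Ideal.absNorm (Ideal.span {α}) : ℝ) := by
  rw [absNorm_span_eq_prod, ← card_embeddings, ← Finset.prod_const]
  exact Finset.prod_le_prod (fun _ _ => ht) fun σ _ => h σ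

lemma absNorm_span_pos {α : 𝓞 K} (h : α ≠ 0) : 0 < Ideal.absNorm (Ideal.span {α}) := by
  refine Nat.pos_of_ne_zero fun h0 => h ?_
  rwa [Ideal.absNorm_eq_zero_iff, Ideal.span_singleton_eq_bot] at h0

lemma absNorm_pos {I : Ideal (𝓞 K)} (h : I ≠ ⊥) : 0 < Ideal.absNorm I :=
  Nat.pos_of_ne_zero fun h0 => h (Ideal.absNorm_eq_zero_iff.1 h0)

lemma absNorm_le_of_mem {I : Ideal (𝓞 K)} {α : 𝓞 K} (hα : α ≠ 0) (h : α ∈ I) :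
    Ideal.absNorm I ≤ Ideal.absNorm (Ideal.span {α}) :=
  Nat.le_of_dvd (absNorm_span_pos hα) (Ideal.absNorm_dvd_absNorm_of_le
    ((Ideal.span_singleton_le_iff_mem _).2 h))

lemma two_le_absNorm {P : Ideal (𝓞 K)} (hP : P.IsPrime) (h0 : P ≠ ⊥) : 2 ≤ Ideal.absNorm P := by
  have h1 : Ideal.absNorm P ≠ 1 := fun h => hP.ne_top (Ideal.absNorm_eq_one_iff.1 h)
  have := absNorm_pos h0
  omega

lemma prod_absNorm_le {s : Finset (Ideal (𝓞 K))} (hs : ∀ P ∈ s, P.IsPrime ∧ P ≠ ⊥) {α : 𝓞 K}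
    (hα : α ≠ 0) (h : ∀ P ∈ s, α ∈ P) :
    ∏ P ∈ s, Ideal.absNorm P ≤ Ideal.absNorm (Ideal.span {α}) := by
  rw [← map_prod]
  refine Nat.le_of_dvd (absNorm_span_pos hα) (map_dvd _ ?_)
  refine Finset.prod_primes_dvd _ (fun P hP => ?_) fun P hP => ?_
  · exact Ideal.prime_of_isPrime (hs P hP).2 (hs P hP).1
  · rw [Ideal.dvd_span_singleton]
    exact h P hP

lemma sum_log_absNorm_le {s : Finset (Ideal (𝓞 K))} (hs : ∀ P ∈ s, P.IsPrime ∧ P ≠ ⊥) {α : 𝓞 K}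
    (hα : α ≠ 0) (h : ∀ P ∈ s, α ∈ P) :
    ∑ P ∈ s, Real.log (Ideal.absNorm P) ≤ Real.log (Ideal.absNorm (Ideal.span {α})) := by
  rw [← Real.log_prod fun P hP => by exact_mod_cast (absNorm_pos (hs P hP).2).ne']
  refine Real.log_le_log ?_ (by exact_mod_cast prod_absNorm_le hs hα h)
  exact Finset.prod_pos fun P hP => by exact_mod_cast absNorm_pos (hs P hP).2

open Classical in
lemma log_absNorm_span_le {α : 𝓞 K} (hα : α ≠ 0) {X : ℕ}
    (hX : Ideal.absNorm (Ideal.span {α}) ≤ X) {s : Finset (Ideal (𝓞 K))}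
    (hs : ∀ P : Ideal (𝓞 K), P.IsPrime → P ≠ ⊥ → Ideal.absNorm P ≤ X → P ∈ s) :
    Real.log (Ideal.absNorm (Ideal.span {α})) ≤
      ∑ P ∈ s, ∑ j ∈ Finset.Icc 1 X, if α ∈ P ^ j then Real.log (Ideal.absNorm P) else 0 := by
  set F := UniqueFactorizationMonoid.normalizedFactors (Ideal.span {α}) with hF
  have hne : Ideal.span {α} ≠ 0 := by simpa using hα
  have hFprime : ∀ P ∈ F, Prime P := fun P hP =>
    UniqueFactorizationMonoid.prime_of_normalized_factor P hP
  have hprod : F.prod = Ideal.span {α} := Ideal.prod_normalizedFactors_eq_self hne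
  have hmem : ∀ P ∈ F.toFinset, P.IsPrime ∧ P ≠ ⊥ ∧ α ∈ P := by
    intro P hP
    rw [Multiset.mem_toFinset] at hP
    have hp := hFprime P hP
    refine ⟨Ideal.isPrime_of_prime hp, hp.ne_zero, ?_⟩
    rw [← Ideal.dvd_span_singleton]
    exact UniqueFactorizationMonoid.dvd_of_mem_normalizedFactors hP
  have hlog : Real.log (Ideal.absNorm (Ideal.span {α})) =
      ∑ P ∈ F.toFinset, F.count P * Real.log (Ideal.absNorm P) := by
    conv_lhs => rw [← hprod, Finset.prod_multiset_count, map_prod, Nat.cast_prod]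
    rw [Real.log_prod fun P hP => by
      rw [map_pow]
      exact_mod_cast (pow_pos (absNorm_pos (hmem P hP).2.1) _).ne']
    refine Finset.sum_congr rfl fun P _ => ?_
    rw [map_pow, Nat.cast_pow, Real.log_pow]
  have hsub : F.toFinset ⊆ s := fun P hP =>
    hs P (hmem P hP).1 (hmem P hP).2.1 ((absNorm_le_of_mem hα (hmem P hP).2.2).trans hX)
  have hlognn : ∀ P : Ideal (𝓞 K), 0 ≤ Real.log (Ideal.absNorm P) := fun P =>
    Real.log_natCast_nonneg _
  rw [hlog]
  refine le_trans ?_ (Finset.sum_le_sum_of_subset_of_nonneg hsub fun P _ _ =>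
    Finset.sum_nonneg fun j _ => by split_ifs <;> simp [hlognn])
  refine Finset.sum_le_sum fun P hP => ?_
  rw [← Finset.sum_filter, Finset.sum_const, nsmul_eq_mul]
  refine mul_le_mul_of_nonneg_right ?_ (hlognn P)
  have hpow : ∀ j ≤ F.count P, P ^ j ∣ Ideal.span {α} := by
    intro j hj
    rw [← hprod, ← Multiset.prod_replicate]
    exact Multiset.prod_dvd_prod_of_le (Multiset.le_count_iff_replicate_le.1 hj)
  have hcount : F.count P ≤ X := by
    have h1 := Nat.le_of_dvd (absNorm_span_pos hα) (map_dvd Ideal.absNorm (hpow _ le_rfl))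
    rw [map_pow] at h1
    have h2 := Nat.pow_le_pow_left (two_le_absNorm (hmem P hP).1 (hmem P hP).2.1) (F.count P)
    exact (Nat.lt_two_pow_self.le.trans h2).trans (h1.trans hX)
  have : (Finset.Icc 1 (F.count P)).card ≤
      ((Finset.Icc 1 X).filter fun j => α ∈ P ^ j).card := by
    refine Finset.card_le_card fun j hj => ?_
    rw [Finset.mem_Icc] at hj
    rw [Finset.mem_filter, Finset.mem_Icc]
    exact ⟨⟨hj.1, hj.2.trans hcount⟩, Ideal.dvd_span_singleton.1 (hpow j hj.2)⟩
  rw [Nat.card_Icc, Nat.add_sub_cancel] at this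
  exact_mod_cast this

namespace LatticeBound

variable {c : ℕ} (hK : LatticeBound K c)
include hK

/-- Upper half of Mertens' theorem for the primes of a number field. -/
theorem sum_log_div_le {u : ℕ} (hu : 1 ≤ u) {s : Finset (Ideal (𝓞 K))}
    (hs : ∀ P ∈ s, P.IsPrime ∧ P ≠ ⊥ ∧ Ideal.absNorm P ≤ u ^ Module.finrank ℚ K) :
    ∑ P ∈ s, Real.log (Ideal.absNorm P) / Ideal.absNorm P ≤
      5 / 4 * (Module.finrank ℚ K * (Real.log u +
        Real.log (2 * c ^ 2 * (60 * Module.finrank ℚ K + 2)))) := by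
  classical
  set n := Module.finrank ℚ K with hn
  have hn0 : 0 < n := Module.finrank_pos
  have hn1 : (1 : ℝ) ≤ n := by exact_mod_cast hn0
  have hu1 : (1 : ℝ) ≤ u := by exact_mod_cast hu
  have hc1 : (1 : ℝ) ≤ c := by exact_mod_cast hK.one_le
  set T' : ℝ := 2 * c ^ 2 * (60 * n + 1) * u with hT'
  set T : ℝ := T' + T' / (60 * n + 1) with hT
  have hTD : T = T' + 2 * c ^ 2 * u := by
    rw [hT, hT']; field_simp
  have hTe : T = 2 * c ^ 2 * (60 * n + 2) * u := by rw [hTD, hT']; ring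
  have hcc : (c : ℝ) ≤ 2 * c ^ 2 * u := by nlinarith [mul_le_mul hc1 hu1 zero_le_one (by linarith)]
  have hgrow : ((houseBall K T).card : ℝ) ≤ 11 / 10 * (houseBall K T').card := by
    refine hK.growth_fine ?_
    rw [hT', ← hn]
    have : (0 : ℝ) ≤ 60 * n + 1 := by positivity
    nlinarith
  set S := (houseBall K T).filter (· ≠ 0) with hS
  have hSpos : (0 : ℝ) < (houseBall K T).card := by
    have : (0 : 𝓞 K) ∈ houseBall K T := by
      rw [mem_houseBall]
      simp only [map_zero, house, norm_zero]
      rw [hTe]; positivity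
    exact_mod_cast Finset.card_pos.2 ⟨0, this⟩
  have hlower : ∀ P ∈ s, 4 / 5 * ((houseBall K T).card : ℝ) / Ideal.absNorm P ≤
      ((S.filter (· ∈ P)).card : ℝ) := by
    intro P hP
    obtain ⟨hp, hp0, hle⟩ := hs P hP
    have hNpos : (0 : ℝ) < Ideal.absNorm P := by exact_mod_cast absNorm_pos hp0
    have h1 := card_houseBall_le hp0 (hK.cover_of_absNorm_le hp0 hle) T'
    rw [← hTD] at h1
    have h1' : ((houseBall K T').card : ℝ) ≤
        Ideal.absNorm P * ((houseBall K T).filter (· ∈ P)).card := by exact_mod_cast h1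
    have h2 : ((houseBall K T).filter (· ∈ P)).card ≤ (S.filter (· ∈ P)).card + 1 := by
      rw [← Finset.card_singleton (0 : 𝓞 K)]
      refine (Finset.card_le_card ?_).trans (Finset.card_union_le _ _)
      intro x hx
      by_cases hx0 : x = 0
      · simp [hx0]
      · simp only [hS, mem_union, mem_filter, mem_singleton] at hx ⊢
        exact Or.inl ⟨⟨hx.1, hx0⟩, hx.2⟩
    have h2' : (((houseBall K T).filter (· ∈ P)).card : ℝ) ≤ (S.filter (· ∈ P)).card + 1 := by
      exact_mod_cast h2
    have h3 : 60 * (Ideal.absNorm P : ℝ) ≤ (houseBall K T).card := by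
      have h4 := hK.card_ge (60 * u)
      have h5 : (houseBall K (c * (60 * u : ℕ))).card ≤ (houseBall K T).card := by
        refine Finset.card_le_card (houseBall_mono ?_)
        rw [hTe]
        push_cast
        have e : (c : ℝ) * 1 ≤ c * c := mul_le_mul_of_nonneg_left hc1 (by linarith)
        have e2 : (60 : ℝ) * (c * u) ≤ 60 * (c * c * u) := by gcongr; linarith
        have e3 : (60 : ℝ) * (c * c * u) ≤ (120 * n + 4) * (c * c * u) := by gcongr; linarith
        linarith
      have h6 : 60 * Ideal.absNorm P ≤ (60 * u + 1) ^ n := by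
        calc 60 * Ideal.absNorm P ≤ 60 ^ n * u ^ n :=
              Nat.mul_le_mul (Nat.le_self_pow hn0.ne' _) hle
          _ = (60 * u) ^ n := (mul_pow _ _ _).symm
          _ ≤ _ := Nat.pow_le_pow_left (Nat.le_succ _) _
      exact_mod_cast h6.trans (h4.trans h5)
    rw [div_le_iff₀ hNpos]
    nlinarith
  have hdouble : ∑ P ∈ s, Real.log (Ideal.absNorm P) * ((S.filter (· ∈ P)).card : ℝ) =
      ∑ α ∈ S, ∑ P ∈ s.filter (α ∈ ·), Real.log (Ideal.absNorm P) := by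
    simp_rw [Finset.card_filter, Nat.cast_sum, Finset.mul_sum, Finset.sum_filter]
    rw [Finset.sum_comm]
    refine Finset.sum_congr rfl fun α _ => Finset.sum_congr rfl fun P _ => ?_
    split_ifs <;> simp
  have hup : ∑ α ∈ S, ∑ P ∈ s.filter (α ∈ ·), Real.log (Ideal.absNorm P) ≤
      (houseBall K T).card * (n * Real.log T) := by
    have h1 : ∀ α ∈ S, ∑ P ∈ s.filter (α ∈ ·), Real.log (Ideal.absNorm P) ≤ n * Real.log T := by
      intro α hα
      simp only [hS, mem_filter, mem_houseBall] at hα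
      refine (sum_log_absNorm_le (fun P hP => ?_) hα.2 fun P hP => ?_).trans ?_
      · have := hs P (Finset.mem_filter.1 hP).1
        exact ⟨this.1, this.2.1⟩
      · exact (Finset.mem_filter.1 hP).2
      · rw [← Real.log_pow]
        exact Real.log_le_log (by exact_mod_cast absNorm_span_pos hα.2) (absNorm_span_le hα.1)
    refine (Finset.sum_le_card_nsmul _ _ _ h1).trans ?_
    rw [nsmul_eq_mul]
    refine mul_le_mul_of_nonneg_right ?_ ?_
    · exact_mod_cast Finset.card_filter_le _ _
    · refine mul_nonneg (by positivity) (Real.log_nonneg ?_)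
      rw [hTe]
      have : (1 : ℝ) ≤ 2 * c ^ 2 * u := hc1.trans hcc
      nlinarith
  have hfin : 4 / 5 * ((houseBall K T).card : ℝ) *
      ∑ P ∈ s, Real.log (Ideal.absNorm P) / Ideal.absNorm P ≤
      (houseBall K T).card * (n * Real.log T) := by
    refine le_trans ?_ (hdouble.trans_le hup)
    rw [Finset.mul_sum]
    refine Finset.sum_le_sum fun P hP => ?_
    have := mul_le_mul_of_nonneg_left (hlower P hP) (Real.log_natCast_nonneg (Ideal.absNorm P))
    refine le_trans (le_of_eq ?_) this
    ring
  have hlogT : Real.log T = Real.log u + Real.log (2 * c ^ 2 * (60 * n + 2)) := by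
    rw [hTe, Real.log_mul (by positivity) (by positivity), add_comm]
  rw [← hlogT]
  have : 4 / 5 * ∑ P ∈ s, Real.log (Ideal.absNorm P) / Ideal.absNorm P ≤ n * Real.log T := by
    refine le_of_mul_le_mul_left ?_ hSpos
    linarith
  linarith

end LatticeBound
end Mertens

section ErrorTerm

variable {K : Type*} [Field K] [NumberField K]

lemma exists_absNorm_eq_prime_pow {P : Ideal (𝓞 K)} (hP : P.IsPrime) (h0 : P ≠ ⊥) :
    ∃ p f : ℕ, p.Prime ∧ 1 ≤ f ∧ Ideal.absNorm P = p ^ f ∧ (p : 𝓞 K) ∈ P := by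
  have hN : 2 ≤ Ideal.absNorm P := two_le_absNorm hP h0
  have hmem : (Ideal.absNorm P : 𝓞 K) ∈ P := Ideal.absNorm_mem P
  rw [← Nat.prod_primeFactorsList (by omega : Ideal.absNorm P ≠ 0), Nat.cast_list_prod] at hmem
  rw [← Multiset.prod_coe, hP.multiset_prod_mem_iff_exists_mem] at hmem
  obtain ⟨x, hx, hxP⟩ := hmem
  obtain ⟨p, hp, rfl⟩ := List.mem_map.1 (Multiset.mem_coe.1 hx)
  have hpp := Nat.prime_of_mem_primeFactorsList hp
  have hd := Ideal.absNorm_dvd_absNorm_of_le ((Ideal.span_singleton_le_iff_mem _).2 hxP)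
  rw [Ideal.absNorm_span_natCast] at hd
  obtain ⟨f, -, hf⟩ := (Nat.dvd_prime_pow hpp).1 hd
  refine ⟨p, f, hpp, ?_, hf, hxP⟩
  rcases Nat.eq_zero_or_pos f with rfl | h
  · rw [hf] at hN; norm_num at hN
  · exact h

lemma minFac_absNorm_mem {P : Ideal (𝓞 K)} (hP : P.IsPrime) (h0 : P ≠ ⊥) :
    ((Ideal.absNorm P).minFac : 𝓞 K) ∈ P := by
  obtain ⟨p, f, hp, hf, hN, hmem⟩ := exists_absNorm_eq_prime_pow hP h0
  rwa [hN, hp.pow_minFac (by omega)]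

lemma minFac_sq_le_absNorm {P : Ideal (𝓞 K)} (hP : P.IsPrime) (h0 : P ≠ ⊥)
    (h : ¬ (Ideal.absNorm P).Prime) : (Ideal.absNorm P).minFac ^ 2 ≤ Ideal.absNorm P := by
  obtain ⟨p, f, hp, hf, hN, hmem⟩ := exists_absNorm_eq_prime_pow hP h0
  rw [hN, hp.pow_minFac (by omega)]
  refine Nat.pow_le_pow_right hp.pos ?_
  by_contra hlt
  obtain rfl : f = 1 := by omega
  rw [hN, pow_one] at h
  exact h hp

lemma card_le_finrank_of_mem {p : ℕ} (hp : 2 ≤ p) {s : Finset (Ideal (𝓞 K))}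
    (hs : ∀ P ∈ s, P.IsPrime ∧ P ≠ ⊥ ∧ p ≤ Ideal.absNorm P ∧ (p : 𝓞 K) ∈ P) :
    s.card ≤ Module.finrank ℚ K := by
  have h := prod_absNorm_le (fun P hP => ⟨(hs P hP).1, (hs P hP).2.1⟩)
    (α := (p : 𝓞 K)) (by exact_mod_cast (by omega : p ≠ 0)) fun P hP => (hs P hP).2.2.2
  rw [Ideal.absNorm_span_natCast, RingOfIntegers.rank] at h
  have h2 := Finset.pow_card_le_prod s (fun P => Ideal.absNorm P) p fun P hP => (hs P hP).2.2.1
  exact (Nat.pow_le_pow_iff_right (by omega)).1 (h2.trans h)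

lemma sum_minFac_le {X : ℕ} {s : Finset (Ideal (𝓞 K))}
    (hs : ∀ P ∈ s, P.IsPrime ∧ P ≠ ⊥ ∧ Ideal.absNorm P ≤ X) {g : ℕ → ℝ} (hg : ∀ m, 0 ≤ g m) :
    ∑ P ∈ s, g (Ideal.absNorm P).minFac ≤
      Module.finrank ℚ K * ∑ m ∈ Finset.Ioc 0 X, g m := by
  classical
  rw [← Finset.sum_fiberwise_of_maps_to (t := Finset.Ioc 0 X)
    (g := fun P => (Ideal.absNorm P).minFac), Finset.mul_sum]
  · refine Finset.sum_le_sum fun m _ => ?_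
    rw [Finset.sum_congr rfl (g := fun _ => g m) fun P hP => by rw [(Finset.mem_filter.1 hP).2],
      Finset.sum_const, nsmul_eq_mul]
    refine mul_le_mul_of_nonneg_right ?_ (hg m)
    rcases (s.filter fun P => (Ideal.absNorm P).minFac = m).eq_empty_or_nonempty with h | ⟨Q, hQ⟩
    · rw [h]; simp
    · have key : ∀ P ∈ s.filter fun P => (Ideal.absNorm P).minFac = m,
          P.IsPrime ∧ P ≠ ⊥ ∧ m ≤ Ideal.absNorm P ∧ (m : 𝓞 K) ∈ P := by
        intro P hP
        obtain ⟨hPs, rfl⟩ := Finset.mem_filter.1 hP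
        obtain ⟨h1, h2, -⟩ := hs P hPs
        exact ⟨h1, h2, Nat.minFac_le (absNorm_pos h2), minFac_absNorm_mem h1 h2⟩
      have hm : 2 ≤ m := by
        obtain ⟨hQs, rfl⟩ := Finset.mem_filter.1 hQ
        have := two_le_absNorm (hs Q hQs).1 (hs Q hQs).2.1
        exact (Nat.minFac_prime (by omega)).two_le
      exact_mod_cast card_le_finrank_of_mem hm key
  · intro P hP
    rw [Finset.mem_Ioc]
    obtain ⟨h1, h2, h3⟩ := hs P hP
    exact ⟨Nat.minFac_pos _, (Nat.minFac_le (absNorm_pos h2)).trans h3⟩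

lemma sum_log_div_pow_le {N : ℝ} (hN : 2 ≤ N) (X : ℕ) :
    ∑ j ∈ Finset.Icc 2 X, Real.log N / N ^ j ≤ 4 * N ^ (-(3 / 2) : ℝ) := by
  have hN0 : 0 < N := by linarith
  have h1 : ∑ j ∈ Finset.Icc 2 X, (N⁻¹) ^ j ≤ 2 * (N ^ 2)⁻¹ := by
    rw [show Finset.Icc 2 X = Finset.Ico 2 (X + 1) by ext; simp]
    have hi : N⁻¹ ≤ 1 / 2 := by rw [inv_le_comm₀ hN0 (by norm_num)]; linarith
    refine (geom_sum_Ico_le_of_lt_one (by positivity) (by linarith)).trans ?_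
    rw [div_le_iff₀ (by linarith), inv_pow]
    have : 0 ≤ (N ^ 2)⁻¹ := by positivity
    nlinarith
  have h2 : Real.log N ≤ 2 * N ^ (1 / 2 : ℝ) := by
    have := Real.log_le_rpow_div hN0.le (ε := 1 / 2) (by norm_num)
    linarith
  calc ∑ j ∈ Finset.Icc 2 X, Real.log N / N ^ j
      = Real.log N * ∑ j ∈ Finset.Icc 2 X, (N⁻¹) ^ j := by
        rw [Finset.mul_sum]; simp [div_eq_mul_inv]
    _ ≤ (2 * N ^ (1 / 2 : ℝ)) * (2 * (N ^ 2)⁻¹) :=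
        mul_le_mul h2 h1 (Finset.sum_nonneg fun _ _ => by positivity) (by positivity)
    _ = 4 * (N ^ (1 / 2 : ℝ) * N ^ (-2 : ℝ)) := by
        rw [Real.rpow_neg hN0.le, Real.rpow_two]; ring
    _ = _ := by rw [← Real.rpow_add hN0]; norm_num

lemma log_div_le_of_sq_le {p N : ℝ} (hp : 1 ≤ p) (h : p ^ 2 ≤ N) :
    Real.log N / N ≤ 4 * p ^ (-(3 / 2) : ℝ) := by
  have hN0 : 0 < N := by nlinarith
  have h2 : Real.log N ≤ 4 * N ^ (1 / 4 : ℝ) := by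
    have := Real.log_le_rpow_div hN0.le (ε := 1 / 4) (by norm_num)
    linarith
  calc Real.log N / N ≤ 4 * N ^ (1 / 4 : ℝ) / N := by gcongr
    _ = 4 * (N ^ (1 / 4 : ℝ) * N ^ (-1 : ℝ)) := by rw [Real.rpow_neg_one]; ring
    _ = 4 * N ^ (-(3 / 4) : ℝ) := by rw [← Real.rpow_add hN0]; norm_num
    _ ≤ 4 * (p ^ 2) ^ (-(3 / 4) : ℝ) := by
        gcongr 4 * ?_
        exact Real.rpow_le_rpow_of_nonpos (by positivity) h (by norm_num)
    _ = _ := by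
        rw [← Real.rpow_two, ← Real.rpow_mul (by linarith)]; norm_num

/-- The sum `∑ m ^ (-3/2)`. -/
noncomputable def zetaThreeHalves : ℝ := ∑' m : ℕ, (m : ℝ) ^ (-(3 / 2) : ℝ)

/-- Proper prime powers, primes of higher residue degree and large primes contribute little. -/
lemma error_le {X : ℕ} {Y : ℝ} (hY : 0 < Y) {s : Finset (Ideal (𝓞 K))}
    (hs : ∀ P ∈ s, P.IsPrime ∧ P ≠ ⊥ ∧ Ideal.absNorm P ≤ X) :
    ∑ P ∈ s, ((∑ j ∈ Finset.Icc 2 X, Real.log (Ideal.absNorm P) / (Ideal.absNorm P : ℝ) ^ j) +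
      if (Ideal.absNorm P).Prime ∧ (Ideal.absNorm P : ℝ) ≤ Y then 0 else
        Real.log (Ideal.absNorm P) / Ideal.absNorm P) ≤
      Module.finrank ℚ K * (8 * zetaThreeHalves + 2 * (X / Y)) := by
  set g : ℕ → ℝ := fun m => 8 * (m : ℝ) ^ (-(3 / 2) : ℝ) +
    if m.Prime then Real.log m / Y else 0 with hgdef
  have hg : ∀ m, 0 ≤ g m := by
    intro m
    have : 0 ≤ Real.log m / Y := div_nonneg (Real.log_natCast_nonneg m) hY.le
    simp only [hgdef]
    split_ifs <;> positivity
  have hbound : ∑ m ∈ Finset.Ioc 0 X, g m ≤ 8 * zetaThreeHalves + 2 * (X / Y) := by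
    simp only [hgdef]
    rw [Finset.sum_add_distrib]
    refine add_le_add ?_ ?_
    · rw [← Finset.mul_sum]
      refine mul_le_mul_of_nonneg_left ?_ (by norm_num)
      refine Summable.sum_le_tsum _ (fun _ _ => by positivity) ?_
      exact Real.summable_nat_rpow.2 (by norm_num)
    · rw [← Finset.sum_filter, ← Finset.sum_div]
      have := Chebyshev.theta_le_log4_mul_x (x := X) (Nat.cast_nonneg X)
      rw [Chebyshev.theta, Nat.floor_natCast] at this
      rw [← mul_div_assoc]
      refine div_le_div_of_nonneg_right (this.trans ?_) hY.le
      refine mul_le_mul_of_nonneg_right ?_ (Nat.cast_nonneg X)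
      rw [show (4 : ℝ) = 2 ^ 2 by norm_num, Real.log_pow]
      have := Real.log_two_lt_d9
      push_cast
      linarith
  refine le_trans (Finset.sum_le_sum fun P hP => ?_)
    ((sum_minFac_le hs hg).trans (mul_le_mul_of_nonneg_left hbound (Nat.cast_nonneg _)))
  obtain ⟨h1, h2, h3⟩ := hs P hP
  have hN := two_le_absNorm h1 h2
  have hp := Nat.minFac_prime (by omega : Ideal.absNorm P ≠ 1)
  have hple := Nat.minFac_le (absNorm_pos h2)
  set N := Ideal.absNorm P with hNdef
  have hA : ∑ j ∈ Finset.Icc 2 X, Real.log N / (N : ℝ) ^ j ≤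
      4 * (N.minFac : ℝ) ^ (-(3 / 2) : ℝ) := by
    refine (sum_log_div_pow_le (by exact_mod_cast hN) X).trans ?_
    gcongr 4 * ?_
    exact Real.rpow_le_rpow_of_nonpos (by exact_mod_cast hp.pos) (by exact_mod_cast hple)
      (by norm_num)
  have hpos : 0 ≤ (N.minFac : ℝ) ^ (-(3 / 2) : ℝ) := by positivity
  simp only [hgdef, if_pos hp]
  have hl : 0 ≤ Real.log N.minFac / Y := div_nonneg (Real.log_natCast_nonneg _) hY.le
  split_ifs with hc
  · linarith
  · by_cases hNp : N.Prime
    · have hlt : Y < N := by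
        by_contra hh
        exact hc ⟨hNp, not_lt.1 hh⟩
      rw [hNp.minFac_eq] at hA hpos ⊢
      have : Real.log N / N ≤ Real.log N / Y :=
        div_le_div_of_nonneg_left (Real.log_natCast_nonneg _) hY hlt.le
      linarith
    · have hB := log_div_le_of_sq_le (p := N.minFac) (N := N) (by exact_mod_cast hp.one_lt.le)
        (by exact_mod_cast minFac_sq_le_absNorm h1 h2 hNp)
      linarith

end ErrorTerm

section LowerMertens

variable {K : Type*} [Field K] [NumberField K]

namespace LatticeBound

variable {c : ℕ} (hK : LatticeBound K c)
include hK

open Classical in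
/-- Few points of a large ball have a small conjugate. -/
lemma card_small_conjugate_le (σ : K →+* ℂ) {h : ℕ} {m : ℕ} (hm : 1 ≤ m)
    (hT : 4 * c ≤ m * h) :
    m * ((houseBall K (m * h)).filter fun α : 𝓞 K => ‖σ (α : K)‖ < h / 2).card ≤
      4 ^ Module.finrank ℚ K * (houseBall K (m * h)).card := by
  have hc := hK.one_le
  have hh : 0 < h := by
    rcases Nat.eq_zero_or_pos h with rfl | hh
    · omega
    · exact hh
  have hm' : (1 : ℝ) ≤ m := by exact_mod_cast hm
  have hh' : (0 : ℝ) < h := by exact_mod_cast hh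
  have hgrow := hK.growth_coarse (T := m * h) (by exact_mod_cast hT) (l := 2) (by norm_num)
  refine le_trans ?_ hgrow
  set F := (houseBall K (m * h)).filter fun α : 𝓞 K => ‖σ (α : K)‖ < h / 2 with hF
  have hcard : m * F.card = (Finset.range m ×ˢ F).card := by
    rw [Finset.card_product, Finset.card_range]
  rw [hcard]
  refine Finset.card_le_card_of_injOn (fun x => x.2 + ((x.1 * h : ℕ) : 𝓞 K)) ?_ ?_
  · rintro ⟨i, α⟩ hx
    simp only [hF, coe_product, coe_range, Set.mem_prod, Set.mem_Iio, mem_coe, mem_filter,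
      mem_houseBall] at hx
    simp only [mem_coe, mem_houseBall, map_add]
    refine (house_add_le _ _).trans ?_
    have h1 := house_natCast (K := K) (i * h)
    have h2 : ((i * h : ℕ) : ℝ) ≤ m * h := by
      exact_mod_cast Nat.mul_le_mul_right h hx.1.le
    have h3 := hx.2.1
    push_cast at h1 h2 ⊢
    linarith
  · rintro ⟨i, α⟩ hx ⟨j, β⟩ hy hxy
    simp only [hF, coe_product, coe_range, Set.mem_prod, Set.mem_Iio, mem_coe, mem_filter,
      mem_houseBall] at hx hy hxy
    have e : σ (α : K) + ((i * h : ℕ) : ℂ) = σ (β : K) + ((j * h : ℕ) : ℂ) := by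
      have := congrArg (fun z : 𝓞 K => σ (z : K)) hxy
      simpa using this
    have hij : i = j := by
      by_contra hne
      have h1 : ((h : ℤ) : ℝ) ≤ |(((j * h : ℕ) : ℤ) - ((i * h : ℕ) : ℤ) : ℤ)| := by
        rw [Int.cast_le]
        have : ((j * h : ℕ) : ℤ) - ((i * h : ℕ) : ℤ) = (j - i : ℤ) * h := by push_cast; ring
        rw [this, abs_mul, Nat.abs_cast]
        have : 1 ≤ |(j - i : ℤ)| := Int.one_le_abs (by omega)
        nlinarith
      have h2 : ‖σ (α : K) - σ (β : K)‖ = |((((j * h : ℕ) : ℤ) - ((i * h : ℕ) : ℤ) : ℤ) : ℝ)| := by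
        rw [← Complex.norm_intCast]
        congr 1
        push_cast at e ⊢
        linear_combination e
      have h3 := norm_sub_le (σ (α : K)) (σ (β : K))
      have := hx.2.2
      have := hy.2.2
      rw [h2] at h3
      push_cast at h1 h3
      linarith
    subst hij
    have : α = β := by simpa using hxy
    rw [this]

/-- The constant by which the radius of the ball exceeds `u` in the lower Mertens bound. -/
def _root_.MissingValues.radiusFactor (c n : ℕ) : ℕ :=
  2 * c ^ 2 * (60 * n + 1) * (4 ^ n * n * 20)

/-- The error term in the lower Mertens bound. -/
noncomputable def _root_.MissingValues.mertensError (c n : ℕ) : ℝ :=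
  (2 * (1 + 2 * c ^ 2)) ^ n * (n * (8 * zetaThreeHalves + 2 * radiusFactor c n ^ n))

open Classical in
lemma card_mem_le {u : ℕ} (hu : 1 ≤ u) {T : ℕ} (hTu : 2 * c ^ 2 * (60 * Module.finrank ℚ K + 1) * u ≤ T)
    {I : Ideal (𝓞 K)} (hI : I ≠ ⊥) :
    (((houseBall K T).filter fun α : 𝓞 K => α ≠ 0 ∧ α ∈ I).card : ℝ) ≤
      (2 * (1 + 2 * c ^ 2)) ^ Module.finrank ℚ K * (houseBall K T).card / Ideal.absNorm I ∧
    (Ideal.absNorm I ≤ u ^ Module.finrank ℚ K →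
      (((houseBall K T).filter fun α : 𝓞 K => α ≠ 0 ∧ α ∈ I).card : ℝ) ≤
        11 / 10 * (houseBall K T).card / Ideal.absNorm I) := by
  set n := Module.finrank ℚ K with hn
  have hc := hK.one_le
  have hn0 : 0 < n := Module.finrank_pos
  have hNpos : (0 : ℝ) < Ideal.absNorm I := by exact_mod_cast absNorm_pos hI
  have hcc : c ≤ c ^ 2 * u := by nlinarith [Nat.mul_le_mul hc hu, Nat.le_self_pow two_ne_zero c]
  have hsub : ((houseBall K T).filter fun α : 𝓞 K => α ≠ 0 ∧ α ∈ I).card ≤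
      ((houseBall K T).filter (· ∈ I)).card :=
    Finset.card_le_card fun x hx => by
      simp only [mem_filter] at hx ⊢
      exact ⟨hx.1, hx.2.2⟩
  refine ⟨?_, fun hle => ?_⟩
  · rcases Finset.eq_empty_or_nonempty ((houseBall K T).filter fun α : 𝓞 K => α ≠ 0 ∧ α ∈ I) with
      h0 | ⟨α, hα⟩
    · rw [h0]; simp only [card_empty, Nat.cast_zero]; positivity
    · simp only [mem_filter, mem_houseBall] at hα
      have hle : Ideal.absNorm I ≤ T ^ n := by
        have h1 := absNorm_le_of_mem hα.2.1 hα.2.2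
        have h2 := absNorm_span_le hα.1
        rw [← hn] at h2
        exact h1.trans (by exact_mod_cast h2)
      have h1 := absNorm_mul_card_le hI (hK.cover_of_absNorm_le hI hle) T
      have h2 := hK.growth_coarse (T := T) (l := 1 + 2 * c ^ 2) (by
        have : 4 * c ≤ T := by nlinarith
        exact_mod_cast this) (by omega)
      rw [show (((1 + 2 * c ^ 2 : ℕ) : ℝ) * T) = T + 2 * c ^ 2 * T by push_cast; ring] at h2
      have h3 := (Nat.mul_le_mul_left (Ideal.absNorm I) hsub).trans (h1.trans h2)
      rw [le_div_iff₀ hNpos, mul_comm]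
      exact_mod_cast h3
  · have h1 := absNorm_mul_card_le hI (hK.cover_of_absNorm_le hI hle) T
    have hTu' : (2 * c ^ 2 * (60 * n + 1) * u : ℝ) ≤ T := by exact_mod_cast hTu
    have h2 := hK.growth_fine (T := T) (by
      have : c * (60 * n + 1) ≤ T := by nlinarith
      exact_mod_cast this)
    have h3 : (houseBall K (T + 2 * c ^ 2 * u)).card ≤
        (houseBall K (T + T / (60 * n + 1))).card := by
      refine Finset.card_le_card (houseBall_mono ?_)
      gcongr
      rw [le_div_iff₀ (by positivity)]
      linarith
    have h4 := (Nat.mul_le_mul_left (Ideal.absNorm I) hsub).trans (h1.trans h3)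
    have h5 : (Ideal.absNorm I : ℝ) * (((houseBall K T).filter fun α : 𝓞 K => α ≠ 0 ∧ α ∈ I).card : ℝ) ≤
        (houseBall K (T + T / (60 * n + 1))).card := by exact_mod_cast h4
    rw [le_div_iff₀ hNpos, mul_comm]
    exact h5.trans h2

open Classical in
/-- Most integers of house at most `T` have large norm. -/
lemma card_mul_log_le_sum {u : ℕ} (hu : 1 ≤ u) {T : ℕ}
    (hT : T = radiusFactor c (Module.finrank ℚ K) * u) :
    19 / 20 * ((houseBall K T).card : ℝ) * (Module.finrank ℚ K * Real.log u) ≤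
      ∑ α ∈ (houseBall K T).filter (· ≠ 0), Real.log (Ideal.absNorm (Ideal.span {α})) := by
  set n := Module.finrank ℚ K with hn
  have hc := hK.one_le
  have hn0 : 0 < n := Module.finrank_pos
  set m := 4 ^ n * n * 20 with hm
  set h := 2 * c ^ 2 * (60 * n + 1) * u with hh
  have hTm : T = m * h := by rw [hT, hh, hm, radiusFactor]; ring
  have hm1 : 1 ≤ m := Nat.succ_le_of_lt (by positivity)
  have hcc : c ≤ c ^ 2 * u := by nlinarith [Nat.mul_le_mul hc hu, Nat.le_self_pow two_ne_zero c]
  have hhu : 2 * u ≤ h := by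
    rw [hh]
    have : 1 ≤ c ^ 2 * (60 * n + 1) := Nat.succ_le_of_lt (by positivity)
    calc 2 * u ≤ 2 * u * (c ^ 2 * (60 * n + 1)) := Nat.le_mul_of_pos_right _ this
      _ = _ := by ring
  have hT4 : 4 * c ≤ m * h := by
    refine le_trans ?_ (Nat.le_mul_of_pos_left h hm1)
    rw [hh]
    nlinarith
  have hsmall := fun σ => hK.card_small_conjugate_le σ hm1 hT4
  have hTm' : (T : ℝ) = m * h := by exact_mod_cast hTm
  rw [← hTm'] at hsmall
  set W := (houseBall K T).card with hW
  set bad := fun σ : K →+* ℂ => (houseBall K T).filter fun α : 𝓞 K => ‖σ (α : K)‖ < h / 2 with hbad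
  have hbadcard : ((Finset.univ.biUnion bad).card : ℝ) ≤ W / 20 := by
    have h1 : ∀ σ ∈ (Finset.univ : Finset (K →+* ℂ)), ((bad σ).card : ℝ) ≤ W / (20 * n) := by
      intro σ _
      have h2 : (m : ℝ) * (bad σ).card ≤ 4 ^ n * W := by exact_mod_cast hsmall σ
      have h3 : (4 ^ n : ℝ) * (n * 20 * (bad σ).card) ≤ 4 ^ n * W := by
        refine le_trans (le_of_eq ?_) h2
        rw [hm]; push_cast; ring
      have h4 := le_of_mul_le_mul_left h3 (by positivity)
      rw [le_div_iff₀ (by positivity)]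
      linarith
    have h5 : ((Finset.univ.biUnion bad).card : ℝ) ≤ ∑ σ, ((bad σ).card : ℝ) := by
      exact_mod_cast Finset.card_biUnion_le
    refine h5.trans ((Finset.sum_le_card_nsmul _ _ _ h1).trans (le_of_eq ?_))
    rw [card_embeddings, ← hn, nsmul_eq_mul]
    field_simp
  set good := (houseBall K T) \ Finset.univ.biUnion bad with hgood
  have hgoodmem : ∀ α ∈ good, α ∈ houseBall K T ∧ ∀ σ : K →+* ℂ, (u : ℝ) ≤ ‖σ (α : K)‖ := by
    intro α hα
    simp only [hgood, mem_sdiff, mem_biUnion, mem_univ, true_and, not_exists, hbad, mem_filter,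
      not_and, not_lt] at hα
    refine ⟨hα.1, fun σ => le_trans ?_ (hα.2 σ hα.1)⟩
    have : (2 * u : ℝ) ≤ h := by exact_mod_cast hhu
    linarith
  have hgoodcard : 19 / 20 * (W : ℝ) ≤ good.card := by
    have := Finset.le_card_sdiff (Finset.univ.biUnion bad) (houseBall K T)
    rw [tsub_le_iff_right] at this
    have h' : (W : ℝ) ≤ good.card + (Finset.univ.biUnion bad).card := by exact_mod_cast this
    linarith
  have hu' : (1 : ℝ) ≤ u := by exact_mod_cast hu
  have hsub : good ⊆ (houseBall K T).filter (· ≠ 0) := by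
    intro α hα
    obtain ⟨h1, h2⟩ := hgoodmem α hα
    refine Finset.mem_filter.2 ⟨h1, ?_⟩
    rintro rfl
    obtain ⟨σ⟩ : Nonempty (K →+* ℂ) := inferInstance
    have := h2 σ
    simp only [map_zero, norm_zero] at this
    linarith
  have hlognn : 0 ≤ n * Real.log u := mul_nonneg (Nat.cast_nonneg _) (Real.log_nonneg hu')
  calc 19 / 20 * (W : ℝ) * (n * Real.log u) ≤ good.card * (n * Real.log u) :=
        mul_le_mul_of_nonneg_right hgoodcard hlognn
    _ ≤ ∑ α ∈ good, Real.log (Ideal.absNorm (Ideal.span {α})) := by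
        rw [← nsmul_eq_mul]
        refine Finset.card_nsmul_le_sum _ _ _ fun α hα => ?_
        rw [← Real.log_pow]
        refine Real.log_le_log (by positivity) ?_
        exact le_absNorm_span (by linarith) (hgoodmem α hα).2
    _ ≤ _ := Finset.sum_le_sum_of_subset_of_nonneg hsub fun _ _ _ => Real.log_natCast_nonneg _

/-- Lower half of Mertens' theorem for the primes of degree one of a number field. -/
theorem le_sum_log_div {u : ℕ} (hu : 1 ≤ u) {t : Finset (Ideal (𝓞 K))}
    (ht : ∀ P : Ideal (𝓞 K), (Ideal.absNorm P).Prime → Ideal.absNorm P ≤ u ^ Module.finrank ℚ K →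
      P ∈ t) :
    17 / 20 * (Module.finrank ℚ K * Real.log u) - mertensError c (Module.finrank ℚ K) ≤
      ∑ P ∈ t, Real.log (Ideal.absNorm P) / Ideal.absNorm P := by
  classical
  obtain ⟨T, hT⟩ : ∃ T, T = radiusFactor c (Module.finrank ℚ K) * u := ⟨_, rfl⟩
  have hlow := hK.card_mul_log_le_sum hu hT
  set n := Module.finrank ℚ K with hn
  have hc := hK.one_le
  have hn0 : 0 < n := Module.finrank_pos
  have hu' : (1 : ℝ) ≤ u := by exact_mod_cast hu
  set X := T ^ n with hX
  have hTu : 2 * c ^ 2 * (60 * n + 1) * u ≤ T := by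
    rw [hT, radiusFactor]
    have : 1 ≤ 4 ^ n * n * 20 := Nat.succ_le_of_lt (by positivity)
    exact Nat.mul_le_mul_right u (Nat.le_mul_of_pos_right _ this)
  set s := ((Ideal.finite_setOfPred_absNorm_le (S := 𝓞 K) X).toFinset).filter
    fun P => P.IsPrime ∧ P ≠ ⊥ with hs
  have hsmem : ∀ P ∈ s, P.IsPrime ∧ P ≠ ⊥ ∧ Ideal.absNorm P ≤ X := by
    intro P hP
    simp only [hs, mem_filter, Set.Finite.mem_toFinset] at hP
    exact ⟨hP.2.1, hP.2.2, hP.1⟩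
  set S := (houseBall K T).filter (· ≠ 0) with hS
  set W := ((houseBall K T).card : ℝ) with hW
  have hWpos : 0 < W := by
    have : (0 : 𝓞 K) ∈ houseBall K T := by
      rw [mem_houseBall]
      simp only [map_zero, house, norm_zero]
      positivity
    rw [hW]
    exact_mod_cast Finset.card_pos.2 ⟨0, this⟩
  set C : ℝ := (2 * (1 + 2 * c ^ 2)) ^ n with hC
  have hC0 : 0 ≤ C := by positivity
  set L := fun P : Ideal (𝓞 K) => Real.log (Ideal.absNorm P) with hL
  have hL0 : ∀ P, 0 ≤ L P := fun P => Real.log_natCast_nonneg _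
  set Y : ℝ := (u : ℝ) ^ n with hY
  have hYpos : 0 < Y := by positivity
  set e := fun P : Ideal (𝓞 K) =>
    (∑ j ∈ Finset.Icc 2 X, L P / (Ideal.absNorm P : ℝ) ^ j) +
      if (Ideal.absNorm P).Prime ∧ (Ideal.absNorm P : ℝ) ≤ Y then 0 else
        L P / Ideal.absNorm P with he
  set f := fun P : Ideal (𝓞 K) =>
    if (Ideal.absNorm P).Prime ∧ (Ideal.absNorm P : ℝ) ≤ Y then L P / Ideal.absNorm P else 0
    with hf
  have herr : ∑ P ∈ s, e P ≤ n * (8 * zetaThreeHalves + 2 * (X / Y)) := error_le hYpos hsmem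
  have hXY : (X : ℝ) / Y = radiusFactor c n ^ n := by
    rw [hX, hY, hT]
    push_cast
    rw [mul_pow]
    field_simp
  have hmain : ∑ α ∈ S, Real.log (Ideal.absNorm (Ideal.span {α})) ≤
      W * (11 / 10 * ∑ P ∈ s, f P + C * ∑ P ∈ s, e P) := by
    have h1 : ∀ α ∈ S, Real.log (Ideal.absNorm (Ideal.span {α})) ≤
        ∑ P ∈ s, ∑ j ∈ Finset.Icc 1 X, if α ∈ P ^ j then L P else 0 := by
      intro α hα
      obtain ⟨hα1, hα0⟩ := Finset.mem_filter.1 hα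
      refine log_absNorm_span_le hα0 (X := X) ?_ fun P hP hP0 hPX => ?_
      · have := absNorm_span_le (mem_houseBall.1 hα1)
        exact_mod_cast this
      · simp only [hs, mem_filter, Set.Finite.mem_toFinset]
        exact ⟨hPX, hP, hP0⟩
    refine (Finset.sum_le_sum h1).trans ?_
    rw [Finset.sum_comm, Finset.mul_sum, Finset.mul_sum, ← Finset.sum_add_distrib, Finset.mul_sum]
    refine Finset.sum_le_sum fun P hP => ?_
    obtain ⟨hP1, hP0, hPX⟩ := hsmem P hP
    rw [Finset.sum_comm]
    have h2 : ∀ j, ∑ α ∈ S, (if α ∈ P ^ j then L P else 0) =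
        L P * ((houseBall K T).filter fun α : 𝓞 K => α ≠ 0 ∧ α ∈ P ^ j).card := by
      intro j
      rw [← Finset.sum_filter, Finset.sum_const, nsmul_eq_mul, hS, Finset.filter_filter, mul_comm]
    simp only [h2]
    have hX1 : 1 ≤ X := (absNorm_pos hP0).trans_le hPX
    have hbd := fun j : ℕ => hK.card_mem_le hu hTu (I := P ^ j) (pow_ne_zero j hP0)
    simp only [map_pow, Nat.cast_pow] at hbd
    rw [← Finset.sum_erase_add _ _ (Finset.mem_Icc.2 ⟨le_rfl, hX1⟩),
      show (Finset.Icc 1 X).erase 1 = Finset.Icc 2 X by ext j; simp; omega]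
    have h3 : ∑ j ∈ Finset.Icc 2 X,
        L P * (((houseBall K T).filter fun α : 𝓞 K => α ≠ 0 ∧ α ∈ P ^ j).card : ℝ) ≤
        W * (C * ∑ j ∈ Finset.Icc 2 X, L P / (Ideal.absNorm P : ℝ) ^ j) := by
      rw [Finset.mul_sum, Finset.mul_sum]
      refine Finset.sum_le_sum fun j _ => ?_
      refine (mul_le_mul_of_nonneg_left (hbd j).1 (hL0 P)).trans (le_of_eq ?_)
      rw [← hn]
      ring
    have h4 : L P * (((houseBall K T).filter fun α : 𝓞 K => α ≠ 0 ∧ α ∈ P ^ 1).card : ℝ) ≤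
        W * (11 / 10 * f P + C * if (Ideal.absNorm P).Prime ∧ (Ideal.absNorm P : ℝ) ≤ Y then 0 else
        L P / Ideal.absNorm P) := by
      simp only [hf]
      split_ifs with hc
      · refine (mul_le_mul_of_nonneg_left ((hbd 1).2 ?_) (hL0 P)).trans (le_of_eq ?_)
        · rw [pow_one]; have := hc.2; rw [hY] at this; exact_mod_cast this
        · rw [pow_one]; ring
      · refine (mul_le_mul_of_nonneg_left (hbd 1).1 (hL0 P)).trans (le_of_eq ?_)
        rw [pow_one, ← hn]; ring
    refine (add_le_add h3 h4).trans (le_of_eq ?_)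
    simp only [he]
    ring
  have hft : ∑ P ∈ s, f P ≤ ∑ P ∈ t, L P / Ideal.absNorm P := by
    simp only [hf]
    rw [← Finset.sum_filter]
    refine Finset.sum_le_sum_of_subset_of_nonneg (fun P hP => ?_) fun P _ _ =>
      div_nonneg (hL0 P) (Nat.cast_nonneg _)
    obtain ⟨-, h1, h2⟩ := Finset.mem_filter.1 hP
    exact ht P h1 (by rw [hY] at h2; exact_mod_cast h2)
  have h6 : 19 / 20 * (n * Real.log u) ≤ 11 / 10 * ∑ P ∈ s, f P + C * ∑ P ∈ s, e P := by
    refine le_of_mul_le_mul_left ?_ hWpos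
    refine le_trans (le_of_eq ?_) (hlow.trans hmain)
    ring
  rw [hXY] at herr
  have h7 : C * ∑ P ∈ s, e P ≤ mertensError c n := by
    rw [mertensError]
    exact mul_le_mul_of_nonneg_left herr hC0
  have h8 : 0 ≤ ∑ P ∈ s, f P := Finset.sum_nonneg fun P _ => by
    simp only [hf]
    split_ifs
    · exact div_nonneg (hL0 P) (Nat.cast_nonneg _)
    · exact le_rfl
  have h9 : 0 ≤ n * Real.log u := mul_nonneg (Nat.cast_nonneg _) (Real.log_nonneg hu')
  have h10 : 0 ≤ mertensError c n := by
    rw [mertensError, zetaThreeHalves]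
    have : 0 ≤ ∑' m : ℕ, (m : ℝ) ^ (-(3 / 2) : ℝ) := tsum_nonneg fun _ => by positivity
    positivity
  simp only [hL] at hft
  linarith

end LatticeBound
end LowerMertens

section Kummer

variable {M N : Type*} [Field M] [Field N] [NumberField M] [NumberField N] [Algebra M N]

open scoped Pointwise in
/-- A prime modulo which `a` is a nonzero `q`-th power splits completely in the Kummer extension
generated by a `q`-th root of `a`. -/
lemma exists_primes_over {q : ℕ} (hq : q.Prime) {ζ : 𝓞 M} (hζ : IsPrimitiveRoot ζ q)
    {a : 𝓞 M} (ha : ∀ x : M, x ^ q ≠ a) [IsSplittingField M N (X ^ q - C (a : M))]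
    {P : Ideal (𝓞 M)} (hP : P.IsPrime) (hP0 : P ≠ ⊥) (hPa : (ζ - 1) * a ∉ P) {r : 𝓞 M}
    (hr : r ^ q - a ∈ P) :
    ∃ s : Finset (Ideal (𝓞 N)), s.card = q ∧
      ∀ Q ∈ s, Q.IsPrime ∧ Q ≠ ⊥ ∧ Q.LiesOver P ∧ Ideal.absNorm Q = Ideal.absNorm P := by
  classical
  have hζM : IsPrimitiveRoot (ζ : M) q := hζ.map_of_injective RingOfIntegers.coe_injective
  have hprim : (primitiveRoots q M).Nonempty := ⟨ζ, (mem_primitiveRoots hq.pos).2 hζM⟩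
  have hirr : Irreducible (X ^ q - C (a : M)) := X_pow_sub_C_irreducible_of_prime hq ha
  have hgal : IsGalois M N := isGalois_of_isSplittingField_X_pow_sub_C hprim hirr N
  have hrank : Module.finrank M N = q := finrank_of_isSplittingField_X_pow_sub_C hprim hirr N
  have hcardG : Nat.card (N ≃ₐ[M] N) = q := by rw [IsGalois.card_aut_eq_finrank, hrank]
  have hmain := Ideal.ncard_primesOver_mul_ramificationIdxIn_mul_inertiaDegIn P (𝓞 N) (N ≃ₐ[M] N)
  rw [hcardG] at hmain
  have hPmax : P.IsMaximal := hP.isMaximal hP0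
  have hne : ∀ Q ∈ P.primesOver (𝓞 N), Q ≠ ⊥ := fun Q hQ => by
    have := hQ.2
    exact Ideal.ne_bot_of_liesOver_of_ne_bot hP0 Q
  have hfin : (P.primesOver (𝓞 N)).Finite := by
    refine Set.finite_of_ncard_ne_zero fun h => ?_
    rw [h, zero_mul] at hmain
    exact hq.ne_zero hmain.symm
  rcases (Nat.dvd_prime hq).1 ⟨_, hmain.symm⟩ with h1 | hcard
  · exfalso
    obtain ⟨Q, hQ⟩ := Set.ncard_eq_one.1 h1
    have hQmem : Q ∈ P.primesOver (𝓞 N) := by rw [hQ]; rfl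
    have hQprime := hQmem.1
    have hQover := hQmem.2
    obtain ⟨b, hb⟩ : ∃ b : N, aeval b (X ^ q - C (a : M)) = 0 := by
      have hs := IsSplittingField.splits N (X ^ q - C (a : M))
      obtain ⟨b, hb⟩ := hs.exists_eval_eq_zero (by
        rw [degree_map]
        exact (degree_pos_of_irreducible hirr).ne')
      exact ⟨b, by rwa [aeval_def, ← eval_map]⟩
    have hmin : minpoly M b = X ^ q - C (a : M) :=
      (minpoly.eq_of_irreducible_of_monic hirr hb (monic_X_pow_sub_C _ hq.ne_zero)).symm
    have hbq : b ^ q = algebraMap M N a := by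
      simpa [sub_eq_zero] using hb
    obtain ⟨σ, hσ⟩ : ∃ σ : N ≃ₐ[M] N, σ b = algebraMap M N ζ * b := by
      refine minpoly.exists_algEquiv_of_root' (Algebra.IsAlgebraic.isAlgebraic b) ?_
      rw [hmin]
      simp only [map_sub, map_pow, aeval_X, aeval_C]
      rw [mul_pow, hbq, ← map_pow, hζM.pow_eq_one, map_one, one_mul, sub_self]
    have hbint : IsIntegral ℤ b := by
      refine IsIntegral.of_pow hq.pos ?_
      rw [hbq]
      exact a.isIntegral_coe.map (Algebra.ofId M N |>.restrictScalars ℤ)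
    set b' : 𝓞 N := ⟨b, hbint⟩ with hb'
    have hbq' : b' ^ q = algebraMap (𝓞 M) (𝓞 N) a := RingOfIntegers.ext hbq
    have hσ' : σ • b' = algebraMap (𝓞 M) (𝓞 N) ζ * b' := RingOfIntegers.ext hσ
    have hmem : ∀ x : 𝓞 M, algebraMap (𝓞 M) (𝓞 N) x ∈ Q ↔ x ∈ P := fun x =>
      (Ideal.mem_of_liesOver Q P x).symm
    have hζN : IsPrimitiveRoot (algebraMap (𝓞 M) (𝓞 N) ζ) q :=
      hζ.map_of_injective (FaithfulSMul.algebraMap_injective (𝓞 M) (𝓞 N))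
    have hprod := hζN.pow_sub_pow_eq_prod_sub_mul b' (algebraMap (𝓞 M) (𝓞 N) r) hq.pos
    have hinQ : ∏ η ∈ nthRootsFinset q (1 : 𝓞 N),
        (b' - η * algebraMap (𝓞 M) (𝓞 N) r) ∈ Q := by
      rw [← hprod, hbq', ← map_pow, ← map_sub, hmem, ← neg_mem_iff, neg_sub]
      exact hr
    obtain ⟨η, hη, hηQ⟩ := hQprime.prod_mem_iff.1 hinQ
    have : NeZero q := ⟨hq.ne_zero⟩
    obtain ⟨i, -, rfl⟩ := hζN.eq_pow_of_pow_eq_one ((mem_nthRootsFinset hq.pos _).1 hη)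
    rw [← map_pow, ← map_mul] at hηQ
    set y := ζ ^ i * r
    have hstable : σ • (b' - algebraMap (𝓞 M) (𝓞 N) y) ∈ Q := by
      have h2 : (σ⁻¹ • Q) ∈ P.primesOver (𝓞 N) := ⟨inferInstance, inferInstance⟩
      rw [hQ, Set.mem_singleton_iff] at h2
      rw [← h2, Ideal.mem_inv_pointwise_smul_iff] at hηQ
      exact hηQ
    rw [smul_sub, smul_algebraMap, hσ'] at hstable
    have h3 := Q.sub_mem hstable hηQ
    have h4 : (ζ - 1) ^ q * a ∈ P := by
      rw [← hmem, map_mul, ← hbq', map_pow, ← mul_pow]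
      refine Ideal.pow_mem_of_mem Q ?_ q hq.pos
      convert h3 using 1
      rw [map_sub, map_one]
      ring
    rcases hP.mem_or_mem h4 with h5 | h5
    · exact hPa (P.mul_mem_right _ (hP.mem_of_pow_mem _ h5))
    · exact hPa (P.mul_mem_left _ h5)
  · refine ⟨hfin.toFinset, by rw [← Set.ncard_eq_toFinset_card _ hfin, hcard], fun Q hQ => ?_⟩
    rw [Set.Finite.mem_toFinset] at hQ
    have hQprime := hQ.1
    have hQover := hQ.2
    refine ⟨hQ.1, hne Q hQ, hQ.2, ?_⟩
    have hQmax : Q.IsMaximal := hQ.1.isMaximal (hne Q hQ)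
    rw [hcard] at hmain
    have hef := Nat.eq_of_mul_eq_mul_left hq.pos (hmain.trans (mul_one q).symm)
    have hf : P.inertiaDegIn (𝓞 N) = 1 := Nat.eq_one_of_mul_eq_one_left hef
    rw [Ideal.inertiaDegIn_eq_inertiaDeg P Q (N ≃ₐ[M] N)] at hf
    have := Ideal.cardQuot_pow_inertiaDeg P Q
    rw [hf, pow_one] at this
    rw [Ideal.absNorm_apply, Ideal.absNorm_apply, this]

/-- If `log w` is large, some prime of degree one avoiding `β` has `a` as a non-residue. -/
theorem exists_prime_not_pow {q : ℕ} (hq : q.Prime) {ζ : 𝓞 M} (hζ : IsPrimitiveRoot ζ q)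
    {a : 𝓞 M} (ha : ∀ x : M, x ^ q ≠ a) [IsSplittingField M N (X ^ q - C (a : M))]
    {cM cN : ℕ} (hM : LatticeBound M cM) (hN : LatticeBound N cN)
    {β : 𝓞 M} (hβ : β ≠ 0) (hdvd : (ζ - 1) * a ∣ β) {w : ℕ} (hw1 : 1 ≤ w)
    (hw : mertensError cM (Module.finrank ℚ M) +
      5 / 4 * (Module.finrank ℚ M *
        Real.log (2 * cN ^ 2 * (60 * (Module.finrank ℚ M * q : ℕ) + 2))) +
      Real.log (Ideal.absNorm (Ideal.span {β})) < 9 / 20 * (Module.finrank ℚ M * Real.log w)) :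
    ∃ P : Ideal (𝓞 M), (Ideal.absNorm P).Prime ∧
      Ideal.absNorm P ≤ w ^ (q * Module.finrank ℚ M) ∧ β ∉ P ∧ ∀ r : 𝓞 M, r ^ q - a ∉ P := by
  classical
  by_contra! hcon
  have hζM : IsPrimitiveRoot (ζ : M) q := hζ.map_of_injective RingOfIntegers.coe_injective
  have hprim : (primitiveRoots q M).Nonempty := ⟨ζ, (mem_primitiveRoots hq.pos).2 hζM⟩
  have hirr : Irreducible (X ^ q - C (a : M)) := X_pow_sub_C_irreducible_of_prime hq ha
  have hrank : Module.finrank M N = q := finrank_of_isSplittingField_X_pow_sub_C hprim hirr N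
  have hrankN : Module.finrank ℚ N = Module.finrank ℚ M * q := by
    rw [← hrank, Module.finrank_mul_finrank]
  set n := Module.finrank ℚ M with hn
  have hn0 : 0 < n := Module.finrank_pos
  set A := ((Ideal.finite_setOfPred_absNorm_le (S := 𝓞 M) (w ^ (q * n))).toFinset).filter
    fun P => (Ideal.absNorm P).Prime with hA
  have hAmem : ∀ P, P ∈ A ↔ Ideal.absNorm P ≤ w ^ (q * n) ∧ (Ideal.absNorm P).Prime := by
    intro P
    simp [hA]
  have hAprime : ∀ P ∈ A, P.IsPrime ∧ P ≠ ⊥ := by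
    intro P hP
    have h1 := ((hAmem P).1 hP).2
    refine ⟨Ideal.isPrime_of_irreducible_absNorm h1, ?_⟩
    rintro rfl
    rw [Ideal.absNorm_bot] at h1
    exact Nat.not_prime_zero h1
  have hlow := hM.le_sum_log_div (u := w ^ q) (Nat.one_le_pow _ _ hw1) (t := A) fun P h1 h2 => by
    rw [hAmem, pow_mul]; exact ⟨h2, h1⟩
  rw [← Finset.sum_filter_add_sum_filter_not A (fun P => β ∈ P)] at hlow
  have hbad : ∑ P ∈ A.filter (β ∈ ·), Real.log (Ideal.absNorm P) / Ideal.absNorm P ≤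
      Real.log (Ideal.absNorm (Ideal.span {β})) := by
    refine le_trans (Finset.sum_le_sum fun P hP => ?_)
      (sum_log_absNorm_le (s := A.filter (β ∈ ·)) (fun P hP => ?_) hβ fun P hP => ?_)
    · refine div_le_self (Real.log_natCast_nonneg _) ?_
      have := hAprime P (Finset.mem_filter.1 hP).1
      exact_mod_cast absNorm_pos this.2
    · exact hAprime P (Finset.mem_filter.1 hP).1
    · exact (Finset.mem_filter.1 hP).2
  have hex : ∀ P ∈ A.filter (β ∉ ·), ∃ s : Finset (Ideal (𝓞 N)), s.card = q ∧
      ∀ Q ∈ s, Q.IsPrime ∧ Q ≠ ⊥ ∧ Q.LiesOver P ∧ Ideal.absNorm Q = Ideal.absNorm P := by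
    intro P hP
    obtain ⟨hPA, hPβ⟩ := Finset.mem_filter.1 hP
    obtain ⟨r, hr⟩ := hcon P ((hAmem P).1 hPA).2 ((hAmem P).1 hPA).1 hPβ
    obtain ⟨h1, h2⟩ := hAprime P hPA
    exact exists_primes_over hq hζ ha h1 h2 (fun h => hPβ (P.mem_of_dvd hdvd h)) hr
  choose! S hScard hS using hex
  have hdisj : (↑(A.filter (β ∉ ·)) : Set (Ideal (𝓞 M))).PairwiseDisjoint S := by
    intro P hP P' hP' hne
    rw [Function.onFun, Finset.disjoint_left]
    intro Q hQ hQ'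
    have h1 := (hS P hP Q hQ).2.2.1.over
    have h2 := (hS P' hP' Q hQ').2.2.1.over
    exact hne (h1.trans h2.symm)
  have hup := hN.sum_log_div_le hw1 (s := (A.filter (β ∉ ·)).biUnion S) fun Q hQ => by
    obtain ⟨P, hP, hQ⟩ := Finset.mem_biUnion.1 hQ
    obtain ⟨h1, h2, -, h3⟩ := hS P hP Q hQ
    refine ⟨h1, h2, ?_⟩
    rw [h3, hrankN, mul_comm n q]
    exact ((hAmem P).1 (Finset.mem_filter.1 hP).1).1
  rw [Finset.sum_biUnion hdisj] at hup
  have heq : ∀ P ∈ A.filter (β ∉ ·),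
      ∑ Q ∈ S P, Real.log (Ideal.absNorm Q) / (Ideal.absNorm Q : ℝ) =
        q * (Real.log (Ideal.absNorm P) / Ideal.absNorm P) := by
    intro P hP
    rw [Finset.sum_congr rfl (g := fun _ => Real.log (Ideal.absNorm P) / (Ideal.absNorm P : ℝ))
      fun Q hQ => by rw [(hS P hP Q hQ).2.2.2], Finset.sum_const, hScard P hP, nsmul_eq_mul]
  rw [Finset.sum_congr rfl heq, ← Finset.mul_sum, hrankN] at hup
  set G := ∑ P ∈ A.filter (β ∉ ·), Real.log (Ideal.absNorm P) / (Ideal.absNorm P : ℝ) with hG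
  have hq2 : (2 : ℝ) ≤ q := by exact_mod_cast hq.two_le
  have hGle : G ≤ 5 / 4 * (n * (Real.log w +
      Real.log (2 * cN ^ 2 * (60 * (n * q : ℕ) + 2)))) := by
    refine le_of_mul_le_mul_left (hup.trans (le_of_eq ?_)) (by linarith : (0 : ℝ) < q)
    push_cast
    ring
  rw [Nat.cast_pow, Real.log_pow] at hlow
  have hlw : 0 ≤ n * Real.log w := mul_nonneg (Nat.cast_nonneg _) (Real.log_natCast_nonneg _)
  have h5 : 2 * (n * Real.log w) ≤ n * (q * Real.log w) := by nlinarith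
  linarith

end Kummer

section Unramified

lemma aeval_mem_of_map_eq_zero {R : Type*} [CommRing R] {I : Ideal R} {l : ℕ} (hl : (l : R) ∈ I)
    {f : ℤ[X]} (hf : f.map (Int.castRingHom (ZMod l)) = 0) (x : R) : aeval x f ∈ I := by
  have h : C (l : ℤ) ∣ f := by
    rw [C_dvd_iff_dvd_coeff]
    intro i
    have := congrArg (fun g => g.coeff i) hf
    simpa [ZMod.intCast_zmod_eq_zero_iff_dvd] using this
  obtain ⟨g, rfl⟩ := h
  rw [map_mul, aeval_C]
  refine I.mul_mem_right _ ?_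
  simpa using hl

/-- Roots of a polynomial which is separable modulo `l` stay distinct modulo primes above `l`. -/
lemma eq_of_sub_mem_of_separable {R : Type*} [CommRing R] [IsDomain R] {I : Ideal R} (hI : I ≠ ⊤)
    {l : ℕ} (hl : (l : R) ∈ I) {f : ℤ[X]} (hf : (f.map (Int.castRingHom (ZMod l))).Separable)
    {x y : R} (hx : aeval x f = 0) (hy : aeval y f = 0) (hxy : x - y ∈ I) : x = y := by
  by_contra hne
  have hsurj : Function.Surjective (Polynomial.map (Int.castRingHom (ZMod l))) :=
    Polynomial.map_surjective _ (ZMod.ringHom_surjective _)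
  obtain ⟨u, v, huv⟩ := hf
  obtain ⟨u, rfl⟩ := hsurj u
  obtain ⟨v, rfl⟩ := hsurj v
  have h0 : (u * f + v * derivative f - 1).map (Int.castRingHom (ZMod l)) = 0 := by
    rw [Polynomial.map_sub, Polynomial.map_add, Polynomial.map_mul, Polynomial.map_mul,
      ← derivative_map, huv, Polynomial.map_one, sub_self]
  have h1 := aeval_mem_of_map_eq_zero hl h0 x
  simp only [map_sub, map_add, map_mul, map_one, hx, mul_zero, zero_add] at h1
  obtain ⟨h, hh⟩ : X - C x ∣ f.map (algebraMap ℤ R) := by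
    rw [dvd_iff_isRoot, IsRoot, eval_map_algebraMap]; exact hx
  have h2 : h.eval y = 0 := by
    have := congrArg (eval y) hh
    rw [eval_map_algebraMap, hy, eval_mul, eval_sub, eval_X, eval_C] at this
    rcases mul_eq_zero.1 this.symm with h | h
    · exact absurd (sub_eq_zero.1 h).symm hne
    · exact h
  have h3 : aeval x (derivative f) = h.eval x := by
    have := congrArg (fun g => eval x (derivative g)) hh
    simp only [derivative_map, eval_map_algebraMap, derivative_mul, eval_add, eval_mul, eval_sub,
      eval_X, eval_C, sub_self, zero_mul, add_zero, derivative_sub, derivative_X, derivative_C,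
      sub_zero, one_mul] at this
    exact this
  have h4 : h.eval x ∈ I := by
    obtain ⟨z, hz⟩ := sub_dvd_eval_sub x y h
    rw [h2, sub_zero] at hz
    rw [hz]
    exact I.mul_mem_right _ hxy
  refine hI ((Ideal.eq_top_iff_one I).2 ?_)
  rw [h3] at h1
  have := I.sub_mem (I.mul_mem_left (aeval x v) h4) h1
  rwa [sub_sub_cancel] at this

/-- `a` is not a `q`-th power in the splitting field of a product of two polynomials that are
separable modulo a prime dividing `a` exactly once. -/
theorem pow_ne_of_separable {M : Type*} [Field M] [NumberField M] {f g : ℤ[X]} (hfm : f.Monic)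
    (hgm : g.Monic) {l : ℕ} (hl : l.Prime)
    (hf : (f.map (Int.castRingHom (ZMod l))).Separable)
    (hg : (g.map (Int.castRingHom (ZMod l))).Separable)
    [hspl : IsSplittingField ℚ M ((f * g).map (Int.castRingHom ℚ))]
    {q : ℕ} (hq : 2 ≤ q) {a : ℤ} (hla : (l : ℤ) ∣ a) (hla2 : ¬ (l : ℤ) ^ 2 ∣ a) (x : M) :
    x ^ q ≠ ((a : 𝓞 M) : M) := by
  classical
  intro hx
  have hfg : (f * g).map (Int.castRingHom ℚ) ≠ 0 :=
    ((hfm.mul hgm).map (Int.castRingHom ℚ)).ne_zero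
  have hgal : IsGalois ℚ M := by
    have : Normal ℚ M := Normal.of_isSplittingField ((f * g).map (Int.castRingHom ℚ))
    exact ⟨⟩
  have hlint : Prime (l : ℤ) := Nat.prime_iff_prime_int.1 hl
  have hp : (Ideal.span {(l : ℤ)}).IsPrime :=
    (Ideal.span_singleton_prime hlint.ne_zero).2 hlint
  have hp0 : Ideal.span {(l : ℤ)} ≠ ⊥ := by simpa using hlint.ne_zero
  have hpm : (Ideal.span {(l : ℤ)}).IsMaximal := hp.isMaximal hp0
  have : Fact l.Prime := ⟨hl⟩
  obtain ⟨L, hL, hLover⟩ := Ideal.exists_maximal_ideal_liesOver_of_isIntegral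
    (S := 𝓞 M) (Ideal.span {(l : ℤ)})
  have hLp := hL.isPrime
  have hlL : (l : 𝓞 M) ∈ L := by
    have := (Ideal.mem_of_liesOver L (Ideal.span {(l : ℤ)}) (l : ℤ)).1
      (Ideal.mem_span_singleton_self _)
    simpa using this
  have hL0 : L ≠ ⊥ := Ideal.ne_bot_of_liesOver_of_ne_bot hp0 L
  have hinertia : Ideal.inertia (M ≃ₐ[ℚ] M) L = ⊥ := by
    rw [eq_bot_iff]
    intro σ hσ
    rw [Subgroup.mem_bot]
    have hroot : ∀ (h : ℤ[X]), h.Monic → (h.map (Int.castRingHom (ZMod l))).Separable →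
        ∀ y : M, aeval y h = 0 → σ y = y := by
      intro h hm hs y hy
      have hint : IsIntegral ℤ y := ⟨h, hm, hy⟩
      obtain ⟨z, rfl⟩ : ∃ z : 𝓞 M, (z : M) = y := ⟨⟨y, hint⟩, rfl⟩
      have hz : aeval z h = 0 := by
        have : algebraMap (𝓞 M) M (aeval z h) = 0 := by rw [← aeval_algebraMap_apply]; exact hy
        exact (map_eq_zero_iff _ RingOfIntegers.coe_injective).1 this
      have hz' : aeval (σ • z) h = 0 := by
        have : aeval (σ • z) h = σ • aeval z h := by
          have := Polynomial.aeval_algHom_apply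
            ((MulSemiringAction.toRingHom (M ≃ₐ[ℚ] M) (𝓞 M) σ).toIntAlgHom) z h
          exact this
        rw [this, hz, smul_zero]
      have := eq_of_sub_mem_of_separable hLp.ne_top hlL hs hz' hz (hσ z)
      exact congrArg (fun t : 𝓞 M => (t : M)) this
    have hadj := IsSplittingField.adjoin_rootSet M ((f * g).map (Int.castRingHom ℚ))
    have heq : (σ : M →ₐ[ℚ] M) = AlgHom.id ℚ M := by
      refine AlgHom.ext_of_adjoin_eq_top hadj fun y hy => ?_
      rw [mem_rootSet] at hy
      have hy2 := hy.2
      have e : aeval y ((f * g).map (Int.castRingHom ℚ)) = aeval y (f * g) :=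
        aeval_map_algebraMap ℚ y (f * g)
      rw [e, map_mul, mul_eq_zero] at hy2
      rcases hy2 with h | h
      · exact hroot f hfm hf y h
      · exact hroot g hgm hg y h
    ext y
    exact DFunLike.congr_fun heq y
  have hcard := Ideal.card_inertia_eq_ramificationIdxIn (G := M ≃ₐ[ℚ] M)
    (Ideal.span {(l : ℤ)}) L
  rw [hinertia, Subgroup.card_bot, Ideal.ramificationIdxIn_eq_ramificationIdx _ L (M ≃ₐ[ℚ] M)]
    at hcard
  have hram := Ideal.ramificationIdx'_eq_ramificationIdx (Ideal.span {(l : ℤ)}) L hp0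
  rw [← hcard] at hram
  have hmapL : Ideal.map (algebraMap ℤ (𝓞 M)) (Ideal.span {(l : ℤ)}) ≤ L := by
    rw [Ideal.map_span, Set.image_singleton, Ideal.span_singleton_le_iff_mem]
    simpa using hlL
  have hsq : ¬ Ideal.map (algebraMap ℤ (𝓞 M)) (Ideal.span {(l : ℤ)}) ≤ L ^ 2 := fun h =>
    (Ideal.ramificationIdx'_ne_one_iff hmapL).2 h hram
  refine hsq ?_
  rw [Ideal.map_span, Set.image_singleton, Ideal.span_singleton_le_iff_mem]
  have hxint : IsIntegral ℤ x := by
    refine IsIntegral.of_pow (by omega : 0 < q) ?_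
    rw [hx]
    exact RingOfIntegers.isIntegral_coe _
  obtain ⟨b, rfl⟩ : ∃ z : 𝓞 M, (z : M) = x := ⟨⟨x, hxint⟩, rfl⟩
  have hb : b ^ q = (a : 𝓞 M) := RingOfIntegers.ext (by simpa using hx)
  obtain ⟨a', rfl⟩ := hla
  have hnd : ¬ (l : ℤ) ∣ a' := fun h => hla2 (by
    rw [pow_two]; exact mul_dvd_mul_left _ h)
  have hbL : b ∈ L := by
    refine hLp.mem_of_pow_mem q ?_
    rw [hb]
    push_cast
    exact L.mul_mem_right _ hlL
  have hb2 : (((l : ℤ) * a' : ℤ) : 𝓞 M) ∈ L ^ 2 := by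
    rw [← hb]
    exact Ideal.pow_le_pow_right hq (Ideal.pow_mem_pow hbL q)
  obtain ⟨s, t, hst⟩ := (hlint.coprime_iff_not_dvd (n := a')).2 hnd
  have e : ((l : ℤ) : ℤ) = s * (l : ℤ) * l + t * (l * a') := by linear_combination -(l : ℤ) * hst
  have hl2 : ((l : ℤ) * l : 𝓞 M) ∈ L ^ 2 := by
    rw [pow_two]
    exact Ideal.mul_mem_mul (by simpa using hlL) (by simpa using hlL)
  rw [e]
  push_cast at hb2 hl2 ⊢
  refine (L ^ 2).add_mem ?_ ((L ^ 2).mul_mem_left _ hb2)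
  rw [mul_assoc]
  exact (L ^ 2).mul_mem_left _ hl2

end Unramified

section SplittingFieldBasis

lemma house_le_of_forall_embedding {K : Type*} [Field K] [NumberField K] {x : K} {R : ℝ}
    (hR : 0 ≤ R) (h : ∀ φ : K →+* ℂ, ‖φ x‖ ≤ R) : house x ≤ R := by
  rw [house, pi_norm_le_iff_of_nonneg hR]
  intro φ
  rw [canonicalEmbedding.apply_at]
  exact h φ

lemma house_prod_le' {K ι : Type*} [Field K] [NumberField K] (s : Finset ι) (f : ι → K) :
    house (∏ i ∈ s, f i) ≤ ∏ i ∈ s, house (f i) := by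
  classical
  induction s using Finset.induction_on with
  | empty =>
    have := house_intCast (K := K) 1
    simpa using this.le
  | insert a s ha ih =>
    rw [Finset.prod_insert ha, Finset.prod_insert ha]
    exact (house_mul_le _ _).trans (mul_le_mul_of_nonneg_left ih (house_nonneg _))

/-- The monomials with exponents less than `m` in a family of generators of degree at most `m`
span. -/
lemma span_monomials_eq_top {k K σ : Type*} [Field k] [Field K] [Algebra k K] [Fintype σ]
    {r : σ → K} (htop : Algebra.adjoin k (Set.range r) = ⊤) {F : k[X]} (hF : F.Monic)
    {m : ℕ} (hm : F.natDegree ≤ m) (hm1 : 1 ≤ m) (hroot : ∀ i, aeval (r i) F = 0) :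
    Submodule.span k (Set.range fun e : σ → Fin m => ∏ i, r i ^ (e i : ℕ)) = ⊤ := by
  classical
  set V := Submodule.span k (Set.range fun e : σ → Fin m => ∏ i, r i ^ (e i : ℕ)) with hV
  have hmon : ∀ e : σ → ℕ, (∀ i, e i < m) → ∏ i, r i ^ e i ∈ V := fun e he =>
    Submodule.subset_span ⟨fun i => ⟨e i, he i⟩, rfl⟩
  have hmul : ∀ i, ∀ v ∈ V, r i * v ∈ V := by
    intro i v hv
    induction hv using Submodule.span_induction with
    | mem x hx =>
      obtain ⟨e, rfl⟩ := hx
      have hF1 : F ≠ 1 := by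
        rintro rfl
        simpa using hroot i
      set p : k[X] := X ^ ((e i : ℕ) + 1) %ₘ F
      have hp : aeval (r i) p = r i ^ ((e i : ℕ) + 1) := by
        have := congrArg (aeval (r i)) (modByMonic_add_div (X ^ ((e i : ℕ) + 1)) F)
        simpa [hroot i] using this
      have hsum := aeval_eq_sum_range' ((natDegree_modByMonic_lt _ hF hF1).trans_le hm)
        (p := p) (r i)
      beta_reduce
      rw [← Finset.mul_prod_erase _ _ (Finset.mem_univ i), ← mul_assoc, ← pow_succ', ← hp, hsum,
        Finset.sum_mul]
      refine V.sum_mem fun j hj => ?_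
      rw [smul_mul_assoc]
      refine V.smul_mem _ ?_
      have := hmon (Function.update (fun l => (e l : ℕ)) i j) (by
        intro l
        by_cases hl : l = i
        · subst hl; simpa using hj
        · simp [hl])
      rw [← Finset.mul_prod_erase _ _ (Finset.mem_univ i), Function.update_self] at this
      convert this using 2
      refine Finset.prod_congr rfl fun l hl => ?_
      rw [Function.update_of_ne (Finset.ne_of_mem_erase hl)]
    | zero => simp
    | add x y _ _ hx hy => rw [mul_add]; exact V.add_mem hx hy
    | smul c x _ hx => rw [mul_smul_comm]; exact V.smul_mem _ hx
  have h1 : (1 : K) ∈ V := by simpa using hmon (fun _ => 0) (fun _ => hm1)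
  rw [eq_top_iff]
  intro x _
  have hx : x ∈ Algebra.adjoin k (Set.range r) := htop ▸ Algebra.mem_top
  have : ∀ v ∈ V, x * v ∈ V := by
    clear * - hx hmul
    induction hx using Algebra.adjoin_induction with
    | mem x hx => obtain ⟨i, rfl⟩ := hx; exact hmul i
    | algebraMap c =>
      intro v hv
      rw [← Algebra.smul_def]
      exact V.smul_mem _ hv
    | add x y _ _ hx hy =>
      intro v hv
      rw [add_mul]
      exact V.add_mem (hx v hv) (hy v hv)
    | mul x y _ _ hx hy =>
      intro v hv
      rw [mul_assoc]
      exact hx _ (hy v hv)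
  simpa using this 1 h1

lemma mul_pow_le_two_pow {m : ℕ} (hm : 5 ≤ m) : m ^ m * m ^ (m * m) ≤ 2 ^ m ^ m := by
  have h1 : m * (m + m * m) ≤ m ^ m := by
    calc m * (m + m * m) ≤ m * (m * m + m * m) := by gcongr; nlinarith
      _ = 2 * m ^ 3 := by ring
      _ ≤ m ^ 2 * m ^ 3 := by gcongr; nlinarith
      _ = m ^ 5 := by ring
      _ ≤ m ^ m := Nat.pow_le_pow_right (by omega) hm
  calc m ^ m * m ^ (m * m) = m ^ (m + m * m) := (pow_add _ _ _).symm
    _ ≤ (2 ^ m) ^ (m + m * m) := Nat.pow_le_pow_left Nat.lt_two_pow_self.le _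
    _ = 2 ^ (m * (m + m * m)) := (pow_mul _ _ _).symm
    _ ≤ 2 ^ m ^ m := Nat.pow_le_pow_right (by norm_num) h1

/-- Degree and lattice bounds for the splitting field of an integral polynomial of degree at most
`m` whose complex roots have absolute value at most `m`. -/
theorem latticeBound_of_isSplittingField {K : Type*} [Field K] [NumberField K] {F : ℤ[X]}
    (hF : F.Monic) [IsSplittingField ℚ K (F.map (Int.castRingHom ℚ))] {m : ℕ}
    (hm5 : 5 ≤ m) (hm : F.natDegree ≤ m) (hroots : ∀ z : ℂ, aeval z F = 0 → ‖z‖ ≤ m) :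
    Module.finrank ℚ K ≤ m ^ m ∧ LatticeBound K (2 ^ m ^ m) := by
  classical
  set Fq := F.map (Int.castRingHom ℚ) with hFq
  have hFqm : Fq.Monic := hF.map _
  have haev : ∀ x : K, aeval x Fq = aeval x F := fun x => aeval_map_algebraMap ℚ x F
  have hfin : Fintype (Fq.rootSet K) := (rootSet_finite Fq K).fintype
  have hcardS : Fintype.card (Fq.rootSet K) ≤ m := by
    rw [← Set.toFinset_card]
    have : (Fq.rootSet K).toFinset = (Fq.aroots K).toFinset := by
      ext x
      rw [Set.mem_toFinset, mem_rootSet, Multiset.mem_toFinset, mem_aroots]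
    rw [this]
    refine (Multiset.toFinset_card_le _).trans ((card_roots' _).trans ?_)
    rw [natDegree_map, hFq, hF.natDegree_map]
    exact hm
  have hroot : ∀ x : Fq.rootSet K, aeval (x : K) F = 0 := fun x => by
    rw [← haev]; exact aeval_eq_zero_of_mem_rootSet x.2
  let r : Fq.rootSet K → 𝓞 K := fun x => ⟨x, F, hF, hroot x⟩
  have hr : ∀ x, house (r x : K) ≤ m := fun x =>
    house_le_of_forall_embedding (Nat.cast_nonneg m) fun φ => hroots _ (by
      have := congrArg φ (hroot x)
      rw [map_zero] at this
      rw [← this]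
      exact aeval_algHom_apply φ.toIntAlgHom (x : K) F)
  have htop : Algebra.adjoin ℚ (Set.range fun x : Fq.rootSet K => (x : K)) = ⊤ := by
    rw [Subtype.range_coe]
    exact IsSplittingField.adjoin_rootSet K Fq
  have hspan := span_monomials_eq_top htop hFqm (m := m) (by
    rw [hFq, hF.natDegree_map]; exact hm) (by omega)
    (fun x => aeval_eq_zero_of_mem_rootSet x.2)
  have hdeg : Module.finrank ℚ K ≤ m ^ m := by
    have h1 := finrank_range_le_card (R := ℚ)
      (fun e : Fq.rootSet K → Fin m => ∏ i : Fq.rootSet K, (i : K) ^ (e i : ℕ))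
    rw [Set.finrank, hspan, finrank_top] at h1
    refine h1.trans ?_
    rw [Fintype.card_fun, Fintype.card_fin]
    exact Nat.pow_le_pow_right (by omega) hcardS
  refine ⟨hdeg, ?_⟩
  obtain ⟨κ, a, hinj, hsp, hli⟩ := exists_linearIndependent' ℚ
    (fun e : Fq.rootSet K → Fin m => ∏ i : Fq.rootSet K, (i : K) ^ (e i : ℕ))
  have := Fintype.ofInjective a hinj
  have hbasis : IsShortBasis (K := K)
      (fun j : κ => ∏ i : Fq.rootSet K, r i ^ ((a j i : Fin m) : ℕ)) ((m : ℝ) ^ (m * m)) := by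
    have e : (fun j : κ => ((∏ i : Fq.rootSet K, r i ^ ((a j i : Fin m) : ℕ) : 𝓞 K) : K)) =
        (fun e : Fq.rootSet K → Fin m => ∏ i : Fq.rootSet K, (i : K) ^ (e i : ℕ)) ∘ a := by
      funext j
      simp only [Function.comp, map_prod, map_pow]
      rfl
    have hm1 : (1 : ℝ) ≤ m := by exact_mod_cast (by omega : 1 ≤ m)
    refine ⟨by rw [e]; exact hli, by rw [e, hsp, hspan], fun j => ?_⟩
    simp only [map_prod, map_pow]
    calc house (∏ i : Fq.rootSet K, (r i : K) ^ ((a j i : Fin m) : ℕ))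
        ≤ ∏ i : Fq.rootSet K, house ((r i : K) ^ ((a j i : Fin m) : ℕ)) := house_prod_le' _ _
      _ ≤ ∏ i : Fq.rootSet K, (m : ℝ) ^ m := by
          refine Finset.prod_le_prod (fun i _ => house_nonneg _) fun i _ => ?_
          refine (house_pow_le _ _).trans ((pow_le_pow_left₀ (house_nonneg _) (hr i) _).trans ?_)
          exact pow_le_pow_right₀ hm1 (a j i).2.le
      _ = (m : ℝ) ^ (m * Fintype.card (Fq.rootSet K)) := by
          rw [Finset.prod_const, Finset.card_univ, pow_mul]
      _ ≤ (m : ℝ) ^ (m * m) := pow_le_pow_right₀ hm1 (Nat.mul_le_mul_left _ hcardS)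
  refine hbasis.latticeBound Nat.one_le_two_pow ?_
  have h1 := (Nat.mul_le_mul_right (m ^ (m * m)) hdeg).trans (mul_pow_le_two_pow hm5)
  exact_mod_cast h1

end SplittingFieldBasis

section ConsecutivePoly

/-- The polynomial whose roots `x` satisfy `P(x + 1) ⋯ P(x + k) = 1`, where `P = X ^ d - a`. -/
noncomputable def consecutivePoly (d : ℕ) (a : ℤ) (k : ℕ) : ℤ[X] :=
  ∏ i ∈ Icc 1 k, (X ^ d - C a).comp (X + C (i : ℤ)) - 1

variable {d : ℕ} {a : ℤ} {k : ℕ}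

lemma monic_prod_shift (hd : d ≠ 0) :
    (∏ i ∈ Icc 1 k, (X ^ d - C a).comp (X + C (i : ℤ)) : ℤ[X]).Monic :=
  monic_prod_of_monic _ _ fun _ _ => (monic_X_pow_sub_C a hd).comp_X_add_C _

lemma natDegree_prod_shift (hd : d ≠ 0) :
    (∏ i ∈ Icc 1 k, (X ^ d - C a).comp (X + C (i : ℤ)) : ℤ[X]).natDegree = d * k := by
  rw [natDegree_prod_of_monic _ _ fun _ _ => (monic_X_pow_sub_C a hd).comp_X_add_C _,
    Finset.sum_congr rfl fun i _ => show _ = d by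
      rw [natDegree_comp, natDegree_X_add_C, natDegree_X_pow_sub_C, mul_one]]
  simp [mul_comm]

lemma degree_one_lt_degree_prod_shift (hd : d ≠ 0) (hk : k ≠ 0) :
    (1 : ℤ[X]).degree <
      (∏ i ∈ Icc 1 k, (X ^ d - C a).comp (X + C (i : ℤ)) : ℤ[X]).degree := by
  rw [degree_eq_natDegree (monic_prod_shift hd).ne_zero, natDegree_prod_shift hd, degree_one]
  exact_mod_cast Nat.pos_of_ne_zero (mul_ne_zero hd hk)

lemma monic_consecutivePoly (hd : d ≠ 0) (hk : k ≠ 0) : (consecutivePoly d a k).Monic :=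
  (monic_prod_shift hd).sub_of_left (degree_one_lt_degree_prod_shift hd hk)

lemma natDegree_consecutivePoly (hd : d ≠ 0) :
    (consecutivePoly d a k).natDegree = d * k := by
  rw [consecutivePoly, ← C_1, natDegree_sub_C, natDegree_prod_shift hd]

lemma aeval_consecutivePoly {R : Type*} [CommRing R] (x : R) :
    aeval x (consecutivePoly d a k) = ∏ i ∈ Icc 1 k, ((x + (i : R)) ^ d - (a : R)) - 1 := by
  simp [consecutivePoly, map_prod]

lemma prod_Icc_zmod {R : Type*} [CommRing R] (l : ℕ) [NeZero l] (g : ZMod l → R) (t : ℕ) :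
    ∏ i ∈ Icc 1 (l * t), g (i : ZMod l) = (∏ c, g c) ^ t := by
  have hbase : ∏ i ∈ Finset.range l, g ((i + 1 : ℕ) : ZMod l) = ∏ c, g c := by
    rw [← Equiv.prod_comp (Equiv.addRight (1 : ZMod l))]
    refine Finset.prod_bij' (fun i _ => (i : ZMod l)) (fun c _ => c.val) ?_ ?_ ?_ ?_ ?_
    · simp
    · intro c _; simpa using ZMod.val_lt c
    · intro i hi; exact ZMod.val_cast_of_lt (by simpa using hi)
    · simp
    · intro i _; simp
  have hrange : ∀ n : ℕ, ∏ i ∈ Icc 1 n, g (i : ZMod l)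
      = ∏ i ∈ Finset.range n, g ((i + 1 : ℕ) : ZMod l) := by
    intro n
    induction n with
    | zero => simp
    | succ n ih => rw [Finset.prod_Icc_succ_top (by omega), ih, Finset.prod_range_succ]
  rw [hrange]
  clear hrange
  induction t with
  | zero => simp
  | succ t ih =>
    rw [Nat.mul_succ, Finset.prod_range_add, ih, pow_succ]
    congr 1
    rw [← hbase]
    refine Finset.prod_congr rfl fun i _ => ?_
    push_cast
    simp

lemma consecutivePoly_map_zmod {l : ℕ} [Fact l.Prime] (hla : (l : ℤ) ∣ a) (t : ℕ) :
    (consecutivePoly d a (l * t)).map (Int.castRingHom (ZMod l))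
      = (X ^ l - X) ^ (d * t) - 1 := by
  have ha : (a : ZMod l) = 0 := (ZMod.intCast_zmod_eq_zero_iff_dvd a l).2 hla
  have h1 : ∏ c : ZMod l, (X + C c) = (X ^ l - X : (ZMod l)[X]) := by
    have hl : 1 < l := (Fact.out : l.Prime).one_lt
    have this : ∏ c : ZMod l, (X - C c) = (X ^ l - X : (ZMod l)[X]) := by
      have hr := FiniteField.roots_X_pow_card_sub_X (ZMod l)
      rw [ZMod.card] at hr
      have hm : (X ^ l - X : (ZMod l)[X]).Monic := by
        refine monic_X_pow_sub ?_
        rw [degree_X]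
        exact_mod_cast hl
      have h := prod_multiset_X_sub_C_of_monic_of_roots_card_eq hm (by
        rw [hr, FiniteField.X_pow_card_sub_X_natDegree_eq _ hl]
        simp [ZMod.card])
      rw [hr] at h
      exact h
    rw [← this, ← Equiv.prod_comp (Equiv.neg (ZMod l))]
    simp [sub_eq_add_neg]
  have h2 := prod_Icc_zmod l (fun c : ZMod l => (X + C c) ^ d) t
  rw [Finset.prod_pow univ, h1, ← pow_mul] at h2
  rw [← h2]
  have ha' : (a : (ZMod l)[X]) = 0 := by rw [← map_intCast (C : ZMod l →+* (ZMod l)[X]), ha, map_zero]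
  simp [consecutivePoly, Polynomial.map_prod, ha']

lemma separable_consecutivePoly {l : ℕ} [Fact l.Prime] (hla : (l : ℤ) ∣ a) {t : ℕ}
    (hdt : ¬ l ∣ d * t) :
    ((consecutivePoly d a (l * t)).map (Int.castRingHom (ZMod l))).Separable := by
  rw [consecutivePoly_map_zmod hla]
  set e := d * t with he
  have he0 : (e : ZMod l) ≠ 0 := by rwa [Ne, ZMod.natCast_eq_zero_iff]
  obtain ⟨e', he'⟩ : ∃ e', e = e' + 1 := Nat.exists_eq_succ_of_ne_zero (by
    rintro h; rw [h] at he0; simp at he0)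
  have hu : C (e : ZMod l)⁻¹ * (e : (ZMod l)[X]) = 1 := by
    rw [← map_natCast C, ← C_mul, inv_mul_cancel₀ he0, C_1]
  refine ⟨-1, -C (e : ZMod l)⁻¹ * (X ^ l - X), ?_⟩
  have hder : derivative ((X ^ l - X : (ZMod l)[X]) ^ e - 1)
      = -(e : (ZMod l)[X]) * (X ^ l - X) ^ e' := by
    rw [derivative_sub, derivative_pow, he', derivative_sub, derivative_X_pow]
    simp
    ring
  rw [hder]
  have hpow : (X ^ l - X : (ZMod l)[X]) ^ e = (X ^ l - X) ^ e' * (X ^ l - X) := by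
    rw [he', pow_succ]
  rw [hpow]
  linear_combination (X ^ l - X : (ZMod l)[X]) * (X ^ l - X : (ZMod l)[X]) ^ e' * hu

lemma norm_le_of_aeval_consecutivePoly (hd : d ≠ 0) (hk : k ≠ 0) {z : ℂ}
    (hz : aeval z (consecutivePoly d a k) = 0) : ‖z‖ ≤ k + |(a : ℝ)| + 2 := by
  by_contra! h
  rw [aeval_consecutivePoly, sub_eq_zero] at hz
  have h2 : ∀ i ∈ Icc 1 k, 2 ≤ ‖(z + (i : ℂ)) ^ d - (a : ℂ)‖ := by
    intro i hi
    have hik : (i : ℝ) ≤ k := by exact_mod_cast (Finset.mem_Icc.1 hi).2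
    have h3 : |(a : ℝ)| + 2 ≤ ‖z + (i : ℂ)‖ := by
      have := norm_sub_le (z + (i : ℂ)) (i : ℂ)
      rw [add_sub_cancel_right, Complex.norm_natCast] at this
      linarith
    have h4 : |(a : ℝ)| + 2 ≤ ‖z + (i : ℂ)‖ ^ d :=
      h3.trans (le_self_pow₀ (by linarith [abs_nonneg (a : ℝ)]) hd)
    have h5 := norm_sub_norm_le ((z + (i : ℂ)) ^ d) (a : ℂ)
    rw [norm_pow, Complex.norm_intCast] at h5
    linarith
  have h6 : (2 : ℝ) ^ k ≤ ∏ i ∈ Icc 1 k, ‖(z + (i : ℂ)) ^ d - (a : ℂ)‖ := by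
    have := Finset.prod_le_prod (s := Icc 1 k) (f := fun _ => (2 : ℝ)) (fun _ _ => by norm_num) h2
    simpa using this
  rw [← norm_prod, hz, norm_one] at h6
  exact absurd h6 (not_le.2 (one_lt_pow₀ (by norm_num) hk))

end ConsecutivePoly

section Roots

variable {M : Type*} [Field M] [NumberField M]

/-- A monic integral polynomial which is separable modulo a prime has as many roots in the ring of
integers of a field where it splits as its degree. -/
lemma exists_roots_of_separable {F : ℤ[X]} (hF : F.Monic) {l : ℕ} (hl : l.Prime)
    (hsep : (F.map (Int.castRingHom (ZMod l))).Separable)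
    (hspl : ((F.map (Int.castRingHom ℚ)).map (algebraMap ℚ M)).Splits) :
    ∃ S : Finset (𝓞 M), S.card = F.natDegree ∧ ∀ x ∈ S, aeval x F = 0 := by
  classical
  have hmap : (F.map (Int.castRingHom ℚ)).map (algebraMap ℚ M) = F.map (algebraMap ℤ M) := by
    rw [Polynomial.map_map]
    congr 1
    exact RingHom.ext_int _ _
  rw [hmap] at hspl
  have hFM : (F.map (algebraMap ℤ M)).Monic := hF.map _
  have hroot : ∀ x ∈ (F.map (algebraMap ℤ M)).roots, aeval x F = 0 := by
    intro x hx
    have := isRoot_of_mem_roots hx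
    rwa [IsRoot, eval_map_algebraMap] at this
  have hint : ∀ x : M, aeval x F = 0 → ∃ y : 𝓞 M, (y : M) = x ∧ aeval y F = 0 := by
    intro x hx
    refine ⟨⟨x, F, hF, hx⟩, rfl, ?_⟩
    refine (map_eq_zero_iff (algebraMap (𝓞 M) M) RingOfIntegers.coe_injective).1 ?_
    exact (aeval_algebraMap_apply M _ F).symm.trans hx
  have hnodup : (F.map (algebraMap ℤ M)).roots.Nodup := by
    rw [Multiset.nodup_iff_count_le_one]
    intro x
    rw [count_roots]
    by_contra! hlt
    obtain ⟨hx1, hx2⟩ := (one_lt_rootMultiplicity_iff_isRoot hFM.ne_zero).1 hlt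
    rw [IsRoot, eval_map_algebraMap] at hx1
    rw [IsRoot, derivative_map, eval_map_algebraMap] at hx2
    obtain ⟨y, rfl, hy⟩ := hint x hx1
    have hy2 : aeval y (derivative F) = 0 := by
      refine (map_eq_zero_iff (algebraMap (𝓞 M) M) RingOfIntegers.coe_injective).1 ?_
      rw [← aeval_algebraMap_apply]
      exact hx2
    have hsurj : Function.Surjective (Polynomial.map (Int.castRingHom (ZMod l))) :=
      Polynomial.map_surjective _ (ZMod.ringHom_surjective _)
    obtain ⟨u, v, huv⟩ := hsep
    obtain ⟨u, rfl⟩ := hsurj u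
    obtain ⟨v, rfl⟩ := hsurj v
    have h0 : (u * F + v * derivative F - 1).map (Int.castRingHom (ZMod l)) = 0 := by
      rw [Polynomial.map_sub, Polynomial.map_add, Polynomial.map_mul, Polynomial.map_mul,
        ← derivative_map, huv, Polynomial.map_one, sub_self]
    have h1 := aeval_mem_of_map_eq_zero (Ideal.mem_span_singleton_self (l : 𝓞 M)) h0 y
    simp only [map_sub, map_add, map_mul, map_one, hy, hy2, mul_zero, zero_add, zero_sub] at h1
    have h2 : Ideal.span {(l : 𝓞 M)} = ⊤ := by
      rw [Ideal.eq_top_iff_one]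
      simpa using (Ideal.span {(l : 𝓞 M)}).neg_mem h1
    have h3 := Ideal.absNorm_span_natCast (S := 𝓞 M) l
    rw [h2, Ideal.absNorm_top] at h3
    have := Nat.one_lt_pow (Module.finrank_pos (R := ℤ) (M := 𝓞 M)).ne' hl.one_lt
    omega
  choose! g hg1 hg2 using hint
  refine ⟨(F.map (algebraMap ℤ M)).roots.toFinset.image g, ?_, ?_⟩
  · rw [Finset.card_image_of_injOn, Multiset.toFinset_card_of_nodup hnodup,
      ← hspl.natDegree_eq_card_roots, hF.natDegree_map]
    intro x hx y hy hxy
    have hx' := hroot x (by simpa only [Finset.mem_coe, Multiset.mem_toFinset] using hx)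
    have hy' := hroot y (by simpa only [Finset.mem_coe, Multiset.mem_toFinset] using hy)
    rw [← hg1 x hx', ← hg1 y hy']
    exact congrArg _ hxy
  · intro y hy
    obtain ⟨x, hx, rfl⟩ := Finset.mem_image.1 hy
    exact hg2 x (hroot x (by simpa only [Multiset.mem_toFinset] using hx))

end Roots

section MissingCount

lemma Fprod_add (P : ℤ[X]) (n k : ℕ) :
    Fprod P (n + k) = Fprod P n * ∏ i ∈ Icc 1 k, P.eval ((n : ℤ) + i) := by
  induction k with
  | zero => simp
  | succ k ih =>
    rw [← add_assoc, Fprod, Finset.prod_Icc_succ_top (by omega), Finset.prod_Icc_succ_top (by omega),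
      ← mul_assoc, ← ih, Fprod]
    push_cast
    rw [add_assoc]

/-- If `F(n + k) = F(n)` for all `n` in a set of `k` indices, then `F` misses `k` values. -/
lemma card_image_add_le {α : Type*} [DecidableEq α] (F : ℕ → α) {p k : ℕ} (hk : 1 ≤ k)
    {N : Finset ℕ} (hcard : k ≤ N.card) (hN : ∀ n ∈ N, 1 ≤ n ∧ n + k ≤ p ∧ F (n + k) = F n) :
    ((Icc 1 p).image F).card + k ≤ p := by
  set N' := N.image (· + k) with hN'
  have hcard' : N'.card = N.card := Finset.card_image_of_injective _ (add_left_injective k)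
  have hsub : N' ⊆ Icc 1 p := by
    intro m hm
    obtain ⟨n, hn, rfl⟩ := Finset.mem_image.1 hm
    have := hN n hn
    simp only [Finset.mem_Icc]
    omega
  have himg : (Icc 1 p).image F ⊆ (Icc 1 p \ N').image F := by
    intro y hy
    obtain ⟨n, hn, rfl⟩ := Finset.mem_image.1 hy
    clear hy
    induction n using Nat.strong_induction_on with
    | _ n ih =>
      by_cases h : n ∈ N'
      · obtain ⟨m, hm, rfl⟩ := Finset.mem_image.1 h
        obtain ⟨h1, h2, h3⟩ := hN m hm
        rw [h3]
        exact ih m (by omega) (by simp only [Finset.mem_Icc]; omega)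
      · exact Finset.mem_image_of_mem _ (Finset.mem_sdiff.2 ⟨hn, h⟩)
  have h1 := (Finset.card_le_card himg).trans Finset.card_image_le
  rw [Finset.card_sdiff_of_subset hsub, Nat.card_Icc] at h1
  have h2 := Finset.card_le_card hsub
  rw [Nat.card_Icc] at h2
  omega

lemma Gval_add_le {P : ℤ[X]} {p : ℕ} [Fact p.Prime] {k : ℕ} (hk : 1 ≤ k) {T : Finset (ZMod p)}
    (hT : 2 * k ≤ T.card)
    (hroot : ∀ x ∈ T, ∏ i ∈ Icc 1 k, aeval (x + (i : ZMod p)) P = 1) :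
    Gval P p + k ≤ p := by
  classical
  set T' := T \ (Finset.range k).image (fun j : ℕ => -(j : ZMod p)) with hT'
  have hT'card : k ≤ T'.card := by
    have h1 := Finset.le_card_sdiff ((Finset.range k).image (fun j : ℕ => -(j : ZMod p))) T
    have h2 : ((Finset.range k).image (fun j : ℕ => -(j : ZMod p))).card ≤ k := by
      simpa using Finset.card_image_le (s := Finset.range k) (f := fun j : ℕ => -(j : ZMod p))
    rw [← hT'] at h1
    omega
  have hnot : ∀ x ∈ T', ∀ j < k, x ≠ -(j : ZMod p) := by
    intro x hx j hj h
    exact (Finset.mem_sdiff.1 hx).2 (Finset.mem_image.2 ⟨j, Finset.mem_range.2 hj, h.symm⟩)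
  refine card_image_add_le (fun n => ((Fprod P n : ℤ) : ZMod p)) hk (N := T'.image ZMod.val) ?_ ?_
  · rw [Finset.card_image_of_injective _ (ZMod.val_injective p)]
    exact hT'card
  · intro n hn
    obtain ⟨x, hx, rfl⟩ := Finset.mem_image.1 hn
    have hval : ((x.val : ℕ) : ZMod p) = x := ZMod.natCast_zmod_val x
    refine ⟨?_, ?_, ?_⟩
    · by_contra! h
      refine hnot x hx 0 (by omega) ?_
      rw [← hval, show x.val = 0 by omega]
      simp
    · by_contra! h
      have hlt := ZMod.val_lt x
      refine hnot x hx (p - x.val) (by omega) ?_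
      rw [Nat.cast_sub hlt.le, CharP.cast_eq_zero, hval]
      ring
    · rw [Fprod_add]
      push_cast
      have h1 := hroot x (Finset.mem_sdiff.1 hx).1
      have h2 : ∏ i ∈ Icc 1 k, ((P.eval ((x.val : ℤ) + i) : ℤ) : ZMod p) = 1 := by
        rw [← h1]
        refine Finset.prod_congr rfl fun i _ => ?_
        have := eval_intCast_map (Int.castRingHom (ZMod p)) P ((x.val : ℤ) + i)
        rw [eq_intCast] at this
        simp only [Int.cast_id] at this
        rw [← this, ← eval_map_algebraMap]
        push_cast
        rw [hval]
        rfl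
      rw [h2, mul_one]

/-- Roots of `consecutivePoly` in a ring mapping onto `𝔽_p`, staying distinct modulo `P`. -/
lemma Gval_add_le_of_roots {M : Type*} [Field M] [NumberField M] {d : ℕ} {a : ℤ} {k : ℕ}
    (hd : 2 ≤ d) (hk : 1 ≤ k) {P : Ideal (𝓞 M)} (hP : (Ideal.absNorm P).Prime)
    {S : Finset (𝓞 M)} (hcard : S.card = d * k)
    (hroot : ∀ x ∈ S, aeval x (consecutivePoly d a k) = 0)
    (hdist : ∀ x ∈ S, ∀ y ∈ S, x ≠ y → x - y ∉ P) :
    Gval (X ^ d - C a) (Ideal.absNorm P) + k ≤ Ideal.absNorm P := by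
  classical
  set p := Ideal.absNorm P with hp
  have : Fact p.Prime := ⟨hP⟩
  have hcq : Nat.card (𝓞 M ⧸ P) = p := by rw [hp, Ideal.absNorm_apply, Submodule.cardQuot_apply]
  have hfin : Finite (𝓞 M ⧸ P) := Nat.finite_of_card_ne_zero (by rw [hcq]; exact hP.ne_zero)
  have := Fintype.ofFinite (𝓞 M ⧸ P)
  rw [Nat.card_eq_fintype_card] at hcq
  let e : ZMod p ≃+* 𝓞 M ⧸ P := ZMod.ringEquivOfPrime _ hP hcq
  let φ : 𝓞 M →+* ZMod p := e.symm.toRingHom.comp (Ideal.Quotient.mk P)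
  refine Gval_add_le hk (T := S.image φ) ?_ ?_
  · rw [Finset.card_image_of_injOn, hcard]
    · exact Nat.mul_le_mul_right _ hd
    · intro x hx y hy hxy
      by_contra hne
      refine hdist x hx y hy hne ?_
      exact Ideal.Quotient.eq.1 (e.symm.injective hxy)
  · intro z hz
    obtain ⟨x, hx, rfl⟩ := Finset.mem_image.1 hz
    have h1 := congrArg φ (hroot x hx)
    rw [aeval_consecutivePoly, map_sub, map_zero, map_one, sub_eq_zero, map_prod] at h1
    rw [← h1]
    refine Finset.prod_congr rfl fun i _ => ?_
    simp

end MissingCount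

section Parameters

lemma exists_numberField_isSplittingField (f : ℚ[X]) :
    ∃ (M : Type) (_ : Field M) (_ : NumberField M), IsSplittingField ℚ M f := by
  have key : ∀ (L : Type) [Field L] [CharZero L] [A : Algebra ℚ L] [IsSplittingField ℚ L f],
      ∃ _ : NumberField L, IsSplittingField ℚ L f := by
    intro L _ _ A h
    obtain rfl : A = DivisionRing.toRatAlgebra := Subsingleton.elim _ _
    have := IsSplittingField.finiteDimensional L f
    exact ⟨⟨⟩, h⟩
  exact ⟨f.SplittingField, inferInstance,
    @key f.SplittingField _ _ _ (IsSplittingField.splittingField f)⟩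

lemma exists_numberField_isSplittingField_over {M : Type} [Field M] [NumberField M] (f : M[X]) :
    ∃ (N : Type) (_ : Field N) (_ : NumberField N) (_ : Algebra M N), IsSplittingField M N f := by
  have : CharZero f.SplittingField := charZero_of_injective_algebraMap
    (algebraMap M f.SplittingField).injective
  have hfd : FiniteDimensional ℚ f.SplittingField := by
    have e : IsScalarTower ℚ M f.SplittingField := inferInstance
    exact Module.Finite.trans M _
  exact ⟨f.SplittingField, inferInstance, ⟨⟩, inferInstance, inferInstance⟩

lemma error_terms_le {m n q : ℕ} (hm : 5 ≤ m) (hn : n ≤ m ^ m) (hq : q ≤ m)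
    (hzeta : 8 * zetaThreeHalves ≤ 2 ^ m ^ m) :
    mertensError (2 ^ m ^ m) n +
      5 / 4 * (n * Real.log (2 * ((2 ^ m ^ m : ℕ) : ℝ) ^ 2 * (60 * (n * q : ℕ) + 2)))
        + n * ((m ^ 2 + 2 : ℕ) * (2 * m : ℕ)) ≤ 2 ^ (12 * (m ^ m) ^ 2) := by
  have hH5 : m ^ 5 ≤ m ^ m := Nat.pow_le_pow_right (by omega) hm
  have hpoly : (m ^ 2 + 2) * (2 * m) ≤ m ^ m := by
    refine le_trans ?_ hH5
    calc (m ^ 2 + 2) * (2 * m) ≤ (m ^ 2 + m ^ 2) * (2 * m) := by gcongr; nlinarith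
      _ = 4 * m ^ 3 := by ring
      _ ≤ m ^ 2 * m ^ 3 := by gcongr; nlinarith
      _ = m ^ 5 := by ring
  have hH : 3125 ≤ m ^ m := le_trans (by simpa using Nat.pow_le_pow_left hm 5) hH5
  have hmH : m ≤ m ^ m := Nat.le_self_pow (by omega) m
  set H := m ^ m with hHdef
  have hH2 : H < 2 ^ H := Nat.lt_two_pow_self
  have hn2 : n ≤ 2 ^ H := hn.trans hH2.le
  have hrf : radiusFactor (2 ^ H) n ≤ 2 ^ (7 * H) := by
    calc radiusFactor (2 ^ H) n = 2 * (2 ^ H) ^ 2 * (60 * n + 1) * (4 ^ n * n * 20) := rfl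
      _ ≤ 2 * (2 ^ H) ^ 2 * (64 * 2 ^ H) * (4 ^ H * 2 ^ H * 32) := by
          gcongr
          · have := Nat.one_le_two_pow (n := H); omega
          · norm_num
          · norm_num
      _ = 2 ^ (12 + 6 * H) := by
          rw [show (4 : ℕ) ^ H = 2 ^ (2 * H) by rw [pow_mul]; norm_num]
          ring
      _ ≤ 2 ^ (7 * H) := Nat.pow_le_pow_right (by norm_num) (by omega)
  have hHH : H ≤ H ^ 2 := by nlinarith
  have hme : mertensError (2 ^ H) n ≤ 2 ^ (11 * H ^ 2) := by
    have h1 : (2 * (1 + 2 * ((2 ^ H : ℕ) : ℝ) ^ 2)) ^ n ≤ 2 ^ (3 * H * H) := by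
      have hb : 2 * (1 + 2 * ((2 ^ H : ℕ) : ℝ) ^ 2) ≤ 2 ^ (3 * H) := by
        have h2 : 2 * (1 + 2 * (2 ^ H) ^ 2) ≤ 2 ^ (3 * H) := by
          calc 2 * (1 + 2 * (2 ^ H) ^ 2) ≤ 2 * (2 * (2 ^ H) ^ 2 + 2 * (2 ^ H) ^ 2) := by
                gcongr
                have := Nat.one_le_two_pow (n := H)
                nlinarith
            _ = 2 ^ (3 + 2 * H) := by ring
            _ ≤ 2 ^ (3 * H) := Nat.pow_le_pow_right (by norm_num) (by omega)
        exact_mod_cast h2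
      calc (2 * (1 + 2 * ((2 ^ H : ℕ) : ℝ) ^ 2)) ^ n ≤ (2 ^ (3 * H)) ^ n := by gcongr
        _ ≤ (2 ^ (3 * H)) ^ H := pow_le_pow_right₀ (one_le_pow₀ (by norm_num)) hn
        _ = 2 ^ (3 * H * H) := (pow_mul _ _ _).symm
    have h3 : ((radiusFactor (2 ^ H) n : ℕ) : ℝ) ^ n ≤ 2 ^ (7 * H * H) := by
      have h4 : radiusFactor (2 ^ H) n ^ n ≤ 2 ^ (7 * H * H) := by
        rw [pow_mul 2 (7 * H)]
        exact (Nat.pow_le_pow_left hrf n).trans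
          (Nat.pow_le_pow_right (Nat.pos_of_ne_zero (by positivity)) hn)
      exact_mod_cast h4
    have h5 : (n : ℝ) * (8 * zetaThreeHalves + 2 * (radiusFactor (2 ^ H) n : ℝ) ^ n)
        ≤ 2 ^ H * (4 * 2 ^ (7 * H * H)) := by
      have h6 : (2 : ℝ) ^ H ≤ 2 ^ (7 * H * H) :=
        pow_le_pow_right₀ (by norm_num) (by nlinarith)
      have h7 : (n : ℝ) ≤ 2 ^ H := by exact_mod_cast hn2
      calc (n : ℝ) * (8 * zetaThreeHalves + 2 * (radiusFactor (2 ^ H) n : ℝ) ^ n)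
          ≤ n * (4 * 2 ^ (7 * H * H)) := by
            refine mul_le_mul_of_nonneg_left ?_ (Nat.cast_nonneg n)
            have : (0 : ℝ) ≤ 2 ^ (7 * H * H) := by positivity
            linarith
        _ ≤ _ := mul_le_mul_of_nonneg_right h7 (by positivity)
    calc mertensError (2 ^ H) n ≤ 2 ^ (3 * H * H) * (2 ^ H * (4 * 2 ^ (7 * H * H))) := by
          rw [mertensError]
          refine (mul_le_mul_of_nonneg_left h5 (by positivity)).trans ?_
          exact mul_le_mul_of_nonneg_right h1 (by positivity)
      _ = 2 ^ (3 * H * H + (H + (2 + 7 * H * H))) := by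
          rw [pow_add, pow_add, pow_add]; norm_num
      _ ≤ 2 ^ (11 * H ^ 2) := pow_le_pow_right₀ (by norm_num) (by nlinarith)
  have hlog : 5 / 4 * (n * Real.log (2 * ((2 ^ H : ℕ) : ℝ) ^ 2 * (60 * (n * q : ℕ) + 2)))
      ≤ 2 ^ (11 * H ^ 2) := by
    have h1 : 2 * (2 ^ H) ^ 2 * (60 * (n * q) + 2) ≤ 2 ^ (7 + 4 * H) := by
      calc 2 * (2 ^ H) ^ 2 * (60 * (n * q) + 2)
          ≤ 2 * (2 ^ H) ^ 2 * (60 * (2 ^ H * 2 ^ H) + 4 * (2 ^ H * 2 ^ H)) := by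
            have := Nat.one_le_two_pow (n := H)
            gcongr
            · exact (hq.trans hmH).trans hH2.le
            · nlinarith
        _ = 2 ^ (7 + 4 * H) := by ring
    have h2 : Real.log (2 * ((2 ^ H : ℕ) : ℝ) ^ 2 * (60 * (n * q : ℕ) + 2)) ≤ 2 ^ (7 + 4 * H) := by
      refine (Real.log_le_self (by positivity)).trans ?_
      exact_mod_cast h1
    have h7 : (n : ℝ) ≤ 2 ^ H := by exact_mod_cast hn2
    calc 5 / 4 * (n * Real.log (2 * ((2 ^ H : ℕ) : ℝ) ^ 2 * (60 * (n * q : ℕ) + 2)))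
        ≤ 2 * (2 ^ H * 2 ^ (7 + 4 * H)) := by
          have : n * Real.log (2 * ((2 ^ H : ℕ) : ℝ) ^ 2 * (60 * (n * q : ℕ) + 2))
              ≤ 2 ^ H * 2 ^ (7 + 4 * H) :=
            (mul_le_mul_of_nonneg_left h2 (Nat.cast_nonneg n)).trans
              (mul_le_mul_of_nonneg_right h7 (by positivity))
          have : (0 : ℝ) ≤ 2 ^ H * 2 ^ (7 + 4 * H) := by positivity
          linarith
      _ = 2 ^ (1 + (H + (7 + 4 * H))) := by rw [pow_add 2 1, pow_add 2 H, pow_one]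
      _ ≤ 2 ^ (11 * H ^ 2) := pow_le_pow_right₀ (by norm_num) (by nlinarith)
  have hL : (n : ℝ) * ((m ^ 2 + 2 : ℕ) * (2 * m : ℕ)) ≤ 2 ^ (11 * H ^ 2) := by
    have h1 : n * ((m ^ 2 + 2) * (2 * m)) ≤ 2 ^ (11 * H ^ 2) := by
      calc n * ((m ^ 2 + 2) * (2 * m)) ≤ 2 ^ H * 2 ^ H :=
            Nat.mul_le_mul hn2 (hpoly.trans hH2.le)
        _ = 2 ^ (H + H) := (pow_add _ _ _).symm
        _ ≤ 2 ^ (11 * H ^ 2) := Nat.pow_le_pow_right (by norm_num) (by nlinarith)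
    exact_mod_cast h1
  calc _ ≤ (2 : ℝ) ^ (11 * H ^ 2) + 2 ^ (11 * H ^ 2) + 2 ^ (11 * H ^ 2) :=
        add_le_add (add_le_add hme hlog) hL
    _ ≤ 2 ^ (2 + 11 * H ^ 2) := by
        rw [pow_add]
        have : (0 : ℝ) ≤ 2 ^ (11 * H ^ 2) := by positivity
        linarith
    _ ≤ 2 ^ (12 * H ^ 2) := pow_le_pow_right₀ (by norm_num) (by nlinarith)

end Parameters

section Existence

lemma norm_le_of_pow_eq_intCast {q : ℕ} (hq : q ≠ 0) {b : ℤ} {B : ℝ} (hB : 1 ≤ B)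
    (hb : |(b : ℝ)| ≤ B) {z : ℂ} (hz : aeval z (X ^ q - C b : ℤ[X]) = 0) : ‖z‖ ≤ B := by
  by_contra! h
  have h1 : z ^ q = b := by
    rw [map_sub, map_pow, aeval_X, aeval_C, sub_eq_zero] at hz
    simpa using hz
  have h2 : ‖z‖ ^ q = |(b : ℝ)| := by rw [← norm_pow, h1, Complex.norm_intCast]
  have h3 : ‖z‖ ≤ ‖z‖ ^ q := le_self_pow₀ (by linarith) hq
  linarith

lemma house_le_of_aeval_eq_zero {K : Type*} [Field K] [NumberField K] {F : ℤ[X]} {B : ℝ}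
    (hB : 0 ≤ B) (hF : ∀ z : ℂ, aeval z F = 0 → ‖z‖ ≤ B) {x : 𝓞 K} (hx : aeval x F = 0) :
    house (x : K) ≤ B := by
  refine house_le_of_forall_embedding hB fun φ => hF _ ?_
  have h1 := aeval_algHom_apply (φ.comp (algebraMap (𝓞 K) K)).toIntAlgHom x F
  rw [hx, map_zero] at h1
  exact h1

/-- A nonzero integer divisible by all differences of a set of integers of small house, with
controlled norm. -/
lemma exists_dvd_sub {M : Type*} [Field M] [NumberField M] {S : Finset (𝓞 M)} {B : ℝ} {m : ℕ}
    (hB : 1 ≤ B) (hS : ∀ x ∈ S, house (x : M) ≤ B) (hcard : S.card ≤ m) :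
    ∃ δ : 𝓞 M, δ ≠ 0 ∧ house (δ : M) ≤ (2 * B) ^ m ^ 2 ∧ ∀ x ∈ S, ∀ y ∈ S, x ≠ y → x - y ∣ δ := by
  classical
  refine ⟨∏ x ∈ S.offDiag, (x.1 - x.2), ?_, ?_, ?_⟩
  · rw [Finset.prod_ne_zero_iff]
    intro x hx
    exact sub_ne_zero.2 (Finset.mem_offDiag.1 hx).2.2
  · have h1 := house_prod_le' S.offDiag (fun x => ((x.1 - x.2 : 𝓞 M) : M))
    rw [show ((∏ x ∈ S.offDiag, (x.1 - x.2) : 𝓞 M) : M)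
      = ∏ x ∈ S.offDiag, ((x.1 - x.2 : 𝓞 M) : M) from map_prod (algebraMap (𝓞 M) M) _ _]
    refine h1.trans ?_
    calc ∏ x ∈ S.offDiag, house ((x.1 - x.2 : 𝓞 M) : M) ≤ ∏ x ∈ S.offDiag, (2 * B) := by
          refine Finset.prod_le_prod (fun _ _ => house_nonneg _) fun x hx => ?_
          obtain ⟨h1, h2, -⟩ := Finset.mem_offDiag.1 hx
          rw [show ((x.1 - x.2 : 𝓞 M) : M) = (x.1 : M) - (x.2 : M) from rfl]
          refine (house_sub_le _ _).trans ?_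
          linarith [hS _ h1, hS _ h2]
      _ = (2 * B) ^ S.offDiag.card := by rw [Finset.prod_const]
      _ ≤ (2 * B) ^ m ^ 2 := by
          refine pow_le_pow_right₀ (by linarith) ?_
          rw [Finset.offDiag_card, pow_two]
          exact (Nat.sub_le _ _).trans (Nat.mul_le_mul hcard hcard)
  · intro x hx y hy hxy
    exact Finset.dvd_prod_of_mem (fun x : 𝓞 M × 𝓞 M => x.1 - x.2)
      (Finset.mem_offDiag.2 ⟨hx, hy, hxy⟩ : (x, y) ∈ S.offDiag)

lemma exists_isPrimitiveRoot {M : Type*} [Field M] [NumberField M] {q : ℕ} (hq : q ≠ 0)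
    (hspl : (X ^ q - 1 : M[X]).Splits) : ∃ ζ : 𝓞 M, IsPrimitiveRoot ζ q := by
  have : NeZero q := ⟨hq⟩
  have hne : (X ^ q - 1 : M[X]) ≠ 0 := by
    rw [← C_1]; exact (monic_X_pow_sub_C (1 : M) hq).ne_zero
  have h1 : (cyclotomic q M).Splits := hspl.of_dvd hne (cyclotomic.dvd_X_pow_sub_one q M)
  obtain ⟨z, hz⟩ := h1.exists_eval_eq_zero (degree_cyclotomic_pos q M (Nat.pos_of_ne_zero hq)).ne'
  have hz' : IsPrimitiveRoot z q := isRoot_cyclotomic_iff.1 hz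
  exact ⟨hz'.toInteger, hz'.toInteger_isPrimitiveRoot⟩

theorem exists_prime_of_parameters {d : ℕ} (hd : 2 ≤ d) {a : ℤ} {l q t : ℕ} (hl : l.Prime)
    (hq : q.Prime) (hla : (l : ℤ) ∣ a) (hla2 : ¬ (l : ℤ) ^ 2 ∣ a) (hqd : q ∣ d)
    (hld : ¬ l ∣ d) (hlt : ¬ l ∣ t) (hk : |(a : ℝ)| + 2 ≤ (l * t : ℕ))
    {m : ℕ} (hm : m = d * (l * t) + 2 * q) (hzeta : 8 * zetaThreeHalves ≤ 2 ^ m ^ m) :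
    ∃ p : ℕ, p.Prime ∧ (∀ r : ℤ, ¬ (p : ℤ) ∣ (X ^ d - C a : ℤ[X]).eval r) ∧
      Gval (X ^ d - C a) p + l * t ≤ p ∧ Real.log p ≤ 2 ^ (13 * (m ^ m) ^ 2) := by
  have : Fact l.Prime := ⟨hl⟩
  have hq0 : q ≠ 0 := hq.ne_zero
  have hd0 : d ≠ 0 := by omega
  have hk2 : 2 ≤ l * t := by
    have : (2 : ℝ) ≤ (l * t : ℕ) := by linarith [abs_nonneg (a : ℝ)]
    exact_mod_cast this
  have hk0 : l * t ≠ 0 := by omega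
  have hm5 : 5 ≤ m := by nlinarith [hq.two_le]
  have hkm : 2 * (l * t) ≤ m := by nlinarith
  have ha0 : a ≠ 0 := by rintro rfl; exact hla2 (dvd_zero _)
  have ham : |(a : ℝ)| + 2 ≤ m := by
    have : ((l * t : ℕ) : ℝ) ≤ m := by exact_mod_cast (by omega : l * t ≤ m)
    linarith
  have hm1 : (1 : ℝ) ≤ m := by exact_mod_cast (by omega : 1 ≤ m)
  set Q := consecutivePoly d a (l * t) with hQ
  have hQm : Q.Monic := monic_consecutivePoly hd0 hk0
  have hQdeg : Q.natDegree = d * (l * t) := natDegree_consecutivePoly hd0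
  have hgm : (X ^ q - C 1 : ℤ[X]).Monic := monic_X_pow_sub_C 1 hq0
  have ham' : (X ^ q - C a : ℤ[X]).Monic := monic_X_pow_sub_C a hq0
  have hQsep : (Q.map (Int.castRingHom (ZMod l))).Separable := separable_consecutivePoly hla
    (fun h => (hl.dvd_mul.1 h).elim hld hlt)
  have hgsep : ((X ^ q - C 1 : ℤ[X]).map (Int.castRingHom (ZMod l))).Separable := by
    have h1 : (X ^ q - C 1 : ℤ[X]).map (Int.castRingHom (ZMod l)) = X ^ q - 1 := by simp
    rw [h1, X_pow_sub_one_separable_iff, Ne, ZMod.natCast_eq_zero_iff]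
    intro h
    rw [Nat.prime_dvd_prime_iff_eq hl hq] at h
    exact hld (h ▸ hqd)
  -- bounds for the complex roots
  have hQroot : ∀ z : ℂ, aeval z Q = 0 → ‖z‖ ≤ m := fun z hz => by
    have h1 := norm_le_of_aeval_consecutivePoly hd0 hk0 hz
    have h2 : ((2 * (l * t) : ℕ) : ℝ) ≤ m := by exact_mod_cast hkm
    push_cast at h1 h2 hk
    linarith
  have hgroot : ∀ z : ℂ, aeval z (X ^ q - C 1 : ℤ[X]) = 0 → ‖z‖ ≤ m := fun z hz =>
    norm_le_of_pow_eq_intCast hq0 hm1 (by simpa using hm1) hz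
  have haroot : ∀ z : ℂ, aeval z (X ^ q - C a : ℤ[X]) = 0 → ‖z‖ ≤ m := fun z hz =>
    norm_le_of_pow_eq_intCast hq0 hm1 (by linarith) hz
  -- the fields
  obtain ⟨M, _, _, hM⟩ := exists_numberField_isSplittingField
    ((Q * (X ^ q - C 1)).map (Int.castRingHom ℚ))
  obtain ⟨N, _, _, _, hN⟩ := exists_numberField_isSplittingField_over
    (X ^ q - C (((a : 𝓞 M) : M)))
  have hN' : IsSplittingField ℚ N ((Q * (X ^ q - C 1) * (X ^ q - C a)).map (Int.castRingHom ℚ)) := by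
    have e : ((X ^ q - C a : ℤ[X]).map (Int.castRingHom ℚ)).map (algebraMap ℚ M)
        = X ^ q - C (((a : 𝓞 M) : M)) := by simp
    have h1 : IsSplittingField M N
        (((X ^ q - C a : ℤ[X]).map (Int.castRingHom ℚ)).map (algebraMap ℚ M)) := by
      rw [e]; exact hN
    rw [Polynomial.map_mul]
    exact IsSplittingField.mul (K := M) N _ _ ((hQm.mul hgm).map _).ne_zero
      (ham'.map _).ne_zero
  have hMb := latticeBound_of_isSplittingField (K := M) (hQm.mul hgm) hm5 (by
    rw [hQm.natDegree_mul hgm, hQdeg, natDegree_X_pow_sub_C]; omega) (fun z hz => by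
    rw [map_mul, mul_eq_zero] at hz
    exact hz.elim (hQroot z) (hgroot z))
  have hNb := latticeBound_of_isSplittingField (K := N) ((hQm.mul hgm).mul ham') hm5 (by
    rw [(hQm.mul hgm).natDegree_mul ham', hQm.natDegree_mul hgm, hQdeg, natDegree_X_pow_sub_C,
      natDegree_X_pow_sub_C]; omega) (fun z hz => by
    rw [map_mul, map_mul, mul_eq_zero, mul_eq_zero] at hz
    exact hz.elim (fun h => h.elim (hQroot z) (hgroot z)) (haroot z))
  obtain ⟨hn, hMb⟩ := hMb
  obtain ⟨-, hNb⟩ := hNb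
  set n := Module.finrank ℚ M with hndef
  have hn1 : 1 ≤ n := Module.finrank_pos
  have hspl := IsSplittingField.splits M ((Q * (X ^ q - C 1)).map (Int.castRingHom ℚ))
  rw [Polynomial.map_mul, Polynomial.map_mul] at hspl
  have hne1 : (Q.map (Int.castRingHom ℚ)).map (algebraMap ℚ M) ≠ 0 := ((hQm.map _).map _).ne_zero
  have hne2 : ((X ^ q - C 1 : ℤ[X]).map (Int.castRingHom ℚ)).map (algebraMap ℚ M) ≠ 0 :=
    ((hgm.map _).map _).ne_zero
  obtain ⟨ζ, hζ⟩ := exists_isPrimitiveRoot (M := M) hq0 (by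
    have := hspl.of_dvd (mul_ne_zero hne1 hne2) (dvd_mul_left _ _)
    simpa using this)
  obtain ⟨S, hScard, hSroot⟩ := exists_roots_of_separable (M := M) hQm hl hQsep
    (hspl.of_dvd (mul_ne_zero hne1 hne2) (dvd_mul_right _ _))
  obtain ⟨δ, hδ0, hδhouse, hδ⟩ := exists_dvd_sub (S := S) hm1
    (fun x hx => house_le_of_aeval_eq_zero (by linarith) hQroot (hSroot x hx))
    (m := m) (by rw [hScard, hQdeg]; omega)
  have hζ1 : ζ - 1 ≠ 0 := sub_ne_zero.2 (hζ.ne_one hq.one_lt)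
  set β : 𝓞 M := (ζ - 1) * (a : 𝓞 M) * δ with hβ
  have hβ0 : β ≠ 0 := mul_ne_zero (mul_ne_zero hζ1 (by exact_mod_cast ha0)) hδ0
  have hβhouse : house (β : M) ≤ (2 * m) ^ (m ^ 2 + 2) := by
    have h1 : house ((ζ - 1 : 𝓞 M) : M) ≤ 2 * m := by
      rw [show ((ζ - 1 : 𝓞 M) : M) = (ζ : M) - 1 from rfl]
      refine (house_sub_le _ _).trans ?_
      have h2 : house (ζ : M) ≤ m := house_le_of_aeval_eq_zero (by linarith) hgroot (by
        simp [hζ.pow_eq_one])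
      have h3 : house (1 : M) = 1 := by simpa using house_intCast (K := M) 1
      linarith
    have h2 : house ((a : 𝓞 M) : M) ≤ 2 * m := by
      have := house_intCast (K := M) a
      rw [show ((a : 𝓞 M) : M) = (a : M) from map_intCast (algebraMap (𝓞 M) M) a, this]
      push_cast
      linarith
    rw [hβ, show (((ζ - 1) * (a : 𝓞 M) * δ : 𝓞 M) : M)
      = ((ζ - 1 : 𝓞 M) : M) * ((a : 𝓞 M) : M) * (δ : M) from rfl]
    calc house (((ζ - 1 : 𝓞 M) : M) * ((a : 𝓞 M) : M) * (δ : M))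
        ≤ house ((ζ - 1 : 𝓞 M) : M) * house ((a : 𝓞 M) : M) * house (δ : M) :=
          (house_mul_le _ _).trans
            (mul_le_mul_of_nonneg_right (house_mul_le _ _) (house_nonneg _))
      _ ≤ 2 * m * (2 * m) * (2 * m) ^ m ^ 2 := by
          have := house_nonneg ((a : 𝓞 M) : M)
          have := house_nonneg (δ : M)
          gcongr
      _ = (2 * m) ^ (m ^ 2 + 2) := by ring
  have hβlog : Real.log (Ideal.absNorm (Ideal.span {β}))
      ≤ n * ((m ^ 2 + 2 : ℕ) * (2 * m : ℕ)) := by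
    have h1 := absNorm_span_le hβhouse
    have h2 : (0 : ℝ) < Ideal.absNorm (Ideal.span {β}) := by
      exact_mod_cast absNorm_span_pos hβ0
    refine (Real.log_le_log h2 h1).trans ?_
    rw [Real.log_pow, Real.log_pow]
    refine mul_le_mul_of_nonneg_left ?_ (Nat.cast_nonneg _)
    push_cast
    refine mul_le_mul_of_nonneg_left (Real.log_le_self (by positivity)) (by positivity)
  have hlog3 : 1 ≤ Real.log 3 := by
    rw [Real.le_log_iff_exp_le (by norm_num)]
    exact Real.exp_one_lt_three.le
  have hlog3' : Real.log 3 ≤ 2 := by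
    have := Real.log_le_sub_one_of_pos (show (0 : ℝ) < 3 by norm_num)
    linarith
  set Λ : ℕ := 2 ^ (12 * (m ^ m) ^ 2) with hΛ
  have hΛ1 : (1 : ℝ) ≤ Λ := by exact_mod_cast Nat.one_le_two_pow
  have herr := error_terms_le hm5 hn (by omega : q ≤ m) hzeta
  have hnR : (1 : ℝ) ≤ n := by exact_mod_cast hn1
  have hlogw : Real.log ((3 ^ (3 * Λ) : ℕ) : ℝ) = 3 * Λ * Real.log 3 := by
    push_cast
    rw [Real.log_pow]
    push_cast
    ring
  have hww : mertensError (2 ^ m ^ m) n +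
      5 / 4 * (n * Real.log (2 * ((2 ^ m ^ m : ℕ) : ℝ) ^ 2 * (60 * (n * q : ℕ) + 2)))
        + Real.log (Ideal.absNorm (Ideal.span {β}))
      < 9 / 20 * (n * Real.log ((3 ^ (3 * Λ) : ℕ) : ℝ)) := by
    rw [hlogw]
    have h1 : (Λ : ℝ) ≤ n * (Λ * Real.log 3) := by
      nlinarith [mul_le_mul_of_nonneg_left hlog3 (by linarith : (0 : ℝ) ≤ Λ)]
    have h2 : ((2 : ℝ) ^ (12 * (m ^ m) ^ 2)) = Λ := by rw [hΛ]; push_cast; rfl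
    rw [h2] at herr
    linarith
  obtain ⟨P, hP, hPle, hβP, hPpow⟩ := exists_prime_not_pow hq hζ
    (pow_ne_of_separable hQm hgm hl hQsep hgsep hq.two_le hla hla2) hMb hNb hβ0
    (Dvd.intro _ rfl) (Nat.one_le_pow _ _ (by norm_num)) hww
  refine ⟨Ideal.absNorm P, hP, ?_, ?_, ?_⟩
  · intro r hr
    obtain ⟨d', rfl⟩ := hqd
    refine hPpow ((r : 𝓞 M) ^ d') ?_
    obtain ⟨s, hs⟩ := hr
    simp only [eval_sub, eval_pow, eval_X, eval_C] at hs
    have h1 : ((r : 𝓞 M) ^ d') ^ q - (a : 𝓞 M) = (Ideal.absNorm P : 𝓞 M) * (s : 𝓞 M) := by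
      have := congrArg (fun z : ℤ => (z : 𝓞 M)) hs
      push_cast at this
      rw [← pow_mul, mul_comm d' q]
      exact this
    rw [h1]
    exact P.mul_mem_right _ (Ideal.absNorm_mem P)
  · refine Gval_add_le_of_roots hd (by omega) hP (hScard.trans hQdeg) hSroot ?_
    intro x hx y hy hxy hmem
    refine hβP ?_
    obtain ⟨z, hz⟩ := hδ x hx y hy hxy
    rw [hβ, hz]
    exact P.mul_mem_left _ (P.mul_mem_right _ hmem)
  · have h1 : Real.log (Ideal.absNorm P) ≤ (q * n : ℕ) * (3 * Λ * Real.log 3) := by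
      rw [← hlogw, ← Real.log_pow]
      refine Real.log_le_log (by exact_mod_cast hP.pos) ?_
      exact_mod_cast hPle
    have hmH : m ≤ m ^ m := Nat.le_self_pow (by omega) m
    set H := m ^ m with hH
    have hH2 : H < 2 ^ H := Nat.lt_two_pow_self
    have h2 : q * n * (6 * Λ) ≤ 2 ^ (13 * H ^ 2) := by
      calc q * n * (6 * Λ) ≤ 2 ^ H * 2 ^ H * (8 * 2 ^ (12 * H ^ 2)) := by
            gcongr
            · omega
            · omega
            · norm_num
        _ = 2 ^ (H + H + (3 + 12 * H ^ 2)) := by rw [pow_add, pow_add, pow_add 2 3]; norm_num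
        _ ≤ 2 ^ (13 * H ^ 2) := Nat.pow_le_pow_right (by norm_num) (by nlinarith)
    calc Real.log (Ideal.absNorm P) ≤ (q * n : ℕ) * (3 * Λ * Real.log 3) := h1
      _ ≤ (q * n : ℕ) * (3 * Λ * 2) := by gcongr
      _ = ((q * n * (6 * Λ) : ℕ) : ℝ) := by push_cast; ring
      _ ≤ 2 ^ (13 * H ^ 2) := by exact_mod_cast h2

end Existence

section Growth

lemma logLogLog_div_le {d k m p : ℕ} (hd : 1 ≤ d) (hdk : 3 * d ≤ k) (hm : m ≤ 3 * d * k)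
    (hm5 : 5 ≤ m) (hk : Real.exp (Real.exp (Real.exp (Real.exp 1))) ≤ k) (hkp : k ≤ p)
    (hp : Real.log p ≤ 2 ^ (13 * (m ^ m) ^ 2)) :
    1 / (18 * d) * Real.log (Real.log (Real.log p)) /
      Real.log (Real.log (Real.log (Real.log p))) ≤ k := by
  have hkp' : (k : ℝ) ≤ p := by exact_mod_cast hkp
  have hdR : (1 : ℝ) ≤ d := by exact_mod_cast hd
  have hdk' : (3 : ℝ) * d ≤ k := by exact_mod_cast hdk
  have hm' : (m : ℝ) ≤ 3 * d * k := by exact_mod_cast hm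
  have hm5' : (5 : ℝ) ≤ m := by exact_mod_cast hm5
  have hp0 := hk.trans hkp'
  have hpe := (Real.exp_pos _).trans_le hp0
  have hp1 : Real.exp (Real.exp (Real.exp 1)) ≤ Real.log p := (Real.le_log_iff_exp_le hpe).2 hp0
  have hpe1 := (Real.exp_pos _).trans_le hp1
  have hp2 : Real.exp (Real.exp 1) ≤ Real.log (Real.log p) :=
    (Real.le_log_iff_exp_le hpe1).2 hp1
  have hpe2 := (Real.exp_pos _).trans_le hp2
  set u := Real.log (Real.log (Real.log p)) with hu
  have hp3 : Real.exp 1 ≤ u := (Real.le_log_iff_exp_le hpe2).2 hp2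
  have hpe3 := (Real.exp_pos _).trans_le hp3
  have hk3 : Real.exp 1 ≤ (k : ℝ) := by
    refine le_trans ?_ hk
    have h : ∀ x : ℝ, x ≤ Real.exp x := fun x => by linarith [Real.add_one_le_exp x]
    exact (h _).trans ((h _).trans (h _))
  have hk0 : (0 : ℝ) < k := (Real.exp_pos _).trans_le hk3
  have hlogk : 1 ≤ Real.log k := (Real.le_log_iff_exp_le hk0).2 hk3
  have hH : (13 : ℝ) ≤ (m : ℝ) ^ m := by
    calc (13 : ℝ) ≤ 5 ^ 2 := by norm_num
      _ ≤ (m : ℝ) ^ 2 := by gcongr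
      _ ≤ (m : ℝ) ^ m := pow_le_pow_right₀ (by linarith) (by omega)
  have h2 : Real.log (Real.log p) ≤ ((m : ℝ) ^ m) ^ 3 := by
    have h := Real.log_le_log hpe1 hp
    rw [Real.log_pow] at h
    have hl2 : Real.log 2 ≤ 1 := by
      have := Real.log_le_sub_one_of_pos (show (0 : ℝ) < 2 by norm_num)
      linarith
    push_cast at h
    have h3 : 13 * ((m : ℝ) ^ m) ^ 2 * Real.log 2 ≤ 13 * ((m : ℝ) ^ m) ^ 2 * 1 :=
      mul_le_mul_of_nonneg_left hl2 (by positivity)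
    nlinarith [mul_le_mul_of_nonneg_right hH (sq_nonneg ((m : ℝ) ^ m))]
  have h3 : u ≤ 18 * d * k * Real.log k := by
    have h := Real.log_le_log hpe2 h2
    rw [Real.log_pow, Real.log_pow] at h
    have hlm : Real.log m ≤ 2 * Real.log k := by
      calc Real.log m ≤ Real.log ((k : ℝ) * k) :=
            Real.log_le_log (by linarith) (hm'.trans (by gcongr))
        _ = 2 * Real.log k := by rw [Real.log_mul hk0.ne' hk0.ne']; ring
    calc u ≤ (3 : ℕ) * (m * Real.log m) := h
      _ ≤ 3 * (3 * d * k * (2 * Real.log k)) := by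
          push_cast
          have : 0 ≤ Real.log (m : ℝ) := Real.log_nonneg (by linarith)
          gcongr
      _ = 18 * d * k * Real.log k := by ring
  set U := 18 * d * k * Real.log k with hU
  have hkU : (k : ℝ) ≤ U := by
    have h1 : (1 : ℝ) ≤ 18 * d * Real.log k := by nlinarith
    calc (k : ℝ) = 1 * k := (one_mul _).symm
      _ ≤ 18 * d * Real.log k * k := by gcongr
      _ = U := by rw [hU]; ring
  have hlogu : 1 ≤ Real.log u := (Real.le_log_iff_exp_le hpe3).2 hp3
  have hlogU : Real.log k ≤ Real.log U := Real.log_le_log hk0 hkU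
  have h4 : Real.log U / U ≤ Real.log u / u :=
    Real.log_div_self_antitoneOn hp3 (hp3.trans h3) h3
  have hU0 : 0 < U := hk0.trans_le hkU
  rw [div_le_div_iff₀ hU0 hpe3] at h4
  have h5 : Real.log k * u ≤ Real.log u * (18 * d * k * Real.log k) :=
    (mul_le_mul_of_nonneg_right hlogU hpe3.le).trans h4
  have h6 : u ≤ Real.log u * (18 * d * k) := by
    refine le_of_mul_le_mul_right ?_ (by linarith : 0 < Real.log k)
    linarith
  rw [div_le_iff₀ (by linarith), one_div, inv_mul_le_iff₀ (by positivity)]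
  linarith

lemma exists_prime_dvd_of_squarefree {a : ℤ} (hsf : Squarefree a) (ha1 : a ≠ 1) (ham : a ≠ -1) :
    ∃ l : ℕ, l.Prime ∧ (l : ℤ) ∣ a ∧ ¬ (l : ℤ) ^ 2 ∣ a := by
  obtain ⟨l, hl, hla⟩ := Nat.exists_prime_and_dvd (n := a.natAbs) (by omega)
  refine ⟨l, hl, Int.natCast_dvd.2 hla, fun h => ?_⟩
  have h1 := hsf l (by rwa [← pow_two])
  exact (Nat.prime_iff_prime_int.1 hl).not_isUnit h1

end Growth
end MissingValues

/-- **Corollary (infinitely many primes with many missing values, binomial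
case).** Let `P(x) = x^d − a` with `d ≥ 2`, `gcd(d, a) = 1`, `a` squarefree and
`a ≠ ±1`. Then for some `c > 0` (depending only on `d` and `a`) there are
infinitely many primes `p` such that `P` has no root modulo `p` and
`p − G_P(p) ≥ c · logloglog p / loglogloglog p`. -/
theorem stmt7 (d : ℕ) (hd : 2 ≤ d) (a : ℤ) (hcop : Int.gcd (d : ℤ) a = 1)
    (hsf : Squarefree a) (ha1 : a ≠ 1) (ham : a ≠ -1) :
    ∃ c : ℝ, 0 < c ∧ ∀ x : ℕ, ∃ p : ℕ, x < p ∧ p.Prime ∧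
      (∀ m : ℤ, ¬ ((p : ℤ) ∣ ((X : Polynomial ℤ) ^ d - C a).eval m)) ∧
      c * Real.log (Real.log (Real.log p)) / Real.log (Real.log (Real.log (Real.log p))) ≤
        (p : ℝ) - (Gval ((X : Polynomial ℤ) ^ d - C a) p : ℝ) := by
  obtain ⟨l, hl, hla, hla2⟩ := MissingValues.exists_prime_dvd_of_squarefree hsf ha1 ham
  have hld : ¬ l ∣ d := fun h => hl.one_lt.ne' (by
    have h1 : (l : ℤ) ∣ Int.gcd (d : ℤ) a := Int.dvd_coe_gcd (by exact_mod_cast h) hla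
    rw [hcop] at h1
    exact Nat.dvd_one.1 (by exact_mod_cast h1))
  refine ⟨1 / (18 * d), by positivity, fun x => ?_⟩
  obtain ⟨s, hs⟩ := exists_nat_ge (max (max (x : ℝ) (|(a : ℝ)| + 2))
    (max (Real.exp (Real.exp (Real.exp (Real.exp 1)))) (max (3 * d : ℝ) (8 * MissingValues.zetaThreeHalves))))
  simp only [max_le_iff] at hs
  obtain ⟨⟨hsx, hsa⟩, hse, hsd, hsz⟩ := hs
  set t := l * s + 1 with ht
  have hlt : ¬ l ∣ t := fun h => hl.one_lt.ne' (Nat.dvd_one.1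
    ((Nat.dvd_add_right (dvd_mul_right l s)).1 h))
  have hsk : s < l * t := by nlinarith [hl.two_le, Nat.zero_le (l * s)]
  have hskR : (s : ℝ) ≤ (l * t : ℕ) := by exact_mod_cast hsk.le
  have hq := Nat.minFac_prime (show d ≠ 1 by omega)
  have hqd := Nat.minFac_dvd d
  have hqle := Nat.le_of_dvd (by omega) hqd
  set q := d.minFac
  have hk3 : 3 * d ≤ l * t := by exact_mod_cast hsd.trans hskR
  set k := l * t with hk
  obtain ⟨m, hm⟩ : ∃ m, m = d * k + 2 * q := ⟨_, rfl⟩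
  have hkm : k ≤ m := by nlinarith
  have hmH : m ≤ m ^ m := Nat.le_self_pow (by omega) m
  have hzeta : 8 * MissingValues.zetaThreeHalves ≤ 2 ^ m ^ m := by
    have h1 : s ≤ 2 ^ m ^ m := (hsk.le.trans (hkm.trans hmH)).trans Nat.lt_two_pow_self.le
    exact hsz.trans (by exact_mod_cast h1)
  obtain ⟨p, hp, hroot, hG, hlog⟩ := MissingValues.exists_prime_of_parameters hd hl hq hla hla2 hqd hld hlt
    (hsa.trans hskR) hm hzeta
  rw [← hk] at hG
  refine ⟨p, ?_, hp, hroot, ?_⟩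
  · have : x ≤ s := by exact_mod_cast hsx
    omega
  · have h1 := MissingValues.logLogLog_div_le (by omega) hk3 (by nlinarith : m ≤ 3 * d * k) (by nlinarith)
      (hse.trans hskR) (by omega) hlog
    have h2 : (Gval (X ^ d - C a) p : ℝ) + k ≤ p := by exact_mod_cast hG
    linarith
end

section
/- Let P(x) ∈ ℤ[x] be an irreducible polynomial of degree D ≥ 2, and for an integer h ≥ 1 define F_h(x) = ∏_{n=1}^{h} P(x+n) ∈ ℤ[x]. Then there is a constant C, depending only on P, such that for every H ≥ 3 the number of primes p for which F_h is congruent modulo p to the square of a polynomial for some 0 < h ≤ H is at most C · H·log H / log log H. -/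
open Polynomial Finset

/-- The product of a finite set of positive integers is at least the factorial of its size. -/
lemma Finset.factorial_card_le_prod_id (s : Finset ℕ) (hs : ∀ n ∈ s, 0 < n) :
    s.card.factorial ≤ ∏ n ∈ s, n := by
  induction s using Finset.induction_on_max with
  | empty => simp
  | insert a s ha ih =>
    have hnot : a ∉ s := fun h => lt_irrefl _ (ha a h)
    have hcard : s.card + 1 ≤ a := by
      have hsub : s ⊆ Finset.Ico 1 a := fun n hn =>
        Finset.mem_Ico.2 ⟨hs n (Finset.mem_insert_of_mem hn), ha n hn⟩
      have := Finset.card_le_card hsub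
      have := hs a (Finset.mem_insert_self _ _)
      rw [Nat.card_Ico] at *
      omega
    rw [Finset.card_insert_of_notMem hnot, Finset.prod_insert hnot, Nat.factorial_succ]
    exact Nat.mul_le_mul hcard (ih fun n hn => hs n (Finset.mem_insert_of_mem hn))

lemma Nat.factorial_card_primeFactors_le {n : ℕ} (hn : n ≠ 0) :
    n.primeFactors.card.factorial ≤ n :=
  (Finset.factorial_card_le_prod_id _ fun _ hp => (Nat.prime_of_mem_primeFactors hp).pos).trans
    (Nat.le_of_dvd (Nat.pos_of_ne_zero hn) (Nat.prod_primeFactors_dvd n))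

lemma Real.mul_log_sub_le_log_factorial (w : ℕ) :
    (w : ℝ) * Real.log w - w ≤ Real.log (w.factorial : ℝ) := by
  rcases Nat.eq_zero_or_pos w with rfl | hw
  · simp
  have hw' : (0 : ℝ) < w := by exact_mod_cast hw
  have h := Real.log_le_log (by positivity) (Real.pow_div_factorial_le_exp _ hw'.le w)
  rw [Real.log_div (by positivity) (by positivity), Real.log_pow, Real.log_exp] at h
  linarith

/-- If `log w! = O(L)`, then `w = O(L / log L)`. -/
lemma Real.exists_le_mul_div_log_of_log_factorial_le (A : ℝ) (hA : 0 ≤ A) :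
    ∃ B : ℝ, 0 ≤ B ∧ ∀ (L : ℝ) (w : ℕ), 1 < L → Real.log (w.factorial : ℝ) ≤ A * L →
      (w : ℝ) ≤ B * (L / Real.log L) := by
  have he : (0 : ℝ) < Real.exp 2 := Real.exp_pos 2
  refine ⟨2 * (2 * A + Real.exp 2) + 2, by positivity, fun L w hL hw => ?_⟩
  have hlog : 0 < Real.log L := Real.log_pos hL
  have hfac := (Real.mul_log_sub_le_log_factorial w).trans hw
  rw [← mul_div_assoc, le_div_iff₀ hlog]
  have hlin : (w : ℝ) ≤ (A + Real.exp 2) * L := by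
    rcases le_total (w : ℝ) (Real.exp 2) with h | h
    · nlinarith [mul_nonneg hA (by linarith : (0 : ℝ) ≤ L)]
    · have h2 : 2 ≤ Real.log w := (Real.le_log_iff_exp_le (he.trans_le h)).2 h
      nlinarith
  have hsqrt : Real.log L = 2 * Real.log (√L) := by
    rw [Real.log_sqrt (by linarith)]; ring
  have hs : 1 < √L := by rwa [Real.lt_sqrt zero_le_one, one_pow]
  have hss : √L * √L = L := Real.mul_self_sqrt (by linarith)
  rcases le_total (w : ℝ) (√L) with h | h
  · have h1 : Real.log (√L) ≤ √L := Real.log_le_self (by positivity)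
    have h0 : 0 ≤ Real.log (√L) := Real.log_nonneg hs.le
    have : (w : ℝ) * Real.log L ≤ 2 * L := by
      rw [hsqrt]
      nlinarith [mul_le_mul h h1 h0 (by positivity)]
    nlinarith [mul_nonneg (by positivity : (0 : ℝ) ≤ 2 * (2 * A + Real.exp 2))
      (by linarith : (0 : ℝ) ≤ L)]
  · have h1 : Real.log (√L) ≤ Real.log w := Real.log_le_log (by positivity) h
    nlinarith [mul_le_mul_of_nonneg_left h1 (Nat.cast_nonneg (α := ℝ) w)]

lemma Polynomial.abs_eval_intCast_le (R : ℤ[X]) :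
    ∃ S : ℝ, 0 < S ∧ ∀ k H : ℕ, k ≤ H → 1 ≤ H →
      |((R.eval (k : ℤ) : ℤ) : ℝ)| ≤ S * (H : ℝ) ^ R.natDegree := by
  refine ⟨∑ i ∈ Finset.range (R.natDegree + 1), |(R.coeff i : ℝ)| + 1, by positivity,
    fun k H hk hH => ?_⟩
  have hH' : (1 : ℝ) ≤ H := by exact_mod_cast hH
  have hk' : (k : ℝ) ≤ H := by exact_mod_cast hk
  rw [eval_eq_sum_range]
  push_cast
  refine (Finset.abs_sum_le_sum_abs _ _).trans ?_
  have : ∑ i ∈ Finset.range (R.natDegree + 1), |(R.coeff i : ℝ) * (k : ℝ) ^ i| ≤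
      (∑ i ∈ Finset.range (R.natDegree + 1), |(R.coeff i : ℝ)|) * (H : ℝ) ^ R.natDegree := by
    rw [Finset.sum_mul]
    refine Finset.sum_le_sum fun i hi => ?_
    rw [abs_mul, abs_of_nonneg (by positivity : (0 : ℝ) ≤ (k : ℝ) ^ i)]
    have hi' : i ≤ R.natDegree := Nat.lt_succ_iff.1 (Finset.mem_range.1 hi)
    gcongr
    exact (pow_le_pow_left₀ (by positivity) hk' i).trans (pow_le_pow_right₀ hH' hi')
  nlinarith [pow_nonneg (by linarith : (0 : ℝ) ≤ H) R.natDegree]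

/-- An irreducible rational polynomial is coprime to its translates. -/
lemma Irreducible.isCoprime_comp_X_add_C {P : ℚ[X]} (hP : Irreducible P) {k : ℚ} (hk : k ≠ 0) :
    IsCoprime P (P.comp (X + C k)) := by
  refine (hP.isCoprime_or_dvd _).resolve_right fun hdvd => ?_
  have hdeg : P.degree ≠ 0 := fun h => hP.not_isUnit (isUnit_iff_degree_eq_zero.2 h)
  obtain ⟨α, hα⟩ := IsAlgClosed.exists_aeval_eq_zero ℂ P hdeg
  have hroot : ∀ n : ℕ, aeval (α + n * (k : ℂ)) P = 0 := by
    intro n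
    induction n with
    | zero => simpa using hα
    | succ n ih =>
      have := aeval_eq_zero_of_dvd_aeval_eq_zero hdvd ih
      rw [aeval_comp] at this
      simpa [add_mul, add_assoc] using this
  have hfin := P.rootSet_finite ℂ
  refine Set.infinite_of_injective_forall_mem (f := fun n : ℕ => α + n * (k : ℂ)) ?_ ?_ hfin
  · intro a b hab
    have : (k : ℂ) ≠ 0 := by exact_mod_cast hk
    simpa [this] using hab
  · intro n
    exact (mem_rootSet_of_ne hP.ne_zero).2 (hroot n)

lemma Polynomial.resultant_ne_zero_of_isCoprime_map {P Q : ℤ[X]}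
    (h : IsCoprime (P.map (Int.castRingHom ℚ)) (Q.map (Int.castRingHom ℚ))) :
    resultant P Q ≠ 0 := by
  have hinj : Function.Injective (Int.castRingHom ℚ) := Int.cast_injective
  have := resultant_ne_zero _ _ h
  rw [natDegree_map_eq_of_injective hinj, natDegree_map_eq_of_injective hinj,
    resultant_map_map] at this
  exact fun h0 => this (by rw [h0, map_zero])

lemma Polynomial.prime_dvd_resultant_of_common_root {p : ℕ} {K : Type*} [Field K] [CharP K p]
    {P Q : ℤ[X]} (hP : P.natDegree ≠ 0) {α : K} (h1 : aeval α P = 0) (h2 : aeval α Q = 0) :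
    (p : ℤ) ∣ resultant P Q := by
  obtain ⟨U, V, -, -, hUV⟩ := exists_mul_add_mul_eq_C_resultant P Q le_rfl le_rfl (Or.inl hP)
  have := congrArg (aeval α) hUV
  rw [map_add, map_mul, map_mul, h1, h2, aeval_C] at this
  rw [← CharP.intCast_eq_zero_iff K p]
  simpa using this.symm

/-- If a product of consecutive translates of `P` is a square modulo `p`, then `p` divides the
leading coefficient of `P`, or the resultant of `P` with its derivative, or the resultant of `P`
with a nontrivial translate. -/
lemma Polynomial.prime_dvd_of_prod_translates_eq_sq {P : ℤ[X]} (hD : P.natDegree ≠ 0) {p h : ℕ}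
    (hp : p.Prime) (hh : 0 < h) {g : (ZMod p)[X]}
    (hg : (∏ n ∈ Finset.Icc 1 h, P.comp (X + C (n : ℤ))).map (Int.castRingHom (ZMod p)) = g ^ 2) :
    (p : ℤ) ∣ P.leadingCoeff ∨ (p : ℤ) ∣ resultant P (derivative P) ∨
      ∃ k : ℕ, 0 < k ∧ k < h ∧ (p : ℤ) ∣ resultant P (P.comp (X + C (k : ℤ))) := by
  have : Fact p.Prime := ⟨hp⟩
  by_contra! hcon
  obtain ⟨hlc, hder, hres⟩ := hcon
  let K := AlgebraicClosure (ZMod p)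
  have : CharP K p := charP_of_injective_algebraMap (algebraMap (ZMod p) K).injective p
  have hlc' : (Int.castRingHom K) P.leadingCoeff ≠ 0 := by
    rwa [eq_intCast, Ne, CharP.intCast_eq_zero_iff K p]
  obtain ⟨α, hα⟩ := IsAlgClosed.exists_root (P.map (Int.castRingHom K)) (by
    rw [degree_map_eq_of_leadingCoeff_ne_zero _ hlc']
    exact fun h0 => hD (natDegree_eq_of_degree_eq_some h0))
  have hα' : aeval α P = 0 := by
    rw [IsRoot, eval_map] at hα
    rw [aeval_def]
    exact hα
  have hdα : aeval α (derivative P) ≠ 0 := fun h0 =>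
    hder (prime_dvd_resultant_of_common_root hD hα' h0)
  set F : ℤ[X] := ∏ n ∈ Finset.Icc 1 h, P.comp (X + C (n : ℤ)) with hF
  set Q : ℤ[X] := ∏ n ∈ Finset.Icc 2 h, P.comp (X + C (n : ℤ)) with hQ
  have hFQ : F = P.comp (X + C 1) * Q := by
    rw [hF, hQ, ← Finset.insert_Icc_succ_left_eq_Icc (by omega : 1 ≤ h),
      Finset.prod_insert (by simp)]
    rfl
  set G : K[X] := g.map (algebraMap (ZMod p) K) with hG
  have hFG : F.map (algebraMap ℤ K) = G ^ 2 := by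
    rw [hG, ← Polynomial.map_pow, ← hg, Polynomial.map_map]
    congr 1
  have hβ : aeval (α - 1) (P.comp (X + C 1)) = 0 := by
    rw [aeval_comp]
    simpa using hα'
  have hGβ : G.eval (α - 1) = 0 := by
    have : aeval (α - 1) F = 0 := by rw [hFQ, map_mul, hβ, zero_mul]
    rw [← eval_map_algebraMap, hFG, eval_pow] at this
    exact pow_eq_zero_iff two_ne_zero |>.1 this
  have hF' : aeval (α - 1) (derivative F) = 0 := by
    rw [← eval_map_algebraMap, ← derivative_map, hFG, derivative_pow]
    simp [hGβ]
  have hQβ : aeval (α - 1) Q = 0 := by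
    rw [hFQ, derivative_mul, map_add, map_mul, map_mul, hβ, zero_mul, add_zero,
      derivative_comp, map_mul, aeval_comp] at hF'
    have h1 : aeval (α - 1) (X + C 1 : ℤ[X]) = α := by simp
    rw [h1] at hF'
    simpa [hdα] using hF'
  rw [hQ, map_prod, Finset.prod_eq_zero_iff] at hQβ
  obtain ⟨n, hn, hn0⟩ := hQβ
  rw [Finset.mem_Icc] at hn
  refine hres (n - 1) (by omega) (by omega) (prime_dvd_resultant_of_common_root hD hα' ?_)
  rw [aeval_comp] at hn0 ⊢
  have h1 : aeval α (X + C ((n - 1 : ℕ) : ℤ) : ℤ[X]) = aeval (α - 1) (X + C (n : ℤ) : ℤ[X]) := by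
    rw [Nat.cast_sub (by omega)]
    simp
    ring
  exact (congrArg (fun z => aeval z P) h1).trans hn0

/-- The resultant of `P` and `P(x + k)` is a polynomial in `k`. -/
lemma Polynomial.exists_eval_eq_resultant_comp_X_add_C (P : ℤ[X]) :
    ∃ R : ℤ[X], ∀ k : ℤ, R.eval k = resultant P (P.comp (X + C k)) := by
  refine ⟨resultant (P.map C) ((P.map C).comp (X + C X)) P.natDegree P.natDegree, fun k => ?_⟩
  have hC : (evalRingHom k).comp (C : ℤ →+* ℤ[X]) = RingHom.id ℤ := RingHom.ext_int _ _
  rw [← coe_evalRingHom, ← resultant_map_map, map_comp, Polynomial.map_map, hC]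
  rw [natDegree_comp, natDegree_X_add_C, mul_one, Polynomial.map_id, Polynomial.map_add, map_X,
    map_C, coe_evalRingHom, eval_X]

/-- **Lemma (few primes modulo which some shifted product is a square).**
Let `P ∈ ℤ[x]` be irreducible of degree `D ≥ 2` and, for `h ≥ 1`, let
`F_h(x) = ∏_{n=1}^h P(x+n)`. Then there is a constant `C` (depending only on
`P`) such that for every `H ≥ 3`, the set of primes `p` for which `F_h` is the
square of a polynomial modulo `p` for some `0 < h ≤ H` is finite of cardinality
at most `C · H · log H / log log H`. -/
theorem stmt11 (P : Polynomial ℤ) (hirr : Irreducible P) (hD : 2 ≤ P.natDegree) :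
    ∃ C : ℝ, ∀ H : ℕ, 3 ≤ H →
      {p : ℕ | p.Prime ∧ ∃ h : ℕ, 0 < h ∧ h ≤ H ∧
        ∃ g : Polynomial (ZMod p),
          (∏ n ∈ Finset.Icc 1 h, P.comp (X + Polynomial.C (n : ℤ))).map
            (Int.castRingHom (ZMod p)) = g ^ 2}.Finite ∧
      ({p : ℕ | p.Prime ∧ ∃ h : ℕ, 0 < h ∧ h ≤ H ∧
        ∃ g : Polynomial (ZMod p),
          (∏ n ∈ Finset.Icc 1 h, P.comp (X + Polynomial.C (n : ℤ))).map
            (Int.castRingHom (ZMod p)) = g ^ 2}.ncard : ℝ) ≤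
        C * (H : ℝ) * Real.log H / Real.log (Real.log H) := by
  have hD0 : P.natDegree ≠ 0 := by omega
  have hPQ : Irreducible (P.map (Int.castRingHom ℚ)) :=
    (IsPrimitive.Int.irreducible_iff_irreducible_map_cast (hirr.isPrimitive hD0)).1 hirr
  have hder : resultant P (derivative P) ≠ 0 := by
    refine resultant_ne_zero_of_isCoprime_map ?_
    rw [← derivative_map]
    exact hPQ.separable
  have htrans : ∀ k : ℕ, 0 < k → resultant P (P.comp (X + C (k : ℤ))) ≠ 0 := by
    intro k hk
    refine resultant_ne_zero_of_isCoprime_map ?_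
    have := hPQ.isCoprime_comp_X_add_C (k := (k : ℚ)) (by exact_mod_cast hk.ne')
    simpa [map_comp] using this
  have hlc : P.leadingCoeff ≠ 0 := leadingCoeff_ne_zero.2 hirr.ne_zero
  obtain ⟨R, hR⟩ := exists_eval_eq_resultant_comp_X_add_C P
  obtain ⟨S, hS, hRS⟩ := abs_eval_intCast_le R
  obtain ⟨B, hB, hBw⟩ :=
    Real.exists_le_mul_div_log_of_log_factorial_le (S + R.natDegree) (by positivity)
  set bad : Finset ℕ :=
    (P.leadingCoeff * resultant P (derivative P)).natAbs.primeFactors with hbad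
  refine ⟨bad.card + B, fun H hH => ?_⟩
  have hH1 : (1 : ℝ) ≤ H := by exact_mod_cast (by omega : 1 ≤ H)
  have hL : 1 < Real.log H := by
    rw [Real.lt_log_iff_exp_lt (by linarith)]
    have : (3 : ℝ) ≤ H := by exact_mod_cast hH
    linarith [Real.exp_one_lt_three]
  have hLL : 0 < Real.log (Real.log H) := Real.log_pos hL
  set T : Finset ℕ := bad ∪ (Finset.Ico 1 H).biUnion
    fun k => (resultant P (P.comp (X + C (k : ℤ)))).natAbs.primeFactors with hT
  have hmem : ∀ {p : ℕ} {z : ℤ}, p.Prime → (p : ℤ) ∣ z → z ≠ 0 → p ∈ z.natAbs.primeFactors :=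
    fun hp hd hz => Nat.mem_primeFactors.2
      ⟨hp, Int.natCast_dvd.1 hd, Int.natAbs_ne_zero.2 hz⟩
  have hsub : {p : ℕ | p.Prime ∧ ∃ h : ℕ, 0 < h ∧ h ≤ H ∧
        ∃ g : Polynomial (ZMod p),
          (∏ n ∈ Finset.Icc 1 h, P.comp (X + Polynomial.C (n : ℤ))).map
            (Int.castRingHom (ZMod p)) = g ^ 2} ⊆ (T : Set ℕ) := by
    rintro p ⟨hp, h, hh, hhH, g, hg⟩
    rw [Finset.mem_coe, hT, Finset.mem_union, Finset.mem_biUnion]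
    rcases prime_dvd_of_prod_translates_eq_sq hD0 hp hh hg with h1 | h1 | ⟨k, hk, hkh, h1⟩
    · exact Or.inl (hmem hp (h1.mul_right _) (mul_ne_zero hlc hder))
    · exact Or.inl (hmem hp (h1.mul_left _) (mul_ne_zero hlc hder))
    · exact Or.inr ⟨k, Finset.mem_Ico.2 ⟨hk, by omega⟩, hmem hp h1 (htrans k hk)⟩
  refine ⟨T.finite_toSet.subset hsub, ?_⟩
  have hcardT : {p : ℕ | p.Prime ∧ ∃ h : ℕ, 0 < h ∧ h ≤ H ∧
        ∃ g : Polynomial (ZMod p),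
          (∏ n ∈ Finset.Icc 1 h, P.comp (X + Polynomial.C (n : ℤ))).map
            (Int.castRingHom (ZMod p)) = g ^ 2}.ncard ≤ T.card := by
    rw [← Set.ncard_coe_finset]
    exact Set.ncard_le_ncard hsub T.finite_toSet
  have homega : ∀ k ∈ Finset.Ico 1 H,
      (((resultant P (P.comp (X + C (k : ℤ)))).natAbs.primeFactors.card : ℕ) : ℝ) ≤
        B * (Real.log H / Real.log (Real.log H)) := by
    intro k hk
    rw [Finset.mem_Ico] at hk
    refine hBw _ _ hL ?_
    have hne := Int.natAbs_ne_zero.2 (htrans k hk.1)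
    have h1 : (((resultant P (P.comp (X + C (k : ℤ)))).natAbs.primeFactors.card.factorial : ℕ) : ℝ)
        ≤ S * (H : ℝ) ^ R.natDegree := by
      refine le_trans ?_ (hRS k H hk.2.le (by omega))
      rw [hR, ← Int.cast_abs, Int.abs_eq_natAbs, Int.cast_natCast]
      exact_mod_cast Nat.factorial_card_primeFactors_le hne
    have h2 := Real.log_le_log (by positivity) h1
    rw [Real.log_mul hS.ne' (by positivity), Real.log_pow] at h2
    nlinarith [Real.log_le_self hS.le]
  have hX : 1 ≤ Real.log H / Real.log (Real.log H) := by
    rw [one_le_div hLL]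
    exact Real.log_le_self (by linarith)
  calc _ ≤ (T.card : ℝ) := by exact_mod_cast hcardT
    _ ≤ bad.card + ∑ k ∈ Finset.Ico 1 H,
        (((resultant P (P.comp (X + C (k : ℤ)))).natAbs.primeFactors.card : ℕ) : ℝ) := by
      exact_mod_cast (Finset.card_union_le _ _).trans
        (Nat.add_le_add_left Finset.card_biUnion_le _)
    _ ≤ bad.card + ∑ _k ∈ Finset.Ico 1 H, B * (Real.log H / Real.log (Real.log H)) := by
      gcongr with k hk
      exact homega k hk
    _ ≤ bad.card * (H * (Real.log H / Real.log (Real.log H))) +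
        H * (B * (Real.log H / Real.log (Real.log H))) := by
      rw [Finset.sum_const, Nat.card_Ico, nsmul_eq_mul]
      have h3 : ((H - 1 : ℕ) : ℝ) ≤ H := by exact_mod_cast Nat.sub_le H 1
      have h4 : 1 ≤ H * (Real.log H / Real.log (Real.log H)) :=
        one_le_mul_of_one_le_of_one_le hH1 hX
      gcongr
      exact le_mul_of_one_le_right (by positivity) h4
    _ = _ := by ring
end

section
/- Let P(x) = x^d − a ∈ ℤ[x] with d ≥ 2 and a squarefree, a ≠ ±1, and for n ≥ 1 let f_n(x) = P(x)·P(x+1)⋯P(x+n−1) − 1. Let q be a prime divisor of a and let k ≥ 1 be an integer with gcd(d·k, q) = 1. Then q does not divide disc(f_{kq}); equivalently, the reduction of f_{kq} modulo q has nonzero discriminant. -/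
open Polynomial Finset

theorem prod_range_mul_X_add_C_zmod (q k : ℕ) [Fact q.Prime] :
    ∏ j ∈ range (k * q), (X + C (j : ZMod q)) = (X ^ q - X) ^ k := by
  have base : ∏ j ∈ range q, (X + C (j : ZMod q)) = X ^ q - X := by
    have hdeg : (X : (ZMod q)[X]).degree < (q : ℕ) := by
      rw [degree_X]
      exact_mod_cast (Fact.out : q.Prime).one_lt
    have hmonic : (X ^ q - X : (ZMod q)[X]).Monic := monic_X_pow_sub hdeg
    have hroots : (X ^ q - X : (ZMod q)[X]).roots = Finset.univ.val := by
      simpa [ZMod.card] using FiniteField.roots_X_pow_card_sub_X (ZMod q)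
    have hfactor := prod_multiset_X_sub_C_of_monic_of_roots_card_eq hmonic (by
      rw [hroots, FiniteField.X_pow_card_sub_X_natDegree_eq _ (Fact.out : q.Prime).one_lt]
      simp [ZMod.card])
    rw [hroots] at hfactor
    rw [← hfactor]
    change _ = ∏ t : ZMod q, (X - C t)
    rw [← Equiv.prod_comp (Equiv.neg (ZMod q))]
    refine prod_bij (fun j _ => (j : ZMod q)) (by simp) ?_ ?_ (by simp)
    · intro i hi j hj hij
      rw [ZMod.natCast_eq_natCast_iff] at hij
      exact hij.eq_of_lt_of_lt (mem_range.1 hi) (mem_range.1 hj)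
    · exact fun t _ => ⟨t.val, mem_range.2 t.val_lt, ZMod.natCast_zmod_val t⟩
  induction k with
  | zero => simp
  | succ k ih =>
    rw [Nat.succ_mul, prod_range_add, ih, pow_succ, ← base]
    simp

theorem separable_X_pow_sub_X_pow_sub_one (q m : ℕ) [Fact q.Prime] (hm : m.Coprime q) :
    ((X ^ q - X : (ZMod q)[X]) ^ m - 1).Separable := by
  have hm0 : (m : ZMod q) ≠ 0 := by
    rw [Ne, ZMod.natCast_eq_zero_iff]
    exact fun h => (Fact.out : q.Prime).one_lt.ne' (Nat.dvd_one.1 (hm ▸ Nat.dvd_gcd h dvd_rfl))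
  obtain ⟨n, rfl⟩ : ∃ n, m = n + 1 :=
    Nat.exists_eq_succ_of_ne_zero (by rintro rfl; simp at hm0)
  have hC : C ((n + 1 : ℕ) : ZMod q)⁻¹ * ((n + 1 : ℕ) : (ZMod q)[X]) = 1 := by
    rw [← C_eq_natCast, ← C_mul, inv_mul_cancel₀ hm0, C_1]
  have hder : derivative ((X ^ q - X : (ZMod q)[X]) ^ (n + 1) - 1) =
      -(((n + 1 : ℕ) : (ZMod q)[X]) * (X ^ q - X) ^ n) := by
    simp [derivative_pow]
  refine ⟨-1, -(C ((n + 1 : ℕ) : ZMod q)⁻¹ * (X ^ q - X)), ?_⟩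
  rw [hder]
  linear_combination (X ^ q - X) ^ (n + 1) * hC

/-- An integer equal to the discriminant of a monic integer polynomial whose reduction modulo a
prime `q` is separable is not divisible by `q`. -/
theorem not_dvd_prod_sub_sq_of_separable_map (q : ℕ) [Fact q.Prime] {f : ℤ[X]}
    (hsep : (f.map (Int.castRingHom (ZMod q))).Separable) {N : ℕ} (r : Fin N → ℂ)
    (hr : f.map (Int.castRingHom ℂ) = ∏ i, (X - C (r i))) (z : ℤ)
    (hz : (z : ℂ) = ∏ i, ∏ j ∈ Ioi i, (r i - r j) ^ 2) : ¬ (q : ℤ) ∣ z := by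
  intro hdvd
  have hq : q.Prime := Fact.out
  have hmonic : f.Monic := by
    apply monic_of_injective (f := Int.castRingHom ℂ) Int.cast_injective
    rw [hr]
    exact monic_prod_of_monic _ _ fun i _ => monic_X_sub_C _
  have hint : ∀ i, r i ∈ integralClosure ℤ ℂ := fun i => by
    refine ⟨f, hmonic, ?_⟩
    rw [← eval_map, algebraMap_int_eq, hr, eval_prod]
    exact prod_eq_zero (mem_univ i) (by simp)
  let A := integralClosure ℤ ℂ
  let s : Fin N → A := fun i => ⟨r i, hint i⟩
  have hinj : Function.Injective (algebraMap A ℂ) := Subtype.val_injective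
  have hs : f.map (Int.castRingHom A) = ∏ i, (X - C (s i)) := by
    apply map_injective (algebraMap A ℂ) hinj
    rw [Polynomial.map_map, RingHom.eq_intCast' ((algebraMap A ℂ).comp _), hr,
      Polynomial.map_prod]
    simp [s]
  have hzA : (z : A) = ∏ i, ∏ j ∈ Ioi i, (s i - s j) ^ 2 := by
    apply hinj
    simp only [map_intCast, map_prod, map_pow, map_sub, hz]
    rfl
  have : (Ideal.span {(q : ℤ)}).IsMaximal :=
    PrincipalIdealRing.isMaximal_of_irreducible (Nat.prime_iff_prime_int.1 hq).irreducible
  obtain ⟨M, hM, hMq⟩ :=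
    Ideal.exists_maximal_ideal_liesOver_of_isIntegral (Ideal.span {(q : ℤ)}) (S := A)
  let := Ideal.Quotient.field M
  have hqM : ((q : ℤ) : A ⧸ M) = 0 := by
    have h : (q : ℤ) ∈ M.under ℤ := hMq.over ▸ Ideal.mem_span_singleton_self _
    have := Ideal.Quotient.eq_zero_iff_mem.2 (Ideal.mem_comap.1 h)
    simpa using this
  have : CharP (A ⧸ M) q := (CharP.charP_iff_prime_eq_zero hq).2 (by exact_mod_cast hqM)
  have hsepM := hsep.map (f := ZMod.castHom dvd_rfl (A ⧸ M))
  rw [Polynomial.map_map, RingHom.ext_int (RingHom.comp _ _)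
    ((Ideal.Quotient.mk M).comp (Int.castRingHom A)), ← Polynomial.map_map, hs,
    Polynomial.map_prod] at hsepM
  simp only [Polynomial.map_sub, map_X, map_C] at hsepM
  rw [separable_prod_X_sub_C_iff] at hsepM
  have hzM : (z : A ⧸ M) = 0 := by
    obtain ⟨c, rfl⟩ := hdvd
    rw [Int.cast_mul, hqM, zero_mul]
  have hprod := congrArg (Ideal.Quotient.mk M) hzA
  simp only [map_intCast, map_prod, map_pow, map_sub, hzM] at hprod
  refine prod_ne_zero_iff.2 (fun i _ => prod_ne_zero_iff.2 fun j hj => ?_) hprod.symm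
  exact pow_ne_zero _ (sub_ne_zero.2 (hsepM.ne (mem_Ioi.1 hj).ne))

/-- **Lemma (discriminant of `f_{kq}` is nonzero modulo `q`).**
Let `P(x) = x^d − a` with `d ≥ 2`, `a` squarefree, `a ≠ ±1`, and let
`f_n(x) = P(x)P(x+1)⋯P(x+n−1) − 1`. Let `q` be a prime divisor of `a` and
`k ≥ 1` with `gcd(dk, q) = 1`. If `r : Fin (d·k·q) → ℂ` lists the complex roots
(with multiplicity) of the monic polynomial `f_{kq}` of degree `d·k·q`, then
the discriminant `∏_{i<j}(r_i − r_j)²` (an integer `z`) is not divisible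
by `q`. -/
theorem stmt15 (d : ℕ) (hd : 2 ≤ d) (a : ℤ) (hsf : Squarefree a)
    (ha1 : a ≠ 1) (ham : a ≠ -1)
    (q : ℕ) (hq : q.Prime) (hqa : (q : ℤ) ∣ a)
    (k : ℕ) (hk : 1 ≤ k) (hcop : Nat.Coprime (d * k) q)
    (r : Fin (d * k * q) → ℂ)
    (hr : ((∏ j ∈ Finset.range (k * q),
            ((X : Polynomial ℤ) ^ d - Polynomial.C a).comp (X + Polynomial.C (j : ℤ))) - 1).map
          (Int.castRingHom ℂ) =
        ∏ i : Fin (d * k * q), (X - Polynomial.C (r i)))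
    (z : ℤ)
    (hz : (z : ℂ) = ∏ i : Fin (d * k * q), ∏ j ∈ Finset.Ioi i, (r i - r j) ^ 2) :
    ¬ ((q : ℤ) ∣ z) := by
  have : Fact q.Prime := ⟨hq⟩
  refine not_dvd_prod_sub_sq_of_separable_map q ?_ r hr z hz
  have ha : (a : (ZMod q)[X]) = 0 := by
    rw [← C_eq_intCast, (ZMod.intCast_zmod_eq_zero_iff_dvd a q).2 hqa, C_0]
  have hmap : ((∏ j ∈ Finset.range (k * q),
      ((X : ℤ[X]) ^ d - C a).comp (X + C (j : ℤ))) - 1).map (Int.castRingHom (ZMod q)) =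
      (X ^ q - X) ^ (d * k) - 1 := by
    rw [mul_comm d k, pow_mul, ← prod_range_mul_X_add_C_zmod, ← prod_pow]
    simp [Polynomial.map_prod, ha]
  rw [hmap]
  exact separable_X_pow_sub_X_pow_sub_one q (d * k) hcop
end

section
/- Let P(x) = x^d − a ∈ ℤ[x] with d ≥ 2, gcd(d, a) = 1, and a squarefree with a ≠ ±1, and for n ≥ 1 let f_n(x) = P(x)·P(x+1)⋯P(x+n−1) − 1. Let q be a prime divisor of a and let k ≥ 1 be an integer with gcd(k, a) = 1. Then for every complex root β_{kq} of f_{kq}, the polynomial P(x) = x^d − a is irreducible over the field K_{kq} = ℚ(β_{kq}). -/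
open Polynomial Finset

/-- If `K = ℚ(b)` and `f ∈ ℤ[X]` vanishes at `b` while `f'(b) ∉ P`, then `P` is unramified
over `ℤ`: no rational prime lies in `P ^ 2`. -/
theorem natCast_notMem_sq_of_aeval_derivative_notMem {K : Type*} [Field K] [NumberField K]
    (P : Ideal (NumberField.RingOfIntegers K)) (q : ℕ) (hq : q.Prime)
    (b : NumberField.RingOfIntegers K)
    (hb : Algebra.adjoin ℚ {algebraMap (NumberField.RingOfIntegers K) K b} = ⊤)
    (f : ℤ[X]) (hf : aeval b f = 0) (hf' : aeval b (derivative f) ∉ P) :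
    (q : NumberField.RingOfIntegers K) ∉ P ^ 2 := by
  intro hmem
  apply hf'
  have hqp : Prime (q : ℤ) := Nat.prime_iff_prime_int.mp hq
  have : (Ideal.span {(q : ℤ)}).IsMaximal :=
    PrincipalIdealRing.isMaximal_of_irreducible hqp.irreducible
  have hdvd : P ^ (2 - 1) ∣ differentIdeal ℤ (NumberField.RingOfIntegers K) := by
    apply pow_sub_one_dvd_differentIdeal ℤ (p := Ideal.span {(q : ℤ)}) P 2
    · simpa using hq.ne_zero
    · rw [Ideal.map_span, Set.image_singleton, Ideal.dvd_span_singleton]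
      simpa using hmem
  obtain ⟨g, hg⟩ := minpoly.isIntegrallyClosed_dvd
    (Algebra.IsIntegral.isIntegral (R := ℤ) b) hf
  have hm := aeval_derivative_mem_differentIdeal ℤ ℚ K b hb
  have hmP : aeval b (derivative (minpoly ℤ b)) ∈ P :=
    Ideal.dvd_iff_le.mp (by simpa using hdvd) hm
  rw [hg, derivative_mul, map_add, map_mul, map_mul, minpoly.aeval, zero_mul, add_zero]
  exact P.mul_mem_right _ hmP

theorem ZMod.prod_range_X_add_C (q : ℕ) [Fact q.Prime] :
    ∏ j ∈ range q, ((X : (ZMod q)[X]) + C (j : ZMod q)) = X ^ q - X := by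
  have hq1 := (Fact.out : q.Prime).one_lt
  have hroots : (X ^ q - X : (ZMod q)[X]).roots = Finset.univ.val := by
    simpa [ZMod.card] using FiniteField.roots_X_pow_card_sub_X (ZMod q)
  have hmon : (X ^ q - X : (ZMod q)[X]).Monic :=
    monic_X_pow_sub (by simpa using hq1)
  have h := prod_multiset_X_sub_C_of_monic_of_roots_card_eq hmon (by
    rw [hroots, FiniteField.X_pow_card_sub_X_natDegree_eq _ hq1]
    simp [ZMod.card])
  rw [hroots] at h
  rw [← h]
  change _ = ∏ x : ZMod q, (X - C x)
  refine Finset.prod_bij (fun j _ ↦ -(j : ZMod q)) (by simp) ?_ ?_ (by simp)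
  · intro i hi j hj hij
    have := (ZMod.natCast_eq_natCast_iff' i j q).mp (neg_injective hij)
    rwa [Nat.mod_eq_of_lt (mem_range.mp hi), Nat.mod_eq_of_lt (mem_range.mp hj)] at this
  · intro x _
    exact ⟨(-x).val, mem_range.mpr (ZMod.val_lt _), by simp⟩

theorem ZMod.prod_range_mul_X_add_C (q k : ℕ) [Fact q.Prime] :
    ∏ j ∈ range (k * q), ((X : (ZMod q)[X]) + C (j : ZMod q)) = (X ^ q - X) ^ k := by
  induction k with
  | zero => simp
  | succ k ih =>
    rw [Nat.succ_mul, prod_range_add, ih, pow_succ, ← ZMod.prod_range_X_add_C]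
    simp

theorem map_prod_comp_X_add_C_sub_one (d : ℕ) (a : ℤ) (q k : ℕ) [Fact q.Prime]
    (hqa : (q : ℤ) ∣ a) :
    ((∏ j ∈ range (k * q), ((X : ℤ[X]) ^ d - C a).comp (X + C (j : ℤ))) - 1).map
      (Int.castRingHom (ZMod q)) = (X ^ q - X) ^ (k * d) - 1 := by
  have ha : (a : ZMod q) = 0 := (ZMod.intCast_zmod_eq_zero_iff_dvd a q).mpr hqa
  rw [pow_mul, ← ZMod.prod_range_mul_X_add_C, ← prod_pow]
  have ha' : ((a : ℤ) : (ZMod q)[X]) = 0 := by simpa using congrArg (C : ZMod q → (ZMod q)[X]) ha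
  simp [Polynomial.map_prod, ha']

theorem isCoprime_derivative_X_pow_sub_X_pow_sub_one (q m : ℕ) [Fact q.Prime]
    (hm : (m : ZMod q) ≠ 0) :
    IsCoprime ((X ^ q - X) ^ m - 1 : (ZMod q)[X])
      (derivative ((X ^ q - X) ^ m - 1 : (ZMod q)[X])) := by
  have hm0 : m ≠ 0 := by rintro rfl; simp at hm
  have hder : derivative ((X ^ q - X) ^ m - 1 : (ZMod q)[X]) =
      -(C (m : ZMod q) * (X ^ q - X) ^ (m - 1)) := by
    simp [derivative_pow]
  refine ⟨-1, -(C (m : ZMod q)⁻¹ * (X ^ q - X)), ?_⟩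
  have hC : C (m : ZMod q)⁻¹ * C (m : ZMod q) = 1 := by
    rw [← C_mul, inv_mul_cancel₀ hm, C_1]
  rw [hder]
  obtain ⟨n, rfl⟩ := Nat.exists_eq_succ_of_ne_zero hm0
  rw [Nat.succ_sub_one, pow_succ]
  linear_combination ((X ^ q - X) ^ n * (X ^ q - X)) * hC

/-- If the reduction of `f` modulo `q` is separable and `f(b) = 0`, then `f'(b)` lies in no proper
ideal containing `q`. -/
theorem aeval_derivative_notMem_of_isCoprime_map {B : Type*} [CommRing B] (P : Ideal B)
    (hP : P ≠ ⊤) (q : ℕ) (hq : q.Prime) (hqP : (q : B) ∈ P) (f : ℤ[X])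
    (hf : IsCoprime (f.map (Int.castRingHom (ZMod q)))
      (derivative (f.map (Int.castRingHom (ZMod q))))) (b : B) (hb : aeval b f = 0) :
    aeval b (derivative f) ∉ P := by
  intro hmem
  have : Nontrivial (B ⧸ P) := Ideal.Quotient.nontrivial_iff.mpr hP
  have : CharP (B ⧸ P) q := (CharP.charP_iff_prime_eq_zero hq).mpr
    (by simpa using Ideal.Quotient.eq_zero_iff_mem.mpr hqP)
  have key (g : ℤ[X]) : eval₂ (ZMod.castHom dvd_rfl (B ⧸ P)) (Ideal.Quotient.mk P b)
      (g.map (Int.castRingHom (ZMod q))) = Ideal.Quotient.mk P (aeval b g) := by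
    rw [eval₂_map, aeval_def, hom_eval₂]
    congr 1
    exact RingHom.ext_int _ _
  obtain ⟨u, v, huv⟩ := hf
  have h := congrArg (eval₂ (ZMod.castHom dvd_rfl (B ⧸ P)) (Ideal.Quotient.mk P b)) huv
  rw [derivative_map, eval₂_add, eval₂_mul, eval₂_mul, key, key, hb, map_zero,
    Ideal.Quotient.eq_zero_iff_mem.mpr hmem, mul_zero, mul_zero, add_zero, eval₂_one] at h
  exact zero_ne_one h

/-- A monic Eisenstein-type criterion over the ring of integers of a number field. -/
theorem irreducible_X_pow_sub_C_of_mem_of_notMem_sq {K : Type*} [Field K] [NumberField K]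
    (P : Ideal (NumberField.RingOfIntegers K)) [P.IsPrime] (d : ℕ) (hd : d ≠ 0) (a : ℤ)
    (ha : (a : NumberField.RingOfIntegers K) ∈ P)
    (ha2 : (a : NumberField.RingOfIntegers K) ∉ P ^ 2) :
    Irreducible ((X : K[X]) ^ d - C (a : K)) := by
  have hmon : ((X : (NumberField.RingOfIntegers K)[X]) ^ d -
      C (a : NumberField.RingOfIntegers K)).Monic := monic_X_pow_sub_C _ hd
  have hdeg := degree_X_pow_sub_C (Nat.pos_of_ne_zero hd) (a : NumberField.RingOfIntegers K)
  have h : Irreducible ((X : (NumberField.RingOfIntegers K)[X]) ^ d -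
      C (a : NumberField.RingOfIntegers K)) := by
    refine irreducible_of_eisenstein_criterion (P := P) inferInstance ?_ ?_ ?_ ?_
      hmon.isPrimitive
    · rw [hmon.leadingCoeff]
      exact (Ideal.ne_top_iff_one P).mp (Ideal.IsPrime.ne_top inferInstance)
    · intro n hn
      rw [hdeg, Nat.cast_lt] at hn
      rw [coeff_sub, coeff_X_pow, if_neg hn.ne, coeff_C, zero_sub]
      split_ifs <;> simp [ha]
    · rw [hdeg]
      exact_mod_cast Nat.pos_of_ne_zero hd
    · simpa [coeff_X_pow, hd.symm] using ha2
  simpa using (hmon.irreducible_iff_irreducible_map_fraction_map (K := K)).mp h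

/-- **Proposition (irreducibility of `x^d − a` over `ℚ(β_{kq})`).**
Let `P(x) = x^d − a` with `d ≥ 2`, `gcd(d, a) = 1`, `a` squarefree, `a ≠ ±1`,
and let `f_n(x) = P(x)P(x+1)⋯P(x+n−1) − 1`. Let `q` be a prime divisor of `a`
and `k ≥ 1` with `gcd(k, a) = 1`. Then for every complex root `β` of `f_{kq}`,
the polynomial `x^d − a` is irreducible over `K_{kq} = ℚ(β)`. -/
theorem stmt16 (d : ℕ) (hd : 2 ≤ d) (a : ℤ) (hcop : Int.gcd (d : ℤ) a = 1)
    (hsf : Squarefree a) (ha1 : a ≠ 1) (ham : a ≠ -1)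
    (q : ℕ) (hq : q.Prime) (hqa : (q : ℤ) ∣ a)
    (k : ℕ) (hk : 1 ≤ k) (hka : Int.gcd (k : ℤ) a = 1)
    (β : ℂ)
    (hβ : Polynomial.aeval β
        ((∏ j ∈ Finset.range (k * q),
            ((X : Polynomial ℤ) ^ d - Polynomial.C a).comp (X + Polynomial.C (j : ℤ))) - 1) = 0) :
    Irreducible
      ((X : Polynomial (IntermediateField.adjoin ℚ {β} : IntermediateField ℚ ℂ)) ^ d -
        Polynomial.C (a : (IntermediateField.adjoin ℚ {β} : IntermediateField ℚ ℂ))) := by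
  have : Fact q.Prime := ⟨hq⟩
  have hd0 : d ≠ 0 := by lia
  set f : ℤ[X] := (∏ j ∈ Finset.range (k * q),
            ((X : Polynomial ℤ) ^ d - Polynomial.C a).comp (X + Polynomial.C (j : ℤ))) - 1 with hf
  have hqp : Prime (q : ℤ) := Nat.prime_iff_prime_int.mp hq
  have hnot : ∀ m : ℕ, Int.gcd (m : ℤ) a = 1 → (m : ZMod q) ≠ 0 := by
    intro m hm h0
    have h1 : (q : ℤ) ∣ m := by exact_mod_cast (ZMod.natCast_eq_zero_iff m q).mp h0
    exact hqp.not_isUnit (Int.isCoprime_iff_gcd_eq_one.mpr hm |>.isUnit_of_dvd' h1 hqa)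
  have hkd : ((k * d : ℕ) : ZMod q) ≠ 0 := by
    rw [Nat.cast_mul]
    exact mul_ne_zero (hnot k hka) (hnot d hcop)
  have hsep : IsCoprime (f.map (Int.castRingHom (ZMod q)))
      (derivative (f.map (Int.castRingHom (ZMod q)))) := by
    rw [hf, map_prod_comp_X_add_C_sub_one d a q k hqa]
    exact isCoprime_derivative_X_pow_sub_X_pow_sub_one q (k * d) hkd
  have hmon : f.Monic := by
    have hprod : (∏ j ∈ Finset.range (k * q),
        ((X : ℤ[X]) ^ d - C a).comp (X + C (j : ℤ))).Monic :=
      monic_prod_of_monic _ _ fun j _ ↦ (monic_X_pow_sub_C a hd0).comp_X_add_C _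
    refine hprod.sub_of_left ?_
    rw [degree_one, degree_prod]
    have hdeg (j : ℕ) : (((X : ℤ[X]) ^ d - C a).comp (X + C (j : ℤ))).degree = d := by
      rw [degree_eq_natDegree ((monic_X_pow_sub_C a hd0).comp_X_add_C _).ne_zero, natDegree_comp,
        natDegree_X_pow_sub_C, natDegree_X_add_C, mul_one]
    simp only [hdeg, sum_const, card_range]
    rw [nsmul_eq_mul]
    exact_mod_cast Nat.mul_pos (Nat.mul_pos hk hq.pos) (Nat.pos_of_ne_zero hd0)
  have hint : IsIntegral ℤ β := ⟨f, hmon, hβ⟩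
  have hintQ : IsIntegral ℚ β := hint.tower_top
  have : FiniteDimensional ℚ (IntermediateField.adjoin ℚ {β}) :=
    IntermediateField.adjoin.finiteDimensional hintQ
  have : NumberField (IntermediateField.adjoin ℚ {β}) := { }
  let γ : IntermediateField.adjoin ℚ {β} := IntermediateField.AdjoinSimple.gen ℚ β
  have hγ : aeval γ f = 0 := by
    apply (algebraMap (IntermediateField.adjoin ℚ {β}) ℂ).injective
    rw [← aeval_algebraMap_apply, map_zero]
    exact hβ
  let b : NumberField.RingOfIntegers (IntermediateField.adjoin ℚ {β}) := ⟨γ, f, hmon, hγ⟩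
  have hb : aeval b f = 0 := by
    apply NumberField.RingOfIntegers.coe_injective
    rw [← aeval_algebraMap_apply, map_zero]
    exact hγ
  have hgen : Algebra.adjoin ℚ {algebraMap (NumberField.RingOfIntegers
      (IntermediateField.adjoin ℚ {β})) (IntermediateField.adjoin ℚ {β}) b} = ⊤ := by
    have h := (IntermediateField.adjoin.powerBasis hintQ).adjoin_gen_eq_top
    rwa [IntermediateField.adjoin.powerBasis_gen] at h
  have : (Ideal.span {(q : ℤ)}).IsMaximal :=
    PrincipalIdealRing.isMaximal_of_irreducible hqp.irreducible
  obtain ⟨P, hPmax, hPover⟩ := Ideal.exists_maximal_ideal_liesOver_of_isIntegral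
    (S := NumberField.RingOfIntegers (IntermediateField.adjoin ℚ {β})) (Ideal.span {(q : ℤ)})
  have hmemP (n : ℤ) :
      (n : NumberField.RingOfIntegers (IntermediateField.adjoin ℚ {β})) ∈ P ↔ (q : ℤ) ∣ n := by
    rw [← Ideal.mem_span_singleton, Ideal.mem_of_liesOver P (Ideal.span {(q : ℤ)})]
    simp
  have hqP : (q : NumberField.RingOfIntegers (IntermediateField.adjoin ℚ {β})) ∈ P := by
    simpa using (hmemP q).mpr dvd_rfl
  have hq2 := natCast_notMem_sq_of_aeval_derivative_notMem P q hq b hgen f hb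
    (aeval_derivative_notMem_of_isCoprime_map P hPmax.ne_top q hq hqP f hsep b hb)
  refine irreducible_X_pow_sub_C_of_mem_of_notMem_sq P d hd0 a ((hmemP a).mpr hqa) fun ha2 ↦ ?_
  obtain ⟨c, rfl⟩ := hqa
  have hc : (c : NumberField.RingOfIntegers (IntermediateField.adjoin ℚ {β})) ∉ P := by
    rw [hmemP]
    intro h
    exact hqp.not_isUnit (hsf _ (mul_dvd_mul_left _ h))
  rw [Int.cast_mul, Int.cast_natCast, mul_comm] at ha2
  exact (Ideal.IsPrime.mul_mem_pow P ha2).elim hc hq2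
end
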